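/- Let n ≥ 2 be an integer and let φ : ℝ → ℝ be a C^∞ function with |φ| ≤ 1 and φ(s) = 0 for |s| > 1/2. For 0 < δ ≤ 1 and a Schwartz function f on ℝⁿ, define the square function T_δ f(x) = ( ∫_0^∞ | ∫_{ℝⁿ} φ(δ^{−1}(1 − |ξ|²/t²)) f̂(ξ) e^{2πi⟨x,ξ⟩} dξ |² dt/t )^{1/2}. Then for every 2 ≤ p < 2(n+1)/(n−1) there exists a constant C = C(n,p,φ) such that for all 0 < δ ≤ 1 and all Schwartz f, ‖T_δ f‖_{L^p(ℝⁿ)} ≤ C δ^{1/(n+1)} ‖f‖_{L^p(ℝⁿ)}. -/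

import Mathlib

open MeasureTheory Complex Filter
open scoped FourierTransform RealInnerProductSpace ENNReal Topology

/-- The square function
`T_δ f(x) = (∫_0^∞ |∫ φ(δ⁻¹(1 - |ξ|²/t²)) f̂(ξ) e^{2πi⟨x,ξ⟩} dξ|² dt/t)^{1/2}`,
as an extended nonnegative real. -/
noncomputable def squareFn (n : ℕ) (φ : ℝ → ℝ) (δ : ℝ)
    (f : EuclideanSpace ℝ (Fin n) → ℂ) (x : EuclideanSpace ℝ (Fin n)) : ℝ≥0∞ :=
  (∫⁻ t in Set.Ioi (0 : ℝ),
      (‖∫ ξ : EuclideanSpace ℝ (Fin n),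
          ((φ (δ⁻¹ * (1 - ‖ξ‖ ^ 2 / t ^ 2)) : ℝ) : ℂ) * 𝓕 f ξ *
            Complex.exp (2 * Real.pi * Complex.I * (⟪x, ξ⟫ : ℝ))‖₊ : ℝ≥0∞) ^ 2 *
        ENNReal.ofReal t⁻¹) ^ (1 / 2 : ℝ)

namespace SqFn

/-- one-dimensional power integral, truncated at `a`. -/
theorem lintegral_pow_lt (e : ℝ) (he : 0 < e) (a : ℝ≥0∞) :
    ∫⁻ l in Set.Ioi (0:ℝ), (if ENNReal.ofReal l < a then ENNReal.ofReal (l ^ (e - 1)) else 0)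
      = a ^ e / ENNReal.ofReal e := by
  have fin : ∀ b : ℝ, 0 ≤ b → ∫⁻ l in Set.Ioi (0:ℝ),
      (if ENNReal.ofReal l < ENNReal.ofReal b then ENNReal.ofReal (l ^ (e - 1)) else 0)
      = ENNReal.ofReal b ^ e / ENNReal.ofReal e := by
    intro b hb
    have h1 : ∀ l ∈ Set.Ioi (0:ℝ),
        (if ENNReal.ofReal l < ENNReal.ofReal b then ENNReal.ofReal (l ^ (e - 1)) else 0)
        = (Set.Iio b).indicator (fun l => ENNReal.ofReal (l ^ (e - 1))) l := by
      intro l hl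
      have hl' : 0 < l := hl
      by_cases h : l < b
      · have : ENNReal.ofReal l < ENNReal.ofReal b :=
          (ENNReal.ofReal_lt_ofReal_iff (hl'.trans h)).2 h
        simp [this, h]
      · have : ¬ ENNReal.ofReal l < ENNReal.ofReal b :=
          not_lt.2 (ENNReal.ofReal_le_ofReal (not_lt.1 h))
        simp [this, h]
    rw [setLIntegral_congr_fun measurableSet_Ioi h1, lintegral_indicator measurableSet_Iio,
      Measure.restrict_restrict measurableSet_Iio, Set.inter_comm, Set.Ioi_inter_Iio]
    rw [← ofReal_integral_eq_lintegral_ofReal]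
    · rw [← integral_Ioc_eq_integral_Ioo, ← intervalIntegral.integral_of_le hb,
        integral_rpow (Or.inl (by linarith))]
      rw [ENNReal.ofReal_rpow_of_nonneg hb he.le, ← ENNReal.ofReal_div_of_pos he]
      simp [Real.zero_rpow he.ne']
    · have := (intervalIntegral.intervalIntegrable_rpow' (a := 0) (b := b) (r := e - 1)
        (by linarith))
      rw [intervalIntegrable_iff_integrableOn_Ioo_of_le hb] at this
      exact this
    · filter_upwards [ae_restrict_mem measurableSet_Ioo] with l hl
      exact Real.rpow_nonneg hl.1.le _
  by_cases ha : a = ⊤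
  · subst ha
    rw [ENNReal.top_rpow_of_pos he, ENNReal.top_div_of_ne_top ENNReal.ofReal_ne_top]
    refine ENNReal.eq_top_of_forall_nnreal_le fun r => ?_
    obtain ⟨b, hb, hr⟩ : ∃ b : ℝ, 0 ≤ b ∧ b ^ e / e = r := by
      refine ⟨(r * e) ^ (1/e), by positivity, ?_⟩
      rw [← Real.rpow_mul (by positivity)]
      field_simp
      simp
    calc (r : ℝ≥0∞) = ENNReal.ofReal (b ^ e / e) := by rw [hr]; simp
      _ = ENNReal.ofReal b ^ e / ENNReal.ofReal e := by
          rw [ENNReal.ofReal_rpow_of_nonneg hb he.le, ← ENNReal.ofReal_div_of_pos he]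
      _ = _ := (fin b hb).symm
      _ ≤ _ := by
        apply lintegral_mono
        intro l
        dsimp only
        split_ifs <;> simp_all
  · have := fin a.toReal ENNReal.toReal_nonneg
    rwa [ENNReal.ofReal_toReal ha] at this

/-- layer cake for extended nonnegative functions -/
theorem layercake {X : Type*} [MeasurableSpace X] (μ : Measure X) [SFinite μ] (g : X → ℝ≥0∞)
    (hg : Measurable g) (p : ℝ) (hp : 0 < p) :
    ∫⁻ x, g x ^ p ∂μ = ENNReal.ofReal p * ∫⁻ l in Set.Ioi (0:ℝ),
      ENNReal.ofReal (l ^ (p - 1)) * μ {x | ENNReal.ofReal l < g x} := by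
  have hp0 : ENNReal.ofReal p ≠ 0 := by simpa using hp
  have : ∀ x, g x ^ p = ENNReal.ofReal p * ∫⁻ l in Set.Ioi (0:ℝ),
      (if ENNReal.ofReal l < g x then ENNReal.ofReal (l ^ (p - 1)) else 0) := by
    intro x
    rw [lintegral_pow_lt p hp, ENNReal.mul_div_cancel hp0 ENNReal.ofReal_ne_top]
  simp_rw [this]
  have hm : Measurable (fun z : X × ℝ =>
      if ENNReal.ofReal z.2 < g z.1 then ENNReal.ofReal (z.2 ^ (p - 1)) else 0) := by
    apply Measurable.ite
    · exact measurableSet_lt (by fun_prop) (by fun_prop)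
    · fun_prop
    · fun_prop
  rw [lintegral_const_mul _ hm.lintegral_prod_right', lintegral_lintegral_swap hm.aemeasurable]
  congr 1
  apply lintegral_congr
  intro l
  have : (fun x => if ENNReal.ofReal l < g x then ENNReal.ofReal (l ^ (p - 1)) else 0)
     = ({x | ENNReal.ofReal l < g x}).indicator (fun _ => ENNReal.ofReal (l ^ (p - 1))) := by
    ext x; simp [Set.indicator]
  rw [this, lintegral_indicator_const (measurableSet_lt (by fun_prop) hg)]

/-- Marcinkiewicz-type inequality -/
theorem marcin {X Y ι : Type*} [MeasurableSpace X] [MeasurableSpace Y] (μ : Measure X) [SFinite μ]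
    (ν : Measure Y) [SFinite ν] (s : Finset ι) (g : ι → X → ℝ≥0∞) (f : Y → ℝ≥0∞)
    (hg : ∀ k, Measurable (g k)) (hf : Measurable f) (r p c : ℝ) (C : ℝ≥0∞) (hr : 0 < r) (hrp : r < p)
    (hc : 0 < c)
    (h : ∀ l : ℝ, 0 < l → ∑ k ∈ s, μ {x | ENNReal.ofReal l < g k x} ≤
      C * ENNReal.ofReal (l ^ (-r)) * ∫⁻ y in {y | ENNReal.ofReal (c * l) < f y}, f y ^ r ∂ν) :
    ∑ k ∈ s, ∫⁻ x, g k x ^ p ∂μ ≤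
      ENNReal.ofReal p * C * ENNReal.ofReal (c ^ (r - p) / (p - r)) * ∫⁻ y, f y ^ p ∂ν := by
  have hp : 0 < p := hr.trans hrp
  have hm : Measurable (fun z : Y × ℝ =>
      if ENNReal.ofReal (c * z.2) < f z.1 then ENNReal.ofReal (z.2 ^ (p - r - 1)) * f z.1 ^ r
        else 0) := by
    apply Measurable.ite
    · exact measurableSet_lt (by fun_prop) (by fun_prop)
    · fun_prop
    · fun_prop
  have hm2 : ∀ k, Measurable fun l : ℝ =>
      ENNReal.ofReal (l ^ (p - 1)) * μ {x | ENNReal.ofReal l < g k x} := by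
    intro k
    apply Measurable.mul (by fun_prop)
    apply Antitone.measurable
    intro a b hab
    apply measure_mono
    intro x hx
    exact lt_of_le_of_lt (ENNReal.ofReal_le_ofReal hab) hx
  calc ∑ k ∈ s, ∫⁻ x, g k x ^ p ∂μ = ∑ k ∈ s, ENNReal.ofReal p * ∫⁻ l in Set.Ioi (0:ℝ),
      ENNReal.ofReal (l ^ (p - 1)) * μ {x | ENNReal.ofReal l < g k x} :=
        Finset.sum_congr rfl fun k _ => layercake μ (g k) (hg k) p hp
    _ = ENNReal.ofReal p * ∫⁻ l in Set.Ioi (0:ℝ), ∑ k ∈ s,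
      ENNReal.ofReal (l ^ (p - 1)) * μ {x | ENNReal.ofReal l < g k x} := by
        rw [← Finset.mul_sum, lintegral_finsetSum]
        intro k _
        exact hm2 k
    _ ≤ ENNReal.ofReal p * ∫⁻ l in Set.Ioi (0:ℝ), C * ∫⁻ y,
         (if ENNReal.ofReal (c * l) < f y then ENNReal.ofReal (l ^ (p - r - 1)) * f y ^ r
        else 0) ∂ν := by
        gcongr ENNReal.ofReal p * ?_
        apply setLIntegral_mono' measurableSet_Ioi
        intro l hl
        have hl' : 0 < l := hl
        rw [← Finset.mul_sum]
        calc _ ≤ ENNReal.ofReal (l ^ (p - 1)) * (C * ENNReal.ofReal (l ^ (-r)) *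
              ∫⁻ y in {y | ENNReal.ofReal (c * l) < f y}, f y ^ r ∂ν) := by
              gcongr
              exact h l hl
          _ = C * (ENNReal.ofReal (l ^ (p - r - 1)) *
              ∫⁻ y in {y | ENNReal.ofReal (c * l) < f y}, f y ^ r ∂ν) := by
              have : l ^ (p - r - 1) = l ^ (p - 1) * l ^ (-r) := by
                rw [← Real.rpow_add hl']; ring_nf
              rw [this, ENNReal.ofReal_mul (p := l ^ (p - 1)) (by positivity)]
              ring
          _ = _ := by
            congr 1
            rw [← lintegral_const_mul _ (by fun_prop),
              ← lintegral_indicator (measurableSet_lt (by fun_prop) hf)]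
            apply lintegral_congr
            intro y
            simp [Set.indicator]
    _ = ENNReal.ofReal p * C * ∫⁻ y, (∫⁻ l in Set.Ioi (0:ℝ),
         (if ENNReal.ofReal (c * l) < f y then ENNReal.ofReal (l ^ (p - r - 1)) * f y ^ r
        else 0)) ∂ν := by
        rw [lintegral_const_mul _ (Measurable.lintegral_prod_left' hm), mul_assoc]
        rw [lintegral_lintegral_swap]
        exact (hm.comp measurable_swap).aemeasurable
    _ = ENNReal.ofReal p * C * ∫⁻ y, ENNReal.ofReal (c ^ (r - p) / (p - r)) * f y ^ p ∂ν := by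
        congr 1
        apply lintegral_congr
        intro y
        have e1 : ∀ l : ℝ, (if ENNReal.ofReal (c * l) < f y then
            ENNReal.ofReal (l ^ (p - r - 1)) * f y ^ r else 0) =
            f y ^ r * (if ENNReal.ofReal l < f y / ENNReal.ofReal c then
              ENNReal.ofReal (l ^ (p - r - 1)) else 0) := by
          intro l
          have : ENNReal.ofReal (c * l) < f y ↔ ENNReal.ofReal l < f y / ENNReal.ofReal c := by
            rw [ENNReal.lt_div_iff_mul_lt (Or.inl (by simpa using hc))
              (Or.inl ENNReal.ofReal_ne_top), ENNReal.ofReal_mul hc.le, mul_comm]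
          simp only [this]
          split_ifs
          · ring
          · simp
        simp_rw [e1]
        rw [lintegral_const_mul, lintegral_pow_lt (p - r) (by linarith)]
        · rw [ENNReal.div_rpow_of_nonneg _ _ (by linarith)]
          rw [ENNReal.ofReal_div_of_pos (by linarith)]
          have : f y ^ p = f y ^ r * f y ^ (p - r) := by
            rw [← ENNReal.rpow_add_of_nonneg _ _ hr.le (by linarith)]; ring_nf
          rw [this]
          have : ENNReal.ofReal (c ^ (r - p)) = (ENNReal.ofReal c ^ (p - r))⁻¹ := by
            rw [← ENNReal.rpow_neg, ENNReal.ofReal_rpow_of_pos hc]; ring_nf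
          rw [this]
          simp only [div_eq_mul_inv]
          ring
        · apply Measurable.ite
          · exact measurableSet_lt (by fun_prop) (by fun_prop)
          · fun_prop
          · fun_prop
    _ = _ := by
        rw [lintegral_const_mul _ (by fun_prop)]
        ring

/-- absorbing inequality -/
theorem absorb (X A : ℝ≥0∞) (q : ℝ) (hq : 1 < q) (hX : X ≠ ⊤) (h : X ≤ A * X ^ (1 - 1/q)) :
    X ≤ A ^ q := by
  by_cases hX0 : X = 0
  · simp [hX0]
  have h1 : X = X ^ (1/q) * X ^ (1 - 1/q) := by
    rw [← ENNReal.rpow_add _ _ hX0 hX]; simp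
  have h2 : X ^ (1/q) ≤ A := by
    have hne : X ^ (1 - 1/q) ≠ 0 := by
      simp [ENNReal.rpow_eq_zero_iff, hX0, hX]
    have hnt : X ^ (1 - 1/q) ≠ ⊤ := by
      simp [ENNReal.rpow_eq_top_iff, hX0, hX]
    have h3 : X ^ (1/q) * X ^ (1 - 1/q) ≤ A * X ^ (1 - 1/q) := by rw [← h1]; exact h
    exact (ENNReal.mul_le_mul_iff_left hne hnt).1 h3
  calc X = (X ^ (1/q)) ^ q := by
        rw [← ENNReal.rpow_mul]; field_simp; simp
    _ ≤ A ^ q := ENNReal.rpow_le_rpow h2 (by linarith)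

/-- Hoelder in the form used with powers `q - 1`. -/
theorem holder_q {X : Type*} [MeasurableSpace X] (μ : Measure X) (u g : X → ℝ≥0∞)
    (hu : AEMeasurable u μ) (hg : AEMeasurable g μ) (q : ℝ) (hq : 1 < q) :
    ∫⁻ x, u x * g x ^ (q - 1) ∂μ ≤ (∫⁻ x, u x ^ q ∂μ) ^ (1/q) * (∫⁻ x, g x ^ q ∂μ) ^ (1 - 1/q) := by
  have hc : q.HolderConjugate (q / (q - 1)) := Real.HolderConjugate.conjExponent hq
  have := ENNReal.lintegral_mul_le_Lp_mul_Lq μ hc hu (hg.pow_const (q - 1))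
  refine this.trans (le_of_eq ?_)
  have hq1 : q - 1 ≠ 0 := by linarith
  have hq0 : q ≠ 0 := by linarith
  congr 2
  · apply lintegral_congr
    intro x
    rw [← ENNReal.rpow_mul]
    congr 1
    field_simp
  · field_simp

/-- Minkowski's integral inequality, a priori finite version -/
theorem minkowski {X T : Type*} [MeasurableSpace X] [MeasurableSpace T] (μ : Measure X) [SFinite μ]
    (τ : Measure T) [SFinite τ] (H : T → X → ℝ≥0∞) (hH : Measurable (Function.uncurry H))
    (q : ℝ) (hq : 1 < q) (hfin : ∫⁻ x, (∫⁻ t, H t x ∂τ) ^ q ∂μ ≠ ⊤) :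
    ∫⁻ x, (∫⁻ t, H t x ∂τ) ^ q ∂μ ≤ (∫⁻ t, (∫⁻ x, H t x ^ q ∂μ) ^ (1/q) ∂τ) ^ q := by
  apply absorb _ _ q hq hfin
  set G := fun x => ∫⁻ t, H t x ∂τ with hG
  have hGm : Measurable G := Measurable.lintegral_prod_left' hH
  have hHt : ∀ t, Measurable (H t) := fun t => hH.comp measurable_prodMk_left
  have hHx : ∀ x, Measurable (fun t => H t x) := fun x => hH.comp measurable_prodMk_right
  calc ∫⁻ x, G x ^ q ∂μ = ∫⁻ x, ∫⁻ t, H t x * G x ^ (q - 1) ∂τ ∂μ := by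
        apply lintegral_congr
        intro x
        rw [lintegral_mul_const _ (hHx x)]
        change G x ^ q = G x * G x ^ (q - 1)
        conv_rhs => rw [← ENNReal.rpow_one (G x), ← ENNReal.rpow_mul, one_mul,
          ← ENNReal.rpow_add_of_nonneg _ _ (by norm_num) (by linarith)]
        ring_nf
    _ = ∫⁻ t, ∫⁻ x, H t x * G x ^ (q - 1) ∂μ ∂τ := by
        rw [lintegral_lintegral_swap]
        apply Measurable.aemeasurable
        apply Measurable.mul
        · exact hH.comp measurable_swap
        · fun_prop
    _ ≤ ∫⁻ t, (∫⁻ x, H t x ^ q ∂μ) ^ (1/q) * (∫⁻ x, G x ^ q ∂μ) ^ (1 - 1/q) ∂τ := by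
        apply lintegral_mono
        intro t
        exact holder_q μ (H t) G (hHt t).aemeasurable hGm.aemeasurable q hq
    _ = _ := by
        rw [lintegral_mul_const]
        apply Measurable.pow_const
        exact Measurable.lintegral_prod_right' (f := fun z : T × X => H z.1 z.2 ^ q) (hH.pow_const q)

end SqFn

namespace SqFn

/-- Euclidean space. -/
abbrev V (n : ℕ) := EuclideanSpace ℝ (Fin n)

/-- The dyadic centred maximal function. -/
noncomputable def Mx (n : ℕ) (u : V n → ℝ≥0∞) (x : V n) : ℝ≥0∞ :=
  ⨆ j : ℤ, ENNReal.ofReal (((2:ℝ) ^ j) ^ n)⁻¹ * ∫⁻ y in Metric.ball x ((2:ℝ) ^ j), u y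

theorem measurable_ball_int {n : ℕ} (u : V n → ℝ≥0∞) (hu : Measurable u) (r : ℝ) :
    Measurable (fun x => ∫⁻ y in Metric.ball x r, u y) := by
  have : ∀ x, ∫⁻ y in Metric.ball x r, u y = ∫⁻ y, (if dist y x < r then u y else 0) := by
    intro x
    rw [← lintegral_indicator measurableSet_ball]
    rfl
  simp_rw [this]
  apply Measurable.lintegral_prod_right'
    (f := fun z : V n × V n => if dist z.2 z.1 < r then u z.2 else 0)
  apply Measurable.ite
  · exact measurableSet_lt (by fun_prop) (by fun_prop)
  · fun_prop
  · fun_prop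

theorem measurable_Mx {n : ℕ} (u : V n → ℝ≥0∞) (hu : Measurable u) : Measurable (Mx n u) := by
  unfold Mx
  exact Measurable.iSup fun j => (measurable_ball_int u hu _).const_mul _

/-- volume of the unit ball -/
noncomputable def vb (n : ℕ) : ℝ≥0∞ := volume (Metric.ball (0 : V n) 1)

theorem vb_ne_top (n : ℕ) : vb n ≠ ⊤ := measure_ball_lt_top.ne
theorem vb_pos (n : ℕ) : 0 < vb n := Metric.measure_ball_pos _ _ one_pos

theorem vol_ball {n : ℕ} (x : V n) {r : ℝ} (hr : 0 < r) :
    volume (Metric.ball x r) = ENNReal.ofReal (r ^ n) * vb n := by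
  rw [Measure.addHaar_ball_of_pos _ _ hr]; simp [vb]

theorem vol_closedBall {n : ℕ} (x : V n) {r : ℝ} (hr : 0 ≤ r) :
    volume (Metric.closedBall x r) = ENNReal.ofReal (r ^ n) * vb n := by
  rw [Measure.addHaar_closedBall _ _ hr]; simp [vb]

theorem weak11 {n : ℕ} (u : V n → ℝ≥0∞) (l : ℝ) (hl : 0 < l) :
    volume {x | ENNReal.ofReal l < Mx n u x} ≤
      ENNReal.ofReal (4 ^ n) * vb n * ENNReal.ofReal l⁻¹ * ∫⁻ y, u y := by
  set A : V n × ℤ → Prop := fun z => ENNReal.ofReal l * ENNReal.ofReal (((2:ℝ) ^ z.2) ^ n) <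
    ∫⁻ y in Metric.ball z.1 ((2:ℝ) ^ z.2), u y with hA
  have key : ∀ J : ℕ, volume {x | ∃ j : ℤ, j ≤ J ∧ A (x, j)} ≤
      ENNReal.ofReal (4 ^ n) * vb n * ENNReal.ofReal l⁻¹ * ∫⁻ y, u y := by
    intro J
    obtain ⟨w, hwt, hdis, hcov⟩ := Vitali.exists_disjoint_subfamily_covering_enlargement_closedBall
      {z : V n × ℤ | z.2 ≤ J ∧ A z} (fun z => z.1) (fun z => (2:ℝ) ^ z.2) ((2:ℝ) ^ (J:ℤ))
      (by rintro ⟨x, j⟩ ⟨h, -⟩; exact zpow_le_zpow_right₀ (by norm_num) h) 4 (by norm_num)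
    have hwc : w.Countable := by
      apply hdis.countable_of_nonempty_interior
      rintro ⟨x, j⟩ -
      have : (0:ℝ) < 2 ^ j := by positivity
      refine ⟨x, ?_⟩
      exact Metric.ball_subset_interior_closedBall (Metric.mem_ball_self this)
    have : Countable w := hwc.to_subtype
    have hsub : {x | ∃ j : ℤ, j ≤ J ∧ A (x, j)} ⊆
        ⋃ b : w, Metric.closedBall (b.1.1) (4 * (2:ℝ) ^ (b.1.2)) := by
      rintro x ⟨j, hj, hx⟩
      obtain ⟨b, hb, hs⟩ := hcov (x, j) ⟨hj, hx⟩
      refine Set.mem_iUnion.2 ⟨⟨b, hb⟩, hs ?_⟩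
      exact Metric.mem_closedBall_self (by positivity)
    calc volume {x | ∃ j : ℤ, j ≤ J ∧ A (x, j)}
        ≤ ∑' b : w, volume (Metric.closedBall (b.1.1) (4 * (2:ℝ) ^ (b.1.2))) :=
          (measure_mono hsub).trans (measure_iUnion_le _)
      _ ≤ ∑' b : w, ENNReal.ofReal (4 ^ n) * vb n * ENNReal.ofReal l⁻¹ *
            ∫⁻ y in Metric.ball b.1.1 ((2:ℝ) ^ b.1.2), u y := by
          refine ENNReal.tsum_le_tsum fun b => ?_
          have hb := (hwt b.2).2
          rw [vol_closedBall _ (by positivity), mul_pow, ENNReal.ofReal_mul (by positivity)]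
          have h1 : ENNReal.ofReal (((2:ℝ) ^ b.1.2) ^ n) ≤ ENNReal.ofReal l⁻¹ *
            ∫⁻ y in Metric.ball b.1.1 ((2:ℝ) ^ b.1.2), u y := by
            calc ENNReal.ofReal (((2:ℝ) ^ b.1.2) ^ n)
                = ENNReal.ofReal l⁻¹ *
                  (ENNReal.ofReal l * ENNReal.ofReal (((2:ℝ) ^ b.1.2) ^ n)) := by
                  rw [← mul_assoc, ← ENNReal.ofReal_mul (by positivity), inv_mul_cancel₀ hl.ne']
                  rw [ENNReal.ofReal_one, one_mul]
              _ ≤ _ := by gcongr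
          calc _ = ENNReal.ofReal (4 ^ n) * vb n * ENNReal.ofReal (((2:ℝ) ^ b.1.2) ^ n) := by ring
            _ ≤ ENNReal.ofReal (4 ^ n) * vb n * (ENNReal.ofReal l⁻¹ *
              ∫⁻ y in Metric.ball b.1.1 ((2:ℝ) ^ b.1.2), u y) := by gcongr
            _ = _ := by ring
      _ = ENNReal.ofReal (4 ^ n) * vb n * ENNReal.ofReal l⁻¹ *
            ∑' b : w, ∫⁻ y in Metric.ball b.1.1 ((2:ℝ) ^ b.1.2), u y := ENNReal.tsum_mul_left
      _ ≤ _ := by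
          gcongr
          rw [← lintegral_iUnion (fun b => measurableSet_ball)]
          · exact setLIntegral_le_lintegral _ _
          · intro a b hab
            have := hdis a.2 b.2 (fun h => hab (Subtype.ext h))
            exact this.mono Metric.ball_subset_closedBall Metric.ball_subset_closedBall
  have hU : {x | ENNReal.ofReal l < Mx n u x} ⊆ ⋃ J : ℕ, {x | ∃ j : ℤ, j ≤ J ∧ A (x, j)} := by
    intro x hx
    obtain ⟨j, hj⟩ := lt_iSup_iff.1 (show ENNReal.ofReal l < Mx n u x from hx)
    refine Set.mem_iUnion.2 ⟨j.toNat, j, Int.self_le_toNat j, ?_⟩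
    have hw : (0:ℝ) < ((2:ℝ) ^ j) ^ n := by positivity
    have h0 : ENNReal.ofReal (((2:ℝ) ^ j) ^ n) ≠ 0 := by simpa using hw
    rw [ENNReal.ofReal_inv_of_pos hw, mul_comm, ← div_eq_mul_inv,
      ENNReal.lt_div_iff_mul_lt (Or.inl h0) (Or.inl ENNReal.ofReal_ne_top)] at hj
    exact hj
  have hmono : Monotone (fun J : ℕ => {x | ∃ j : ℤ, j ≤ J ∧ A (x, j)}) := by
    intro J K hJK x ⟨j, hj, hx⟩
    exact ⟨j, hj.trans (by exact_mod_cast hJK), hx⟩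
  calc _ ≤ volume (⋃ J : ℕ, {x | ∃ j : ℤ, j ≤ J ∧ A (x, j)}) := measure_mono hU
    _ = ⨆ J, volume {x | ∃ j : ℤ, j ≤ ((J:ℕ):ℤ) ∧ A (x, j)} := hmono.measure_iUnion
    _ ≤ _ := iSup_le key

theorem Mx_mono {n : ℕ} {u v : V n → ℝ≥0∞} (h : u ≤ v) : Mx n u ≤ Mx n v := by
  intro x
  exact iSup_mono fun j => by gcongr; exact h _

theorem Mx_add_le {n : ℕ} (u : V n → ℝ≥0∞) (hu : Measurable u) (c : ℝ≥0∞) (x : V n) :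
    Mx n (fun y => u y + c) x ≤ Mx n u x + c * vb n := by
  refine iSup_le fun j => ?_
  rw [lintegral_add_left hu, mul_add]
  have hw : (0:ℝ) < ((2:ℝ) ^ j) ^ n := by positivity
  refine add_le_add (le_iSup (fun j : ℤ => ENNReal.ofReal (((2:ℝ) ^ j) ^ n)⁻¹ *
    ∫⁻ y in Metric.ball x ((2:ℝ) ^ j), u y) j) ?_
  rw [setLIntegral_const, vol_ball _ (by positivity)]
  have : ENNReal.ofReal (((2:ℝ) ^ j) ^ n)⁻¹ * ENNReal.ofReal (((2:ℝ) ^ j) ^ n) = 1 := by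
    rw [← ENNReal.ofReal_mul (by positivity), inv_mul_cancel₀ hw.ne']; simp
  calc _ = (ENNReal.ofReal (((2:ℝ) ^ j) ^ n)⁻¹ * ENNReal.ofReal (((2:ℝ) ^ j) ^ n)) * (c * vb n) := by
        ring
    _ ≤ _ := by rw [this, one_mul]

theorem Mx_Lp (n : ℕ) (s : ℝ) (hs : 1 < s) : ∃ C : ℝ, 0 < C ∧ ∀ u : V n → ℝ≥0∞, Measurable u →
    ∫⁻ x, Mx n u x ^ s ≤ ENNReal.ofReal C * ∫⁻ x, u x ^ s := by
  set v := (vb n).toReal with hv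
  have hv0 : 0 < v := ENNReal.toReal_pos (vb_pos n).ne' (vb_ne_top n)
  have hvv : vb n = ENNReal.ofReal v := (ENNReal.ofReal_toReal (vb_ne_top n)).symm
  set c : ℝ := (2 * v)⁻¹ with hc
  have hc0 : 0 < c := by positivity
  refine ⟨s * (4 ^ n * v * 2) * (c ^ (1 - s) / (s - 1)), ?_, fun u hu => ?_⟩
  · have : 0 < s - 1 := by linarith
    positivity
  have h := marcin (volume : Measure (V n)) (volume : Measure (V n)) {()} (fun _ => Mx n u) u
    (fun _ => measurable_Mx u hu) hu 1 s c (ENNReal.ofReal (4 ^ n * v * 2)) one_pos hs hc0 ?_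
  · simp only [Finset.sum_singleton] at h
    refine h.trans (le_of_eq ?_)
    have : 0 < s - 1 := by linarith
    rw [← ENNReal.ofReal_mul (by positivity), ← ENNReal.ofReal_mul (by positivity)]
  · intro l hl
    simp only [Finset.sum_singleton]
    set E := {y | ENNReal.ofReal (c * l) < u y} with hE
    have hEm : MeasurableSet E := measurableSet_lt (by fun_prop) hu
    have hsub : {x | ENNReal.ofReal l < Mx n u x} ⊆
        {x | ENNReal.ofReal (l / 2) < Mx n (E.indicator u) x} := by
      intro x hx
      have h1 : Mx n u x ≤ Mx n (E.indicator u) x + ENNReal.ofReal (c * l) * vb n := by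
        refine le_trans (Mx_mono ?_ x) (Mx_add_le (E.indicator u) (hu.indicator hEm) _ x)
        intro y
        by_cases hy : y ∈ E
        · simp [hy]
        · simpa [hy] using not_lt.1 hy
      rw [hvv, ← ENNReal.ofReal_mul (by positivity),
        show c * l * v = l / 2 by rw [hc]; field_simp] at h1
      have hx' : ENNReal.ofReal l < Mx n u x := hx
      by_contra hcon
      have hcon' : Mx n (E.indicator u) x ≤ ENNReal.ofReal (l / 2) := not_lt.1 hcon
      have := hx'.trans_le (h1.trans (add_le_add_left hcon' _))
      rw [← ENNReal.ofReal_add (by positivity) (by positivity), add_halves] at this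
      exact lt_irrefl _ this
    refine (measure_mono hsub).trans ((weak11 _ _ (by positivity)).trans (le_of_eq ?_))
    rw [lintegral_indicator hEm, hvv, ← ENNReal.ofReal_mul (by positivity),
      ← ENNReal.ofReal_mul (by positivity), ← ENNReal.ofReal_mul (by positivity)]
    simp only [ENNReal.rpow_one]
    congr 2
    rw [Real.rpow_neg_one]
    field_simp

/-- The kernel `R^n (1 + R|x|)^{-(n+1)}`. -/
noncomputable def kap (n : ℕ) (R : ℝ) (x : V n) : ℝ≥0∞ :=
  ENNReal.ofReal (R ^ n / (1 + R * ‖x‖) ^ (n + 1))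

/-- Convolution with `kap`. -/
noncomputable def cv (n : ℕ) (R : ℝ) (u : V n → ℝ≥0∞) (x : V n) : ℝ≥0∞ :=
  ∫⁻ y, kap n R (x - y) * u y

theorem measurable_kap (n : ℕ) (R : ℝ) : Measurable (kap n R) := by
  unfold kap; fun_prop

theorem measurable_cv {n : ℕ} (R : ℝ) (u : V n → ℝ≥0∞) (hu : Measurable u) :
    Measurable (cv n R u) := by
  have := measurable_kap n R
  unfold cv
  apply Measurable.lintegral_prod_right'
    (f := fun z : V n × V n => kap n R (z.1 - z.2) * u z.2)
  fun_prop

theorem kap_le (n : ℕ) (R : ℝ) (k : ℤ) (h1 : (2:ℝ) ^ k ≤ R) (h2 : R ≤ 2 ^ (k + 1)) (z : V n) :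
    kap n R z ≤ ∑' i : ℕ, ENNReal.ofReal (2 ^ (2 * n + 1)) * ENNReal.ofReal ((1/2) ^ i) *
      (ENNReal.ofReal (((2:ℝ) ^ ((i:ℤ) - k)) ^ n)⁻¹ *
        (Metric.ball (0 : V n) ((2:ℝ) ^ ((i:ℤ) - k))).indicator 1 z) := by
  have hk : (0:ℝ) < 2 ^ k := by positivity
  have hR : 0 < R := hk.trans_le h1
  have hex : ∃ i : ℕ, (2:ℝ) ^ k * ‖z‖ < 2 ^ i := pow_unbounded_of_one_lt _ (by norm_num)
  classical
  set i := Nat.find hex with hi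
  have hi1 : (2:ℝ) ^ k * ‖z‖ < 2 ^ i := Nat.find_spec hex
  have hpow : (2:ℝ) ^ ((i:ℤ) - k) = 2 ^ i / 2 ^ k := by
    rw [zpow_sub₀ (by norm_num)]; simp
  have hz : z ∈ Metric.ball (0 : V n) ((2:ℝ) ^ ((i:ℤ) - k)) := by
    rw [mem_ball_zero_iff, hpow, lt_div_iff₀ hk, mul_comm]; exact hi1
  refine le_trans ?_ (ENNReal.le_tsum i)
  rw [Set.indicator_of_mem hz, Pi.one_apply, mul_one, ← ENNReal.ofReal_mul (by positivity),
    ← ENNReal.ofReal_mul (by positivity), kap]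
  apply ENNReal.ofReal_le_ofReal
  have hRn : R ^ n ≤ 2 ^ n * ((2:ℝ) ^ k) ^ n := by
    rw [← mul_pow]; gcongr; rw [zpow_add₀ (by norm_num)] at h2; linarith
  have hden : (2:ℝ) ^ i ≤ 2 * (1 + R * ‖z‖) := by
    rcases Nat.eq_zero_or_pos i with h0 | h0
    · rw [h0]
      have : 0 ≤ R * ‖z‖ := by positivity
      simp; linarith
    · have := Nat.find_min hex (m := i - 1) (by omega)
      have h3 : (2:ℝ) ^ (i - 1) ≤ 2 ^ k * ‖z‖ := not_lt.1 this
      have h4 : (2:ℝ) ^ i = 2 * 2 ^ (i - 1) := by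
        rw [← pow_succ']; congr 1; omega
      have h5 : (2:ℝ) ^ k * ‖z‖ ≤ R * ‖z‖ := by gcongr
      linarith
  have hd0 : 0 < 1 + R * ‖z‖ := by positivity
  rw [hpow, div_le_iff₀ (by positivity)]
  have h6 : ((2:ℝ) ^ i) ^ (n + 1) ≤ 2 ^ (n + 1) * (1 + R * ‖z‖) ^ (n + 1) := by
    rw [← mul_pow]; gcongr
  have e : (2:ℝ) ^ (2 * n + 1) * (1 / 2) ^ i * ((2 ^ i / 2 ^ k) ^ n)⁻¹ * (1 + R * ‖z‖) ^ (n + 1)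
      = 2 ^ n * ((2:ℝ) ^ k) ^ n * ((2 ^ (n + 1) * (1 + R * ‖z‖) ^ (n + 1)) / ((2:ℝ) ^ i) ^ (n + 1)) := by
    rw [div_pow, div_pow]
    field_simp
    ring
  rw [e]
  have h7 : 1 ≤ (2 ^ (n + 1) * (1 + R * ‖z‖) ^ (n + 1)) / ((2:ℝ) ^ i) ^ (n + 1) := by
    rw [le_div_iff₀ (by positivity), one_mul]; exact h6
  calc R ^ n ≤ 2 ^ n * ((2:ℝ) ^ k) ^ n * 1 := by rw [mul_one]; exact hRn
    _ ≤ _ := by gcongr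

theorem cv_le_Mx {n : ℕ} (R : ℝ) (hR : 0 < R) (u : V n → ℝ≥0∞) (hu : Measurable u) (x : V n) :
    cv n R u x ≤ ENNReal.ofReal (2 ^ (2 * n + 2)) * Mx n u x := by
  obtain ⟨k, hk1, hk2⟩ := exists_mem_Ico_zpow hR (y := (2:ℝ)) (by norm_num)
  have step : cv n R u x ≤ ∑' i : ℕ, ENNReal.ofReal (2 ^ (2 * n + 1)) * ENNReal.ofReal ((1/2) ^ i) *
      Mx n u x := by
    calc cv n R u x ≤ ∫⁻ y, ∑' i : ℕ, (ENNReal.ofReal (2 ^ (2 * n + 1)) * ENNReal.ofReal ((1/2) ^ i) *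
      (ENNReal.ofReal (((2:ℝ) ^ ((i:ℤ) - k)) ^ n)⁻¹)) *
        (Metric.ball x ((2:ℝ) ^ ((i:ℤ) - k))).indicator u y := by
          unfold cv
          refine lintegral_mono fun y => ?_
          refine (mul_le_mul_left (kap_le n R k hk1 hk2.le (x - y)) _).trans ?_
          rw [← ENNReal.tsum_mul_right]
          refine ENNReal.tsum_le_tsum fun i => le_of_eq ?_
          by_cases hy : y ∈ Metric.ball x ((2:ℝ) ^ ((i:ℤ) - k))
          · have : x - y ∈ Metric.ball (0 : V n) ((2:ℝ) ^ ((i:ℤ) - k)) := by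
              rw [mem_ball_zero_iff, ← dist_eq_norm, dist_comm]; exact hy
            rw [Set.indicator_of_mem hy, Set.indicator_of_mem this]; simp [mul_assoc]
          · have : x - y ∉ Metric.ball (0 : V n) ((2:ℝ) ^ ((i:ℤ) - k)) := by
              rw [mem_ball_zero_iff, ← dist_eq_norm, dist_comm]; exact hy
            rw [Set.indicator_of_notMem hy, Set.indicator_of_notMem this]; simp
      _ = ∑' i : ℕ, ∫⁻ y, (ENNReal.ofReal (2 ^ (2 * n + 1)) * ENNReal.ofReal ((1/2) ^ i) *
      (ENNReal.ofReal (((2:ℝ) ^ ((i:ℤ) - k)) ^ n)⁻¹)) *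
        (Metric.ball x ((2:ℝ) ^ ((i:ℤ) - k))).indicator u y := by
          apply lintegral_tsum
          intro i
          exact ((hu.indicator measurableSet_ball).const_mul _).aemeasurable
      _ ≤ _ := by
          refine ENNReal.tsum_le_tsum fun i => ?_
          rw [lintegral_const_mul _ (hu.indicator measurableSet_ball),
            lintegral_indicator measurableSet_ball, mul_assoc]
          gcongr
          exact le_iSup (fun j : ℤ => ENNReal.ofReal (((2:ℝ) ^ j) ^ n)⁻¹ *
            ∫⁻ y in Metric.ball x ((2:ℝ) ^ j), u y) ((i:ℤ) - k)
  refine step.trans (le_of_eq ?_)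
  rw [ENNReal.tsum_mul_right, ENNReal.tsum_mul_left]
  congr 1
  rw [← ENNReal.ofReal_tsum_of_nonneg (fun i => by positivity) summable_geometric_two,
    tsum_geometric_two, ← ENNReal.ofReal_mul (by positivity)]
  congr 1

theorem cv_Lp (n : ℕ) (s : ℝ) (hs : 1 < s) : ∃ C : ℝ, 0 < C ∧ ∀ R : ℝ, 0 < R →
    ∀ u : V n → ℝ≥0∞, Measurable u →
    ∫⁻ x, cv n R u x ^ s ≤ ENNReal.ofReal C * ∫⁻ x, u x ^ s := by
  obtain ⟨C, hC, h⟩ := Mx_Lp n s hs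
  refine ⟨(2 ^ (2 * n + 2)) ^ s * C, by positivity, fun R hR u hu => ?_⟩
  calc ∫⁻ x, cv n R u x ^ s ≤ ∫⁻ x, (ENNReal.ofReal (2 ^ (2 * n + 2)) * Mx n u x) ^ s := by
        refine lintegral_mono fun x => ?_
        exact ENNReal.rpow_le_rpow (cv_le_Mx R hR u hu x) (by linarith)
    _ = ENNReal.ofReal ((2 ^ (2 * n + 2)) ^ s) * ∫⁻ x, Mx n u x ^ s := by
        rw [← lintegral_const_mul _ ((measurable_Mx u hu).pow_const s)]
        refine lintegral_congr fun x => ?_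
        rw [ENNReal.mul_rpow_of_nonneg _ _ (by linarith),
          ENNReal.ofReal_rpow_of_pos (by positivity)]
    _ ≤ _ := by
        rw [ENNReal.ofReal_mul (by positivity), mul_assoc]
        gcongr
        exact h u hu

theorem cv_sym {n : ℕ} (R : ℝ) (u v : V n → ℝ≥0∞) (hu : Measurable u) (hv : Measurable v) :
    ∫⁻ x, cv n R u x * v x = ∫⁻ x, u x * cv n R v x := by
  have hk := measurable_kap n R
  calc ∫⁻ x, cv n R u x * v x = ∫⁻ x, ∫⁻ y, kap n R (x - y) * u y * v x := by
        refine lintegral_congr fun x => ?_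
        rw [cv, lintegral_mul_const]; fun_prop
    _ = ∫⁻ y, ∫⁻ x, kap n R (x - y) * u y * v x := by
        apply lintegral_lintegral_swap
        apply Measurable.aemeasurable
        fun_prop
    _ = _ := by
        refine lintegral_congr fun y => ?_
        rw [cv, ← lintegral_const_mul]
        · refine lintegral_congr fun x => ?_
          have : kap n R (x - y) = kap n R (y - x) := by simp only [kap, norm_sub_rev]
          rw [this]; ring
        · fun_prop

theorem lintegral_sum_mul {X ι : Type*} [MeasurableSpace X] {μ : Measure X} (I : Finset ι)
    (s : ι → X → ℝ≥0∞) (h : X → ℝ≥0∞) (hs : ∀ i, Measurable (s i)) (hh : Measurable h) :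
    ∫⁻ x, (∑ i ∈ I, s i x) * h x ∂μ = ∑ i ∈ I, ∫⁻ x, s i x * h x ∂μ := by
  simp_rw [Finset.sum_mul]
  exact lintegral_finsetSum _ (fun i _ => by have := hs i; fun_prop)

/-- Dual Doob-type inequality. -/
theorem dualDoob (n : ℕ) (q : ℝ) (hq : 1 < q) : ∃ C : ℝ, 0 < C ∧
    ∀ (ι : Type) (I : Finset ι) (R : ι → ℝ) (_ : ∀ i, 0 < R i) (s : ι → V n → ℝ≥0∞)
    (_ : ∀ i, Measurable (s i))
    (_ : ∫⁻ x, (∑ i ∈ I, s i x) ^ q ≠ ⊤),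
    ∫⁻ x, (∑ i ∈ I, cv n (R i) (s i) x) ^ q ≤ ENNReal.ofReal C * ∫⁻ x, (∑ i ∈ I, s i x) ^ q := by
  have hq1 : 0 < q - 1 := by linarith
  obtain ⟨C1, hC1, h1⟩ := Mx_Lp n (q / (q - 1)) (by rw [lt_div_iff₀ hq1]; linarith)
  obtain ⟨C2, hC2, h2⟩ := cv_Lp n q hq
  set A : ℝ := 2 ^ (2 * n + 2) * C1 ^ (1 - 1/q) with hA
  have hA0 : 0 < A := by positivity
  refine ⟨A ^ q, by positivity, fun ι I R hR s hs hfin => ?_⟩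
  set g := fun x => ∑ i ∈ I, s i x with hg
  set G := fun x => ∑ i ∈ I, cv n (R i) (s i) x with hG
  have hgm : Measurable g := by rw [hg]; exact Finset.measurable_fun_sum _ fun i _ => hs i
  have hGm : Measurable G := by
    rw [hG]; exact Finset.measurable_fun_sum _ fun i _ => measurable_cv _ _ (hs i)
  -- finiteness
  have hGfin : ∫⁻ x, G x ^ q ≠ ⊤ := by
    have hle : ∀ x, G x ^ q ≤ ENNReal.ofReal ((I.card + 1 : ℝ) ^ q) * ∑ i ∈ I, cv n (R i) (s i) x ^ q := by
      intro x
      have : ∀ i ∈ I, cv n (R i) (s i) x ≤ (∑ i ∈ I, cv n (R i) (s i) x ^ q) ^ (1/q) := by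
        intro i hi
        rw [one_div, ENNReal.le_rpow_inv_iff (by linarith)]
        exact Finset.single_le_sum (f := fun i => cv n (R i) (s i) x ^ q) (fun _ _ => zero_le) hi
      have h3 : G x ≤ I.card • (∑ i ∈ I, cv n (R i) (s i) x ^ q) ^ (1/q) :=
        Finset.sum_le_card_nsmul _ _ _ this
      calc G x ^ q ≤ (ENNReal.ofReal (I.card + 1) * (∑ i ∈ I, cv n (R i) (s i) x ^ q) ^ (1/q)) ^ q := by
            refine ENNReal.rpow_le_rpow (h3.trans ?_) (by linarith)
            rw [nsmul_eq_mul]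
            gcongr
            rw [show ((I.card : ℕ) : ℝ≥0∞) = ENNReal.ofReal I.card by simp]
            exact ENNReal.ofReal_le_ofReal (by linarith)
        _ = _ := by
            rw [ENNReal.mul_rpow_of_nonneg _ _ (by linarith), ← ENNReal.rpow_mul,
              ENNReal.ofReal_rpow_of_pos (by positivity)]
            rw [one_div, inv_mul_cancel₀ (by linarith), ENNReal.rpow_one]
    refine ne_top_of_le_ne_top ?_ (lintegral_mono hle)
    rw [lintegral_const_mul _ (Finset.measurable_fun_sum _ fun i _ => (measurable_cv _ _ (hs i)).pow_const q),
      lintegral_finsetSum _ (fun i _ => (measurable_cv _ _ (hs i)).pow_const q)]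
    refine ENNReal.mul_ne_top ENNReal.ofReal_ne_top ?_
    refine (ENNReal.sum_lt_top.2 fun i hi => ?_).ne
    refine (h2 (R i) (hR i) (s i) (hs i)).trans_lt (ENNReal.mul_lt_top ENNReal.ofReal_lt_top ?_)
    refine lt_of_le_of_lt (lintegral_mono fun x => ?_) (lt_top_iff_ne_top.2 hfin)
    exact ENNReal.rpow_le_rpow (Finset.single_le_sum (f := fun i => s i x) (fun _ _ => zero_le) hi) (by linarith)
  have hmain : ∫⁻ x, G x ^ q ≤ (ENNReal.ofReal A * (∫⁻ x, g x ^ q) ^ (1/q)) * (∫⁻ x, G x ^ q) ^ (1 - 1/q) := by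
    set h := fun x => G x ^ (q - 1) with hh
    have hhm : Measurable h := hGm.pow_const _
    calc ∫⁻ x, G x ^ q = ∫⁻ x, G x * h x := by
          refine lintegral_congr fun x => ?_
          conv_lhs => rw [show q = 1 + (q - 1) by ring,
            ENNReal.rpow_add_of_nonneg _ _ zero_le_one hq1.le, ENNReal.rpow_one]
      _ = ∑ i ∈ I, ∫⁻ x, cv n (R i) (s i) x * h x := by
          exact lintegral_sum_mul I _ _ (fun i => measurable_cv _ _ (hs i)) hhm
      _ = ∑ i ∈ I, ∫⁻ x, s i x * cv n (R i) h x :=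
          Finset.sum_congr rfl fun i _ => cv_sym _ _ _ (hs i) hhm
      _ ≤ ∑ i ∈ I, ∫⁻ x, s i x * (ENNReal.ofReal (2 ^ (2 * n + 2)) * Mx n h x) := by
          gcongr with i hi x
          exact cv_le_Mx _ (hR i) h hhm x
      _ = ∫⁻ x, g x * (ENNReal.ofReal (2 ^ (2 * n + 2)) * Mx n h x) := by
          exact (lintegral_sum_mul I _ _ hs ((measurable_Mx h hhm).const_mul _)).symm
      _ = ENNReal.ofReal (2 ^ (2 * n + 2)) * ∫⁻ x, g x * ((Mx n h x) ^ (1/(q-1))) ^ (q - 1) := by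
          rw [← lintegral_const_mul]
          · refine lintegral_congr fun x => ?_
            rw [← ENNReal.rpow_mul, one_div, inv_mul_cancel₀ hq1.ne', ENNReal.rpow_one]; ring
          · exact hgm.mul (((measurable_Mx h hhm).pow_const _).pow_const _)
      _ ≤ ENNReal.ofReal (2 ^ (2 * n + 2)) * ((∫⁻ x, g x ^ q) ^ (1/q) *
            (∫⁻ x, ((Mx n h x) ^ (1/(q-1))) ^ q) ^ (1 - 1/q)) := by
          gcongr
          exact holder_q _ _ _ hgm.aemeasurable ((measurable_Mx h hhm).pow_const _).aemeasurable q hq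
      _ ≤ ENNReal.ofReal (2 ^ (2 * n + 2)) * ((∫⁻ x, g x ^ q) ^ (1/q) *
            (ENNReal.ofReal C1 * ∫⁻ x, G x ^ q) ^ (1 - 1/q)) := by
          have hexp : 0 ≤ 1 - 1/q := by
            rw [sub_nonneg, div_le_one (by linarith)]; linarith
          gcongr
          calc _ = ∫⁻ x, Mx n h x ^ (q / (q - 1)) := by
                refine lintegral_congr fun x => ?_
                rw [← ENNReal.rpow_mul]; congr 1; field_simp
            _ ≤ _ := h1 h hhm
            _ = _ := by
                congr 1
                refine lintegral_congr fun x => ?_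
                rw [hh, ← ENNReal.rpow_mul]; congr 1; field_simp
      _ = _ := by
          have hexp : 0 ≤ 1 - 1/q := by
            rw [sub_nonneg, div_le_one (by linarith)]; linarith
          rw [ENNReal.mul_rpow_of_nonneg _ _ hexp, ENNReal.ofReal_rpow_of_pos hC1, hA,
            ENNReal.ofReal_mul (by positivity)]
          ring
  refine (absorb _ _ q hq hGfin hmain).trans (le_of_eq ?_)
  rw [ENNReal.mul_rpow_of_nonneg _ _ (by linarith), ← ENNReal.rpow_mul,
    ENNReal.ofReal_rpow_of_pos hA0, one_div, inv_mul_cancel₀ (by linarith), ENNReal.rpow_one]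

end SqFn

namespace SqFn

theorem pow_upper_real (x d r : ℝ) (hx : 0 ≤ x) (hd : 0 ≤ d) (hr : 0 < r) :
    (x + d) ^ r ≤ x ^ r + max 1 r * (d * (x + d) ^ (r - 1)) := by
  rcases (add_nonneg hx hd).eq_or_lt with h0 | h0
  · have : x = 0 := by linarith
    have : d = 0 := by linarith
    subst_vars; simp [Real.zero_rpow hr.ne']
  set y := x + d with hy
  set z := x / y with hz
  have hz0 : 0 ≤ z := by positivity
  have hz1 : z ≤ 1 := by rw [hz, div_le_one h0]; linarith
  have key : 1 ≤ z ^ r + max 1 r * (1 - z) := by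
    rcases le_total 1 r with h | h
    · rw [max_eq_right h]
      have := one_add_mul_self_le_rpow_one_add (s := z - 1) (by linarith) h
      rw [show 1 + (z - 1) = z by ring] at this
      linarith
    · rw [max_eq_left h]
      have : z ≤ z ^ r := by
        rcases hz0.eq_or_lt with h1 | h1
        · rw [← h1, Real.zero_rpow hr.ne']
        · conv_lhs => rw [← Real.rpow_one z]
          exact Real.rpow_le_rpow_of_exponent_ge h1 hz1 h
      linarith
  have e1 : x ^ r = z ^ r * y ^ r := by
    rw [← Real.mul_rpow hz0 h0.le, hz, div_mul_cancel₀ _ h0.ne']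
  have e2 : d * y ^ (r - 1) = (1 - z) * y ^ r := by
    rw [Real.rpow_sub_one h0.ne', hz]
    have : d = y - x := by rw [hy]; ring
    rw [this]; field_simp
  rw [e1, e2]
  have : 0 ≤ y ^ r := by positivity
  nlinarith

theorem pow_lower_real (x d r : ℝ) (hx : 0 ≤ x) (hd : 0 ≤ d) (hr : 0 < r) :
    x ^ r + min 1 r * (d * (x + d) ^ (r - 1)) ≤ (x + d) ^ r := by
  rcases (add_nonneg hx hd).eq_or_lt with h0 | h0
  · have : x = 0 := by linarith
    have : d = 0 := by linarith
    subst_vars; simp [Real.zero_rpow hr.ne']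
  set y := x + d with hy
  set z := x / y with hz
  have hz0 : 0 ≤ z := by positivity
  have hz1 : z ≤ 1 := by rw [hz, div_le_one h0]; linarith
  have key : z ^ r + min 1 r * (1 - z) ≤ 1 := by
    rcases le_total 1 r with h | h
    · rw [min_eq_left h]
      have : z ^ r ≤ z := by
        rcases hz0.eq_or_lt with h1 | h1
        · rw [← h1, Real.zero_rpow hr.ne']
        · conv_rhs => rw [← Real.rpow_one z]
          exact Real.rpow_le_rpow_of_exponent_ge h1 hz1 h
      linarith
    · rw [min_eq_right h]
      have := rpow_one_add_le_one_add_mul_self (s := z - 1) (by linarith) hr.le h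
      rw [show 1 + (z - 1) = z by ring] at this
      linarith
  have e1 : x ^ r = z ^ r * y ^ r := by
    rw [← Real.mul_rpow hz0 h0.le, hz, div_mul_cancel₀ _ h0.ne']
  have e2 : d * y ^ (r - 1) = (1 - z) * y ^ r := by
    rw [Real.rpow_sub_one h0.ne', hz]
    have : d = y - x := by rw [hy]; ring
    rw [this]; field_simp
  rw [e1, e2]
  have : 0 ≤ y ^ r := by positivity
  nlinarith

theorem mul_rpow_cast (x d r : ℝ) (hx : 0 ≤ x) (hd : 0 ≤ d) :
    ENNReal.ofReal d * (ENNReal.ofReal x + ENNReal.ofReal d) ^ r =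
      ENNReal.ofReal (d * (x + d) ^ r) := by
  rcases hd.eq_or_lt with h | h
  · simp [← h]
  · rw [← ENNReal.ofReal_add hx hd, ENNReal.ofReal_rpow_of_pos (by linarith),
      ENNReal.ofReal_mul hd]

theorem pow_upper (x d : ℝ≥0∞) (r : ℝ) (hx : x ≠ ⊤) (hd : d ≠ ⊤) (hr : 0 < r) :
    (x + d) ^ r ≤ x ^ r + ENNReal.ofReal (max 1 r) * (d * (x + d) ^ (r - 1)) := by
  lift x to NNReal using hx
  lift d to NNReal using hd
  have h := pow_upper_real x d r x.2 d.2 hr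
  have hc : ∀ a : NNReal, (a : ℝ≥0∞) = ENNReal.ofReal a := fun a => (ENNReal.ofReal_coe_nnreal).symm
  rw [hc x, hc d, mul_rpow_cast _ _ _ x.coe_nonneg d.coe_nonneg, ← ENNReal.ofReal_add x.coe_nonneg d.coe_nonneg,
    ENNReal.ofReal_rpow_of_nonneg (by positivity) hr.le,
    ENNReal.ofReal_rpow_of_nonneg (by positivity) hr.le, ← ENNReal.ofReal_mul (by positivity),
    ← ENNReal.ofReal_add (by positivity) (by positivity)]
  exact ENNReal.ofReal_le_ofReal h

theorem pow_lower (x d : ℝ≥0∞) (r : ℝ) (hx : x ≠ ⊤) (hd : d ≠ ⊤) (hr : 0 < r) :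
    x ^ r + ENNReal.ofReal (min 1 r) * (d * (x + d) ^ (r - 1)) ≤ (x + d) ^ r := by
  lift x to NNReal using hx
  lift d to NNReal using hd
  have h := pow_lower_real x d r x.2 d.2 hr
  have hc : ∀ a : NNReal, (a : ℝ≥0∞) = ENNReal.ofReal a := fun a => (ENNReal.ofReal_coe_nnreal).symm
  have h2 : 0 ≤ min 1 r := by positivity
  rw [hc x, hc d, mul_rpow_cast _ _ _ x.coe_nonneg d.coe_nonneg, ← ENNReal.ofReal_add x.coe_nonneg d.coe_nonneg,
    ENNReal.ofReal_rpow_of_nonneg (by positivity) hr.le,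
    ENNReal.ofReal_rpow_of_nonneg (by positivity) hr.le, ← ENNReal.ofReal_mul (by positivity),
    ← ENNReal.ofReal_add (by positivity) (by positivity)]
  exact ENNReal.ofReal_le_ofReal h

theorem psum_upper (a : ℕ → ℝ≥0∞) (ha : ∀ i, a i ≠ ⊤) (r : ℝ) (hr : 0 < r) (K : ℕ) :
    (∑ i ∈ Finset.range K, a i) ^ r ≤ ENNReal.ofReal (max 1 r) *
      ∑ l ∈ Finset.range K, a l * (∑ j ∈ Finset.range (l + 1), a j) ^ (r - 1) := by
  induction K with
  | zero => simp [hr]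
  | succ K ih =>
    rw [Finset.sum_range_succ, Finset.sum_range_succ (fun l => a l * _), mul_add]
    refine (pow_upper _ _ r ?_ (ha K) hr).trans ?_
    · exact (ENNReal.sum_lt_top.2 fun i _ => (ha i).lt_top).ne
    · rw [Finset.sum_range_succ a K]
      exact add_le_add ih le_rfl

theorem psum_lower (a : ℕ → ℝ≥0∞) (ha : ∀ i, a i ≠ ⊤) (r : ℝ) (hr : 0 < r) (K : ℕ) :
    ENNReal.ofReal (min 1 r) *
      ∑ l ∈ Finset.range K, a l * (∑ j ∈ Finset.range (l + 1), a j) ^ (r - 1) ≤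
    (∑ i ∈ Finset.range K, a i) ^ r := by
  induction K with
  | zero => simp
  | succ K ih =>
    rw [Finset.sum_range_succ, Finset.sum_range_succ a, mul_add]
    refine le_trans ?_ (pow_lower _ _ r ?_ (ha K) hr)
    · exact add_le_add ih le_rfl
    · exact (ENNReal.sum_lt_top.2 fun i _ => (ha i).lt_top).ne

/-- pointwise paraproduct -/
theorem para_pt (s a : ℕ → ℝ≥0∞) (hsa : ∀ i, s i ≤ a i) (ha : ∀ i, a i ≠ ⊤) (q : ℝ) (hq : 1 < q)
    (K : ℕ) :
    (∑ i ∈ Finset.range K, s i) ^ q ≤ ENNReal.ofReal (q * max 1 (q - 1)) *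
      ∑ l ∈ Finset.range K, (∑ i ∈ Finset.Ico l K, s i) *
        (a l * (∑ j ∈ Finset.range (l + 1), a j) ^ (q - 2)) := by
  have hs : ∀ i, s i ≠ ⊤ := fun i => ne_top_of_le_ne_top (ha i) (hsa i)
  have h1 := psum_upper s hs q (by linarith) K
  rw [max_eq_right hq.le] at h1
  refine h1.trans ?_
  rw [ENNReal.ofReal_mul (by linarith), mul_assoc]
  gcongr
  calc ∑ l ∈ Finset.range K, s l * (∑ j ∈ Finset.range (l + 1), s j) ^ (q - 1)
      ≤ ∑ i ∈ Finset.range K, s i * (ENNReal.ofReal (max 1 (q - 1)) *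
          ∑ l ∈ Finset.range (i + 1), a l * (∑ j ∈ Finset.range (l + 1), a j) ^ (q - 2)) := by
        refine Finset.sum_le_sum fun i hi => ?_
        gcongr
        have h2 := psum_upper a ha (q - 1) (by linarith) (i + 1)
        rw [show q - 1 - 1 = q - 2 by ring] at h2
        refine le_trans (ENNReal.rpow_le_rpow ?_ (by linarith)) h2
        exact Finset.sum_le_sum fun j _ => hsa j
    _ = ENNReal.ofReal (max 1 (q - 1)) * ∑ i ∈ Finset.range K, 
          ∑ l ∈ Finset.range (i + 1), s i * (a l * (∑ j ∈ Finset.range (l + 1), a j) ^ (q - 2)) := by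
        rw [Finset.mul_sum]
        refine Finset.sum_congr rfl fun i _ => ?_
        rw [← Finset.mul_sum]; ring
    _ = _ := by
        congr 1
        rw [Finset.sum_comm' (t' := Finset.range K) (s' := fun l => Finset.Ico l K)]
        · refine Finset.sum_congr rfl fun l _ => ?_
          rw [Finset.sum_mul]
        · intro x y; simp only [Finset.mem_range, Finset.mem_Ico]; omega

theorem kap_slow {n : ℕ} {R R' : ℝ} (hR : 0 < R) (hRR : R ≤ R') (x y z : V n) :
    kap n R (x - z) ≤ ENNReal.ofReal ((1 + R' * ‖x - y‖) ^ (n + 1)) * kap n R (y - z) := by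
  have hR' : 0 < R' := hR.trans_le hRR
  unfold kap
  rw [← ENNReal.ofReal_mul (by positivity)]
  apply ENNReal.ofReal_le_ofReal
  rw [mul_div_assoc', div_le_div_iff₀ (by positivity) (by positivity)]
  have h : 1 + R * ‖y - z‖ ≤ (1 + R' * ‖x - y‖) * (1 + R * ‖x - z‖) := by
    have h1 : ‖y - z‖ ≤ ‖x - y‖ + ‖x - z‖ := by
      have : y - z = (x - z) - (x - y) := by abel
      rw [this, add_comm]; exact norm_sub_le _ _
    have h2 : R * ‖x - y‖ ≤ R' * ‖x - y‖ := by gcongr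
    have h3 : 0 ≤ R' * ‖x - y‖ * (R * ‖x - z‖) := by positivity
    nlinarith
  calc R ^ n * (1 + R * ‖y - z‖) ^ (n + 1)
      ≤ R ^ n * ((1 + R' * ‖x - y‖) * (1 + R * ‖x - z‖)) ^ (n + 1) := by gcongr
    _ = _ := by rw [mul_pow]; ring

theorem cv_slow {n : ℕ} {R R' : ℝ} (hR : 0 < R) (hRR : R ≤ R') (u : V n → ℝ≥0∞)
    (hu : Measurable u) (x y : V n) :
    cv n R u x ≤ ENNReal.ofReal ((1 + R' * ‖x - y‖) ^ (n + 1)) * cv n R u y := by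
  have := measurable_kap n R
  unfold cv
  rw [← lintegral_const_mul _ (by fun_prop)]
  refine lintegral_mono fun z => ?_
  rw [← mul_assoc]
  gcongr
  exact kap_slow hR hRR x y z

theorem rpow_anti {a b : ℝ≥0∞} {e : ℝ} (he : e ≤ 0) (h : a ≤ b) : b ^ e ≤ a ^ e := by
  rw [show e = -(-e) by ring, ENNReal.rpow_neg b, ENNReal.rpow_neg a, ENNReal.inv_le_inv]
  exact ENNReal.rpow_le_rpow h (by linarith)

/-- Slow variation of `a * G^e`. -/
theorem slow_prod (w a a' G G' : ℝ≥0∞) (e : ℝ) (hw1 : 1 ≤ w) (hw : w ≠ ⊤) (h1 : a ≤ w * a')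
    (h2 : G ≤ w * G') (h3 : G' ≤ w * G) :
    a * G ^ e ≤ w ^ (1 + |e|) * (a' * G' ^ e) := by
  have hw0 : w ≠ 0 := (zero_lt_one.trans_le hw1).ne'
  have hG : G ^ e ≤ w ^ |e| * G' ^ e := by
    rcases le_total 0 e with he | he
    · rw [abs_of_nonneg he, ← ENNReal.mul_rpow_of_nonneg _ _ he]
      exact ENNReal.rpow_le_rpow h2 he
    · rw [abs_of_nonpos he]
      have h4 : w⁻¹ * G' ≤ G := by
        rw [mul_comm, ← div_eq_mul_inv]; exact ENNReal.div_le_of_le_mul' h3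
      calc G ^ e ≤ (w⁻¹ * G') ^ e := rpow_anti he h4
        _ = w⁻¹ ^ e * G' ^ e := by
            by_cases hG0 : G' = 0
            · rcases he.eq_or_lt with he0 | he0
              · simp [he0]
              · simp only [hG0, mul_zero, ENNReal.zero_rpow_of_neg he0]
                rw [ENNReal.mul_top]
                simp [ENNReal.rpow_eq_zero_iff, hw0, hw]
            · by_cases hGt : G' = ⊤
              · have : w⁻¹ ≠ 0 := by simp [hw]
                rcases he.eq_or_lt with he0 | he0
                · simp [he0]
                · simp [hGt, ENNReal.mul_top this, ENNReal.top_rpow_of_neg he0]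
              · rw [ENNReal.mul_rpow_of_ne_top _ hGt]
                simp [hw0]
        _ = _ := by rw [ENNReal.inv_rpow, ENNReal.rpow_neg]
  calc a * G ^ e ≤ (w * a') * (w ^ |e| * G' ^ e) := mul_le_mul' h1 hG
    _ = _ := by
      rw [ENNReal.rpow_add _ _ hw0 hw, ENNReal.rpow_one]; ring

/-- Abstract paraproduct lemma. -/
theorem paraproduct (n : ℕ) (q : ℝ) (hq : 1 < q) (A : ℝ) (hA : 0 < A) (ν : ℕ)
    (hν : (n + 1) * (1 + |q - 2|) ≤ (ν : ℝ)) :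
    ∃ C : ℝ, 0 < C ∧ ∀ (K L : ℕ) (R : ℕ → ℝ) (_ : ∀ i, 0 < R i) (_ : Monotone R)
      (s : ℕ → V n → ℝ≥0∞) (_ : ∀ i, Measurable (s i))
      (_ : ∀ i x, s i x ≤ ENNReal.ofReal A * cv n (R i) (s i) x)
      (_ : ∀ i x, cv n (R i) (s i) x ≠ ⊤)
      (_ : ∫⁻ x, (∑ i ∈ Finset.range K, s i x) ^ q ≠ ⊤)
      (F σ : V n → ℝ≥0∞) (_ : Measurable F) (_ : Measurable σ)
      (_ : ∀ i < K, ∀ x, s i x ≤ σ x) (ε : ℝ≥0∞)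
      (_ : ∀ l < K, ∀ ω : V n → ℝ≥0∞, Measurable ω →
        (∀ x y, ω x ≤ ENNReal.ofReal ((1 + R l * ‖x - y‖) ^ ν) * ω y) →
        ∫⁻ x, (∑ i ∈ Finset.Ico (l + L) K, s i x) * ω x ≤ ε * ∫⁻ x, F x * ω x),
      ∫⁻ x, (∑ i ∈ Finset.range K, s i x) ^ q ≤
        ENNReal.ofReal C * ∫⁻ x, (ε * F x + L * σ x) ^ q := by
  obtain ⟨C1, hC1, hDD⟩ := dualDoob n q hq
  have hq1 : 0 < q - 1 := by linarith
  set c0 : ℝ := q * max 1 (q - 1) with hc0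
  have hc0' : 0 < c0 := by positivity
  set c2 : ℝ := (min 1 (q - 1))⁻¹ with hc2
  have hmin : 0 < min 1 (q - 1) := lt_min one_pos hq1
  have hc2' : 0 < c2 := by positivity
  set B : ℝ := c0 * c2 * (A ^ q * C1) ^ (1 - 1/q) with hB
  have hB' : 0 < B := by positivity
  refine ⟨B ^ q, by positivity, ?_⟩
  intro K L R hR hRm s hs hsa hfin hSfin F σ hF hσ hsσ ε hhigh
  set a : ℕ → V n → ℝ≥0∞ := fun i x => ENNReal.ofReal A * cv n (R i) (s i) x with ha
  have ham : ∀ i, Measurable (a i) := fun i => (measurable_cv _ _ (hs i)).const_mul _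
  have hat : ∀ i x, a i x ≠ ⊤ := fun i x => ENNReal.mul_ne_top ENNReal.ofReal_ne_top (hfin i x)
  set G : ℕ → V n → ℝ≥0∞ := fun l x => ∑ j ∈ Finset.range l, a j x with hG
  have hGm : ∀ l, Measurable (G l) := fun l => by
    rw [hG]; exact Finset.measurable_fun_sum _ fun i _ => ham i
  set D : ℕ → V n → ℝ≥0∞ := fun l x => a l x * G (l + 1) x ^ (q - 2) with hD
  have hDm : ∀ l, Measurable (D l) := fun l => (ham l).mul ((hGm _).pow_const _)
  have hslow_a : ∀ j l, j ≤ l → ∀ x y, a j x ≤ ENNReal.ofReal ((1 + R l * ‖x - y‖) ^ (n + 1)) * a j y := by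
    intro j l hjl x y
    have := cv_slow (hR j) (hRm hjl) (s j) (hs j) x y
    calc a j x ≤ ENNReal.ofReal A * (ENNReal.ofReal ((1 + R l * ‖x - y‖) ^ (n + 1)) * cv n (R j) (s j) y) := by
          simp only [ha]; gcongr
      _ = _ := by simp only [ha]; ring
  have hslow_G : ∀ l x y, G (l + 1) x ≤ ENNReal.ofReal ((1 + R l * ‖x - y‖) ^ (n + 1)) * G (l + 1) y := by
    intro l x y
    simp only [hG]
    rw [Finset.mul_sum]
    refine Finset.sum_le_sum fun j hj => hslow_a j l ?_ x y
    simp only [Finset.mem_range] at hj; omega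
  have hslow_D : ∀ l x y, D l x ≤ ENNReal.ofReal ((1 + R l * ‖x - y‖) ^ ν) * D l y := by
    intro l x y
    have hRl := hR l
    have hb : 1 ≤ 1 + R l * ‖x - y‖ := by
      have : 0 ≤ R l * ‖x - y‖ := by positivity
      linarith
    have h3 := hslow_G l y x
    rw [norm_sub_rev] at h3
    refine (slow_prod (ENNReal.ofReal ((1 + R l * ‖x - y‖) ^ (n + 1))) (a l x) (a l y) _ _ (q - 2) ?_
      ENNReal.ofReal_ne_top (hslow_a l l le_rfl x y) (hslow_G l x y) h3).trans ?_
    · rw [ENNReal.one_le_ofReal]; exact one_le_pow₀ hb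
    · simp only [hD]
      gcongr
      rw [ENNReal.ofReal_rpow_of_pos (by positivity)]
      apply ENNReal.ofReal_le_ofReal
      rw [← Real.rpow_natCast, ← Real.rpow_natCast, ← Real.rpow_mul (by positivity)]
      apply Real.rpow_le_rpow_of_exponent_le hb
      push_cast
      exact hν
  set S := fun x => ∑ i ∈ Finset.range K, s i x with hS
  have hSm : Measurable S := by rw [hS]; exact Finset.measurable_fun_sum _ fun i _ => hs i
  set H := fun x => ε * F x + L * σ x with hH
  have hHm : Measurable H := (hF.const_mul _).add (hσ.const_mul _)
  have hmain : ∫⁻ x, S x ^ q ≤ ENNReal.ofReal c0 * ∑ l ∈ Finset.range K, ∫⁻ x, H x * D l x := by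
    calc ∫⁻ x, S x ^ q ≤ ∫⁻ x, ENNReal.ofReal c0 *
          ∑ l ∈ Finset.range K, (∑ i ∈ Finset.Ico l K, s i x) * D l x :=
          lintegral_mono fun x => para_pt (fun i => s i x) (fun i => a i x) (fun i => hsa i x)
            (fun i => hat i x) q hq K
      _ = ENNReal.ofReal c0 * ∑ l ∈ Finset.range K, ∫⁻ x, (∑ i ∈ Finset.Ico l K, s i x) * D l x := by
          have hm : ∀ l, Measurable fun x => (∑ i ∈ Finset.Ico l K, s i x) * D l x := fun l =>
            (Finset.measurable_fun_sum _ fun i _ => hs i).mul (hDm l)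
          rw [lintegral_const_mul _ (Finset.measurable_fun_sum _ fun l _ => hm l),
            lintegral_finsetSum _ fun l _ => hm l]
      _ ≤ _ := by
          refine mul_le_mul' le_rfl (Finset.sum_le_sum fun l hl => ?_)
          have hl' : l < K := Finset.mem_range.1 hl
          calc ∫⁻ x, (∑ i ∈ Finset.Ico l K, s i x) * D l x
              ≤ ∫⁻ x, ((∑ i ∈ Finset.Ico (l + L) K, s i x) * D l x + (L * σ x) * D l x) := by
                refine lintegral_mono fun x => ?_
                rw [← add_mul]
                gcongr
                have hsub : Finset.Ico l K ⊆ Finset.Ico (l + L) K ∪ (Finset.Ico l (min K (l + L))) := by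
                  intro i; simp only [Finset.mem_union, Finset.mem_Ico]; omega
                refine (Finset.sum_le_sum_of_subset hsub).trans ?_
                rw [Finset.sum_union (by rw [Finset.disjoint_left]; intro i; simp only [Finset.mem_Ico]; omega)]
                gcongr
                refine (Finset.sum_le_card_nsmul _ _ (σ x) ?_).trans ?_
                · intro i hi
                  simp only [Finset.mem_Ico] at hi
                  exact hsσ i (by omega) x
                · rw [nsmul_eq_mul]
                  gcongr
                  rw [Nat.card_Ico]; omega
            _ = (∫⁻ x, (∑ i ∈ Finset.Ico (l + L) K, s i x) * D l x) + ∫⁻ x, (L * σ x) * D l x := by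
                apply lintegral_add_left
                exact (Finset.measurable_fun_sum _ fun i _ => hs i).mul (hDm l)
            _ ≤ ε * (∫⁻ x, F x * D l x) + ∫⁻ x, (L * σ x) * D l x := by
                gcongr
                exact hhigh l hl' (D l) (hDm l) (hslow_D l)
            _ = ∫⁻ x, H x * D l x := by
                rw [← lintegral_const_mul _ (hF.fun_mul (hDm l)), ← lintegral_add_left]
                · refine lintegral_congr fun x => ?_
                  simp only [hH]; ring
                · exact (hF.mul (hDm l)).const_mul _
  have hsumD : ∀ x, ∑ l ∈ Finset.range K, D l x ≤ ENNReal.ofReal c2 * G K x ^ (q - 1) := by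
    intro x
    have h := psum_lower (fun i => a i x) (fun i => hat i x) (q - 1) hq1 K
    rw [show q - 1 - 1 = q - 2 by ring] at h
    calc ∑ l ∈ Finset.range K, D l x = ENNReal.ofReal c2 * (ENNReal.ofReal (min 1 (q - 1)) *
          ∑ l ∈ Finset.range K, D l x) := by
          rw [← mul_assoc, ← ENNReal.ofReal_mul hc2'.le, hc2, inv_mul_cancel₀ hmin.ne',
            ENNReal.ofReal_one, one_mul]
      _ ≤ _ := by gcongr
  have hGq : ∫⁻ x, G K x ^ q ≤ ENNReal.ofReal (A ^ q * C1) * ∫⁻ x, S x ^ q := by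
    have hh := hDD ℕ (Finset.range K) R hR s hs hSfin
    calc ∫⁻ x, G K x ^ q = ENNReal.ofReal (A ^ q) * ∫⁻ x, (∑ i ∈ Finset.range K, cv n (R i) (s i) x) ^ q := by
          rw [← lintegral_const_mul]
          · refine lintegral_congr fun x => ?_
            simp only [hG, ha]
            rw [← Finset.mul_sum, ENNReal.mul_rpow_of_nonneg _ _ (by linarith),
              ENNReal.ofReal_rpow_of_pos hA]
          · exact (Finset.measurable_fun_sum _ fun i _ => measurable_cv _ _ (hs i)).pow_const _
      _ ≤ ENNReal.ofReal (A ^ q) * (ENNReal.ofReal C1 * ∫⁻ x, S x ^ q) := by gcongr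
      _ = _ := by rw [ENNReal.ofReal_mul (by positivity)]; ring
  have hexp : 0 ≤ 1 - 1/q := by
    rw [sub_nonneg, div_le_one (by linarith)]; linarith
  have hfinal : ∫⁻ x, S x ^ q ≤ (ENNReal.ofReal B * (∫⁻ x, H x ^ q) ^ (1/q)) * (∫⁻ x, S x ^ q) ^ (1 - 1/q) := by
    calc ∫⁻ x, S x ^ q ≤ ENNReal.ofReal c0 * ∑ l ∈ Finset.range K, ∫⁻ x, H x * D l x := hmain
      _ = ENNReal.ofReal c0 * ∫⁻ x, H x * ∑ l ∈ Finset.range K, D l x := by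
          rw [← lintegral_finsetSum _ fun l _ => hHm.fun_mul (hDm l)]
          congr 1
          refine lintegral_congr fun x => ?_
          rw [Finset.mul_sum]
      _ ≤ ENNReal.ofReal c0 * ∫⁻ x, ENNReal.ofReal c2 * (H x * G K x ^ (q - 1)) := by
          refine mul_le_mul' le_rfl (lintegral_mono fun x => ?_)
          calc H x * ∑ l ∈ Finset.range K, D l x ≤ H x * (ENNReal.ofReal c2 * G K x ^ (q - 1)) := by
                gcongr; exact hsumD x
            _ = _ := by ring
      _ = ENNReal.ofReal c0 * (ENNReal.ofReal c2 * ∫⁻ x, H x * G K x ^ (q - 1)) := by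
          rw [lintegral_const_mul _ (hHm.fun_mul ((hGm K).pow_const _))]
      _ ≤ ENNReal.ofReal c0 * (ENNReal.ofReal c2 * ((∫⁻ x, H x ^ q) ^ (1/q) *
            (∫⁻ x, G K x ^ q) ^ (1 - 1/q))) := by
          gcongr
          exact holder_q _ _ _ hHm.aemeasurable (hGm K).aemeasurable q hq
      _ ≤ ENNReal.ofReal c0 * (ENNReal.ofReal c2 * ((∫⁻ x, H x ^ q) ^ (1/q) *
            (ENNReal.ofReal (A ^ q * C1) * ∫⁻ x, S x ^ q) ^ (1 - 1/q))) := by gcongr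
      _ = _ := by
          rw [ENNReal.mul_rpow_of_nonneg _ _ hexp, ENNReal.ofReal_rpow_of_pos (by positivity), hB,
            ENNReal.ofReal_mul (p := c0 * c2) (by positivity), ENNReal.ofReal_mul (p := c0) (by positivity)]
          ring
  refine (absorb _ _ q hq hSfin hfinal).trans (le_of_eq ?_)
  rw [ENNReal.mul_rpow_of_nonneg _ _ (by linarith), ← ENNReal.rpow_mul,
    ENNReal.ofReal_rpow_of_pos hB', one_div, inv_mul_cancel₀ (by linarith), ENNReal.rpow_one]

end SqFn

namespace SqFn

/-- the character -/
noncomputable def ex {n : ℕ} (x ξ : V n) : ℂ :=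
  Complex.exp (2 * Real.pi * Complex.I * (⟪x, ξ⟫ : ℝ))

/-- inverse Fourier integral -/
noncomputable def iF {n : ℕ} (h : V n → ℂ) (x : V n) : ℂ := ∫ ξ, h ξ * ex x ξ

theorem norm_ex {n : ℕ} (x ξ : V n) : ‖ex x ξ‖ = 1 := by
  unfold ex
  rw [show 2 * (Real.pi : ℂ) * Complex.I * (⟪x, ξ⟫ : ℝ) = ((2 * Real.pi * ⟪x, ξ⟫ : ℝ) : ℂ) * I by
    push_cast; ring]
  exact Complex.norm_exp_ofReal_mul_I _

theorem ex_add {n : ℕ} (x y ξ : V n) : ex (x + y) ξ = ex x ξ * ex y ξ := by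
  unfold ex
  rw [← Complex.exp_add, inner_add_left]; congr 1; push_cast; ring

theorem ex_comm {n : ℕ} (x ξ : V n) : ex x ξ = ex ξ x := by
  unfold ex; rw [real_inner_comm]

theorem conj_ex {n : ℕ} (x ξ : V n) : (starRingEnd ℂ) (ex x ξ) = ex (-x) ξ := by
  unfold ex
  rw [← Complex.exp_conj, inner_neg_left]; congr 1
  have h2 : (starRingEnd ℂ) 2 = 2 := Complex.conj_ofNat 2
  simp [h2]

theorem continuous_ex {n : ℕ} : Continuous (fun z : V n × V n => ex z.1 z.2) := by
  unfold ex; fun_prop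

theorem fourier_ex {n : ℕ} (f : V n → ℂ) (ξ : V n) : 𝓕 f ξ = ∫ y, f y * ex (-y) ξ := by
  rw [Real.fourier_eq']
  congr 1; ext y
  rw [smul_eq_mul, mul_comm]; unfold ex; congr 2; rw [inner_neg_left]; push_cast; ring

theorem iF_eq {n : ℕ} (h : V n → ℂ) (x : V n) : iF h x = 𝓕⁻ h x := by
  rw [Real.fourierInv_eq']
  unfold iF
  congr 1; ext y
  rw [smul_eq_mul, mul_comm]; unfold ex; congr 2; rw [real_inner_comm]; push_cast; ring

theorem iF_neg {n : ℕ} (h : V n → ℂ) (x : V n) : iF h x = 𝓕 h (-x) := by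
  rw [iF_eq, Real.fourierInv_eq_fourier_neg]

theorem norm_fourier_le {n : ℕ} (f : V n → ℂ) (ξ : V n) : ‖𝓕 f ξ‖ ≤ ∫ y, ‖f y‖ := by
  rw [fourier_ex]
  refine (norm_integral_le_integral_norm _).trans (le_of_eq ?_)
  simp [norm_ex]

theorem continuous_fourier {n : ℕ} {f : V n → ℂ} (hf : Integrable f) : Continuous (𝓕 f) :=
  VectorFourier.fourierIntegral_continuous Real.continuous_fourierChar
    (by exact continuous_inner) hf

theorem integrable_mul_ex {n : ℕ} {h : V n → ℂ} (hh : Integrable h) (x : V n) :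
    Integrable (fun ξ => h ξ * ex x ξ) := by
  apply hh.mul_bdd (c := 1)
  · exact (continuous_ex.comp (by fun_prop : Continuous fun ξ : V n => (x, ξ))).aestronglyMeasurable
  · exact Eventually.of_forall fun ξ => (norm_ex x ξ).le

theorem integrable_mul_fourier {n : ℕ} {m f : V n → ℂ} (hm : Integrable m) (hf : Integrable f) :
    Integrable (fun ξ => m ξ * 𝓕 f ξ) := by
  apply hm.mul_bdd (c := ∫ y, ‖f y‖)
  · exact (continuous_fourier hf).aestronglyMeasurable
  · exact Eventually.of_forall fun ξ => norm_fourier_le f ξ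

theorem iF_conv {n : ℕ} {m f : V n → ℂ} (hm : Integrable m) (hf : Integrable f) (x : V n) :
    iF (fun ξ => m ξ * 𝓕 f ξ) x = ∫ y, iF m (x - y) * f y := by
  unfold iF
  simp_rw [fourier_ex f, ← integral_const_mul, ← integral_mul_const]
  rw [integral_integral_swap]
  · congr 1; ext y; congr 1; ext ξ
    rw [sub_eq_add_neg, ex_add]; ring
  · have h1 : Integrable (fun z : V n × V n => m z.1 * f z.2) := hm.mul_prod hf
    have h2 : Integrable (fun z : V n × V n => (m z.1 * f z.2) * (ex (-z.2) z.1 * ex x z.1)) := by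
      apply h1.mul_bdd (c := 1)
      · apply Continuous.aestronglyMeasurable
        apply Continuous.mul
        · exact continuous_ex.comp (by fun_prop : Continuous fun z : V n × V n => (-z.2, z.1))
        · exact continuous_ex.comp (by fun_prop : Continuous fun z : V n × V n => (x, z.1))
      · exact Eventually.of_forall fun z => by simp [norm_ex]
    refine h2.congr (Eventually.of_forall fun z => ?_)
    simp only [Function.uncurry]; ring

theorem pair {n : ℕ} {h u : V n → ℂ} (hh : Integrable h) (hu : Integrable u) :
    ∫ x, (starRingEnd ℂ) (u x) * iF h x = ∫ ξ, h ξ * (starRingEnd ℂ) (𝓕 u ξ) := by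
  unfold iF
  simp_rw [fourier_ex u, ← integral_conj, ← integral_const_mul]
  rw [integral_integral_swap]
  · congr 1; ext y; congr 1; ext ξ
    rw [map_mul, conj_ex, neg_neg]; ring
  · have h1 : Integrable (fun z : V n × V n => (starRingEnd ℂ) (u z.1) * h z.2) := by
      exact Integrable.mul_prod (f := fun x => starRingEnd ℂ (u x)) (hu.congr' (g := fun x => starRingEnd ℂ (u x)) (Complex.continuous_conj.comp_aestronglyMeasurable hu.1) (Eventually.of_forall fun x => by simp)) hh
    have h2 : Integrable (fun z : V n × V n => ((starRingEnd ℂ) (u z.1) * h z.2) * (ex z.1 z.2)) := by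
      apply h1.mul_bdd (c := 1)
      · exact continuous_ex.aestronglyMeasurable
      · exact Eventually.of_forall fun z => by simp [norm_ex]
    refine h2.congr (Eventually.of_forall fun z => ?_)
    simp only [Function.uncurry]; ring

theorem iF_gauss {n : ℕ} {b : ℂ} (hb : 0 < b.re) (x : V n) :
    iF (fun v : V n => cexp (-b * ‖v‖ ^ 2)) x =
      (Real.pi / b) ^ (n / 2 : ℂ) * cexp (-Real.pi ^ 2 * ‖x‖ ^ 2 / b) := by
  rw [iF_neg, fourier_gaussian_innerProductSpace hb]; simp

theorem integrable_gauss {n : ℕ} {b : ℂ} (hb : 0 < b.re) :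
    Integrable (fun v : V n => cexp (-b * ‖v‖ ^ 2)) := by
  simpa using GaussianFourier.integrable_cexp_neg_mul_sq_norm_add hb 0 (0 : V n)

/-- Gaussian identity. -/
theorem gauss_id {n : ℕ} {b : ℂ} (hb : 0 < b.re) {u : V n → ℂ} (hu : Integrable u) :
    ∫ ξ, cexp (-b * ‖ξ‖ ^ 2) * 𝓕 u ξ * (starRingEnd ℂ) (𝓕 u ξ) =
      ∫ x, (starRingEnd ℂ) (u x) * ∫ y, ((Real.pi / b) ^ (n / 2 : ℂ) *
        cexp (-Real.pi ^ 2 * ‖x - y‖ ^ 2 / b)) * u y := by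
  have hg := integrable_gauss (n := n) hb
  rw [← pair (integrable_mul_fourier hg hu) hu]
  congr 1; ext x
  rw [iF_conv hg hu]
  simp_rw [iF_gauss hb]

theorem enn_amgm (a b : ℝ≥0∞) : a * b ≤ 2⁻¹ * (a ^ 2 + b ^ 2) := by
  by_cases ha : a = ⊤
  · subst ha; simp
  by_cases hb : b = ⊤
  · subst hb; simp
  lift a to NNReal using ha
  lift b to NNReal using hb
  have h : 2 * (a * b) ≤ a ^ 2 + b ^ 2 := by
    have := two_mul_le_add_sq a b; rw [mul_assoc] at this; exact this
  have h' : 2 * ((a:ℝ≥0∞) * b) ≤ a ^ 2 + b ^ 2 := by exact_mod_cast h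
  calc (a:ℝ≥0∞) * b = 2⁻¹ * (2 * (a * b)) := by
        rw [← mul_assoc, ENNReal.inv_mul_cancel (by simp) (by simp), one_mul]
    _ ≤ _ := by gcongr

/-- Schur-type bound for a convolution form. -/
theorem schur {n : ℕ} (k u : V n → ℝ≥0∞) (hk : Measurable k) (hu : AEMeasurable u) (hks : ∀ x, k (-x) = k x) :
    ∫⁻ x, u x * ∫⁻ y, k (x - y) * u y ≤ (∫⁻ x, k x) * ∫⁻ x, u x ^ 2 := by
  have hI : ∀ x : V n, ∫⁻ y, k (x - y) = ∫⁻ y, k y := fun x => lintegral_sub_left_eq_self k x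
  have hI' : ∀ y : V n, ∫⁻ x, k (x - y) = ∫⁻ y, k y := fun x => lintegral_sub_right_eq_self k x
  calc ∫⁻ x, u x * ∫⁻ y, k (x - y) * u y = ∫⁻ x, ∫⁻ y, k (x - y) * (u x * u y) := by
        refine lintegral_congr fun x => ?_
        rw [← lintegral_const_mul'']
        · congr 1; ext y; ring
        · exact (by fun_prop : Measurable fun y => k (x - y)).aemeasurable.mul hu
    _ ≤ ∫⁻ x, ∫⁻ y, (2⁻¹ * (k (x - y) * u x ^ 2) + 2⁻¹ * (k (x - y) * u y ^ 2)) := by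
        refine lintegral_mono fun x => lintegral_mono fun y => ?_
        calc _ ≤ k (x - y) * (2⁻¹ * (u x ^ 2 + u y ^ 2)) := mul_le_mul' le_rfl (enn_amgm _ _)
          _ = _ := by ring
    _ = ∫⁻ x, (2⁻¹ * ((∫⁻ y, k y) * u x ^ 2) + ∫⁻ y, 2⁻¹ * (k (x - y) * u y ^ 2)) := by
        refine lintegral_congr fun x => ?_
        rw [lintegral_add_left (by fun_prop)]
        congr 1
        rw [lintegral_const_mul _ (by fun_prop), lintegral_mul_const _ (by fun_prop), hI]
    _ = (∫⁻ x, 2⁻¹ * ((∫⁻ y, k y) * u x ^ 2)) + ∫⁻ x, ∫⁻ y, 2⁻¹ * (k (x - y) * u y ^ 2) := by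
        apply lintegral_add_left'
        exact ((hu.pow_const 2).const_mul _).const_mul _
    _ = (∫⁻ x, 2⁻¹ * ((∫⁻ y, k y) * u x ^ 2)) + ∫⁻ y, ∫⁻ x, 2⁻¹ * (k (x - y) * u y ^ 2) := by
        congr 1
        apply lintegral_lintegral_swap
        apply AEMeasurable.const_mul
        apply AEMeasurable.mul
        · exact (by fun_prop : Measurable fun z : V n × V n => k (z.1 - z.2)).aemeasurable
        · exact (hu.pow_const 2).comp_snd
    _ = (∫⁻ x, 2⁻¹ * ((∫⁻ y, k y) * u x ^ 2)) + ∫⁻ y, 2⁻¹ * ((∫⁻ y, k y) * u y ^ 2) := by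
        congr 1
        refine lintegral_congr fun y => ?_
        rw [lintegral_const_mul _ (by fun_prop), lintegral_mul_const _ (by fun_prop), hI']
    _ = _ := by
        rw [lintegral_const_mul'' _ ((hu.pow_const 2).const_mul _),
          lintegral_const_mul'' _ (hu.pow_const 2), ← add_mul, ENNReal.inv_two_add_inv_two, one_mul]

theorem bessel_eps {n : ℕ} {u : V n → ℂ} (hu : Integrable u) (ε : ℝ) (hε : 0 < ε) :
    ∫⁻ ξ, ENNReal.ofReal (Real.exp (-ε * ‖ξ‖ ^ 2)) * ‖𝓕 u ξ‖ₑ ^ 2 ≤ ∫⁻ x, ‖u x‖ₑ ^ 2 := by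
  have hb : 0 < (ε : ℂ).re := by simpa using hε
  have hid := gauss_id hb hu
  have hg := integrable_gauss (n := n) hb
  have hmul : ∀ ξ : V n, cexp (-(ε:ℂ) * ‖ξ‖ ^ 2) * 𝓕 u ξ * (starRingEnd ℂ) (𝓕 u ξ) =
      ((Real.exp (-ε * ‖ξ‖ ^ 2) * ‖𝓕 u ξ‖ ^ 2 : ℝ) : ℂ) := by
    intro ξ
    rw [mul_assoc, Complex.mul_conj, Complex.normSq_eq_norm_sq]; push_cast; rfl
  simp_rw [hmul] at hid
  rw [_root_.integral_complex_ofReal] at hid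
  have hint : Integrable (fun ξ : V n => Real.exp (-ε * ‖ξ‖ ^ 2) * ‖𝓕 u ξ‖ ^ 2) := by
    have h1 : Integrable (fun ξ : V n => Real.exp (-ε * ‖ξ‖ ^ 2)) := by
      have := hg.norm
      refine this.congr (Eventually.of_forall fun ξ => ?_)
      simp only [Complex.norm_exp]
      congr 1
      rw [← ofReal_neg, ← ofReal_pow, ← ofReal_mul, ofReal_re]
    apply h1.mul_bdd (c := (∫ y, ‖u y‖) ^ 2)
    · exact ((continuous_fourier hu).norm.pow 2).aestronglyMeasurable
    · refine Eventually.of_forall fun ξ => ?_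
      rw [norm_pow, norm_norm]; gcongr; exact norm_fourier_le u ξ
  have h0 : ∫⁻ ξ, ENNReal.ofReal (Real.exp (-ε * ‖ξ‖ ^ 2)) * ‖𝓕 u ξ‖ₑ ^ 2 =
      ENNReal.ofReal (∫ ξ : V n, Real.exp (-ε * ‖ξ‖ ^ 2) * ‖𝓕 u ξ‖ ^ 2) := by
    rw [ofReal_integral_eq_lintegral_ofReal hint (Eventually.of_forall fun ξ => by positivity)]
    refine lintegral_congr fun ξ => ?_
    rw [ENNReal.ofReal_mul (by positivity), ENNReal.ofReal_pow (by positivity), ofReal_norm]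
  set k : V n → ℝ := fun x => (Real.pi / ε) ^ (n / 2 : ℝ) * Real.exp (-(Real.pi ^ 2 / ε) * ‖x‖ ^ 2) with hk
  have hk0 : ∀ x, 0 ≤ k x := fun x => by positivity
  have hpi := Real.pi_pos
  have hkint : ∫ x, k x = 1 := by
    rw [hk, integral_const_mul, GaussianFourier.integral_rexp_neg_mul_sq_norm (by positivity)]
    simp only [finrank_euclideanSpace, Fintype.card_fin]
    rw [← Real.mul_rpow (by positivity) (by positivity)]
    rw [show Real.pi / ε * (Real.pi / (Real.pi ^ 2 / ε)) = 1 by field_simp, Real.one_rpow]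
  have hki : Integrable k := by
    by_contra h
    rw [integral_undef h] at hkint; exact zero_ne_one hkint
  have hkl : ∫⁻ x, ENNReal.ofReal (k x) = 1 := by
    rw [← ofReal_integral_eq_lintegral_ofReal hki (Eventually.of_forall hk0), hkint, ENNReal.ofReal_one]
  have hkeq : ∀ x : V n, ((Real.pi:ℂ) / ε) ^ (n / 2 : ℂ) * cexp (-Real.pi ^ 2 * ‖x‖ ^ 2 / ε) = (k x : ℂ) := by
    intro x
    rw [hk]; push_cast
    congr 1
    · rw [← ofReal_div, show (n / 2 : ℂ) = ((n / 2 : ℝ) : ℂ) by push_cast; rfl,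
        ← ofReal_cpow (by positivity)]
    · congr 1; field_simp
  rw [h0]
  calc ENNReal.ofReal (∫ ξ : V n, Real.exp (-ε * ‖ξ‖ ^ 2) * ‖𝓕 u ξ‖ ^ 2)
      ≤ ‖((∫ ξ : V n, Real.exp (-ε * ‖ξ‖ ^ 2) * ‖𝓕 u ξ‖ ^ 2 : ℝ) : ℂ)‖ₑ := by
        rw [← ofReal_norm, Complex.norm_real]
        exact ENNReal.ofReal_le_ofReal (le_abs_self _)
    _ ≤ ∫⁻ x, ‖u x‖ₑ * ∫⁻ y, ENNReal.ofReal (k (x - y)) * ‖u y‖ₑ := by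
        refine (congrArg enorm hid).le.trans ?_
        refine (enorm_integral_le_lintegral_enorm _).trans (lintegral_mono fun x => ?_)
        rw [enorm_mul]
        refine mul_le_mul' (le_of_eq ?_) ?_
        · rw [← ofReal_norm, ← ofReal_norm, RCLike.norm_conj]
        · refine (enorm_integral_le_lintegral_enorm _).trans (le_of_eq (lintegral_congr fun y => ?_))
          rw [hkeq, enorm_mul]
          congr 1
          rw [← ofReal_norm, Complex.norm_real, Real.norm_of_nonneg (hk0 _)]
    _ ≤ (∫⁻ x, ENNReal.ofReal (k x)) * ∫⁻ x, ‖u x‖ₑ ^ 2 := by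
        apply schur (fun x => ENNReal.ofReal (k x)) (fun x => ‖u x‖ₑ)
        · apply Measurable.ennreal_ofReal; rw [hk]; fun_prop
        · exact hu.aestronglyMeasurable.enorm
        · intro x; simp only [hk, norm_neg]
    _ = _ := by rw [hkl, one_mul]

theorem bessel {n : ℕ} {u : V n → ℂ} (hu : Integrable u) :
    ∫⁻ ξ, ‖𝓕 u ξ‖ₑ ^ 2 ≤ ∫⁻ x, ‖u x‖ₑ ^ 2 := by
  have hc := continuous_fourier hu
  have hlim : ∀ ξ : V n, Tendsto (fun k : ℕ => ENNReal.ofReal (Real.exp (-(1 / ((k:ℝ) + 1)) * ‖ξ‖ ^ 2)) *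
      ‖𝓕 u ξ‖ₑ ^ 2) atTop (𝓝 (‖𝓕 u ξ‖ₑ ^ 2)) := by
    intro ξ
    have h1 : Tendsto (fun k : ℕ => Real.exp (-(1 / ((k:ℝ) + 1)) * ‖ξ‖ ^ 2)) atTop (𝓝 (Real.exp (-0 * ‖ξ‖ ^ 2))) :=
      (Real.continuous_exp.tendsto _).comp ((tendsto_one_div_add_atTop_nhds_zero_nat.neg).mul_const _)
    have h2 := ENNReal.tendsto_ofReal h1
    simp only [neg_zero, zero_mul, Real.exp_zero, ENNReal.ofReal_one] at h2
    have h3 := ENNReal.Tendsto.mul_const h2 (b := ‖𝓕 u ξ‖ₑ ^ 2) (Or.inl one_ne_zero)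
    simpa using h3
  calc ∫⁻ ξ, ‖𝓕 u ξ‖ₑ ^ 2 = ∫⁻ ξ, liminf (fun k : ℕ => ENNReal.ofReal (Real.exp (-(1 / ((k:ℝ) + 1)) * ‖ξ‖ ^ 2)) *
      ‖𝓕 u ξ‖ₑ ^ 2) atTop := lintegral_congr fun ξ => (hlim ξ).liminf_eq.symm
    _ ≤ liminf (fun k : ℕ => ∫⁻ ξ, ENNReal.ofReal (Real.exp (-(1 / ((k:ℝ) + 1)) * ‖ξ‖ ^ 2)) *
      ‖𝓕 u ξ‖ₑ ^ 2) atTop := by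
        apply lintegral_liminf_le
        intro k
        have := hc.measurable.enorm
        fun_prop
    _ ≤ _ := by
        refine liminf_le_of_frequently_le' (Frequently.of_forall fun k => ?_)
        exact bessel_eps hu _ (by positivity)

theorem bessel_inv {n : ℕ} {h : V n → ℂ} (hh : Integrable h) :
    ∫⁻ x, ‖iF h x‖ₑ ^ 2 ≤ ∫⁻ ξ, ‖h ξ‖ₑ ^ 2 := by
  simp_rw [iF_neg]
  rw [lintegral_neg_eq_self (fun x => ‖𝓕 h x‖ₑ ^ 2)]
  exact bessel hh

end SqFn

namespace SqFn

/-- the multiplier -/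
noncomputable def mt (n : ℕ) (φ : ℝ → ℝ) (δ t : ℝ) (ξ : V n) : ℂ :=
  (φ (δ⁻¹ * (1 - ‖ξ‖ ^ 2 / t ^ 2)) : ℂ)

/-- the frequency-localized pieces -/
noncomputable def FT (n : ℕ) (φ : ℝ → ℝ) (δ t : ℝ) (g : V n → ℂ) (x : V n) : ℂ :=
  iF (fun ξ => mt n φ δ t ξ * 𝓕 g ξ) x

/-- the annulus -/
def AA (n : ℕ) (δ t : ℝ) : Set (V n) := {ξ | |1 - ‖ξ‖ ^ 2 / t ^ 2| ≤ δ / 2}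

/-- the localized `L²` norm squared -/
noncomputable def NN (n : ℕ) (δ t : ℝ) (g : V n → ℂ) : ℝ≥0∞ :=
  ∫⁻ ξ in AA n δ t, ‖𝓕 g ξ‖ₑ ^ 2

/-- standing assumptions on the profile -/
structure Good (φ : ℝ → ℝ) : Prop where
  smooth : ContDiff ℝ (⊤ : ℕ∞) φ
  bdd : ∀ s, |φ s| ≤ 1
  supp : ∀ s, 1 / 2 < |s| → φ s = 0

theorem measurableSet_AA (n : ℕ) (δ t : ℝ) : MeasurableSet (AA n δ t) :=
  measurableSet_le (by fun_prop) (by fun_prop)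

theorem mt_zero {n : ℕ} {φ : ℝ → ℝ} (hφ : Good φ) {δ : ℝ} (hδ : 0 < δ) (t : ℝ) {ξ : V n}
    (h : ξ ∉ AA n δ t) : mt n φ δ t ξ = 0 := by
  unfold mt
  rw [hφ.supp, ofReal_zero]
  simp only [AA, Set.mem_setOf_eq, not_le] at h
  rw [abs_mul, abs_of_pos (inv_pos.2 hδ)]
  rw [lt_inv_mul_iff₀ hδ]; linarith

theorem norm_mt_le {n : ℕ} {φ : ℝ → ℝ} (hφ : Good φ) (δ t : ℝ) (ξ : V n) : ‖mt n φ δ t ξ‖ ≤ 1 := by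
  unfold mt; rw [Complex.norm_real]; exact hφ.bdd _

theorem enorm_mt_le {n : ℕ} {φ : ℝ → ℝ} (hφ : Good φ) {δ : ℝ} (hδ : 0 < δ) (t : ℝ) (ξ : V n) :
    ‖mt n φ δ t ξ‖ₑ ≤ (AA n δ t).indicator (fun _ => 1) ξ := by
  by_cases h : ξ ∈ AA n δ t
  · rw [Set.indicator_of_mem h, ← ofReal_norm, ← ENNReal.ofReal_one]
    exact ENNReal.ofReal_le_ofReal (norm_mt_le hφ δ t ξ)
  · rw [mt_zero hφ hδ t h]; simp

theorem continuous_mt {n : ℕ} {φ : ℝ → ℝ} (hφ : Good φ) (δ t : ℝ) : Continuous (mt n φ δ t) := by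
  have := hφ.smooth.continuous
  unfold mt; fun_prop

theorem AA_norm {n : ℕ} {δ t : ℝ} (hδ : δ ≤ 1) (ht : 0 < t) {ξ : V n} (h : ξ ∈ AA n δ t) :
    ‖ξ‖ ^ 2 ≤ 3 / 2 * t ^ 2 ∧ t ^ 2 / 2 ≤ ‖ξ‖ ^ 2 := by
  simp only [AA, Set.mem_setOf_eq] at h
  have h2 := abs_le.1 h
  have ht2 : 0 < t ^ 2 := by positivity
  constructor
  · have : ‖ξ‖ ^ 2 / t ^ 2 ≤ 3 / 2 := by linarith
    rwa [div_le_iff₀ ht2] at this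
  · have : 1 / 2 ≤ ‖ξ‖ ^ 2 / t ^ 2 := by linarith
    rw [le_div_iff₀ ht2] at this; linarith

theorem mt_zero_of_norm {n : ℕ} {φ : ℝ → ℝ} (hφ : Good φ) {δ : ℝ} (hδ : 0 < δ) (hδ1 : δ ≤ 1) {t : ℝ} (ht : 0 < t)
    {ξ : V n} (h : ξ ∉ Metric.closedBall (0 : V n) (3 / 2 * t)) : mt n φ δ t ξ = 0 := by
  by_cases h' : ξ ∈ AA n δ t
  · exfalso; apply h
    have := (AA_norm hδ1 ht h').1
    rw [mem_closedBall_zero_iff]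
    apply le_of_sq_le_sq _ (by positivity)
    nlinarith
  · exact mt_zero hφ hδ t h'

theorem integrable_mt {n : ℕ} {φ : ℝ → ℝ} (hφ : Good φ) {δ : ℝ} (hδ : 0 < δ) (hδ1 : δ ≤ 1) {t : ℝ} (ht : 0 < t) :
    Integrable (mt n φ δ t) := by
  apply (continuous_mt hφ δ t).integrable_of_hasCompactSupport
  exact HasCompactSupport.intro (isCompact_closedBall (0 : V n) (3 / 2 * t)) fun ξ h =>
    mt_zero_of_norm hφ hδ hδ1 ht h

theorem FT_conv {n : ℕ} {φ : ℝ → ℝ} (hφ : Good φ) {δ : ℝ} (hδ : 0 < δ) (hδ1 : δ ≤ 1) {t : ℝ} (ht : 0 < t)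
    {g : V n → ℂ} (hg : Integrable g) (x : V n) :
    FT n φ δ t g x = ∫ y, iF (mt n φ δ t) (x - y) * g y :=
  iF_conv (integrable_mt hφ hδ hδ1 ht) hg x

theorem FT_L2 {n : ℕ} {φ : ℝ → ℝ} (hφ : Good φ) {δ : ℝ} (hδ : 0 < δ) (hδ1 : δ ≤ 1) {t : ℝ} (ht : 0 < t)
    {g : V n → ℂ} (hg : Integrable g) : ∫⁻ x, ‖FT n φ δ t g x‖ₑ ^ 2 ≤ NN n δ t g := by
  refine (bessel_inv (integrable_mul_fourier (integrable_mt hφ hδ hδ1 ht) hg)).trans ?_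
  unfold NN
  rw [← lintegral_indicator (measurableSet_AA n δ t)]
  refine lintegral_mono fun ξ => ?_
  simp only []
  rw [enorm_mul, mul_pow]
  by_cases h : ξ ∈ AA n δ t
  · rw [Set.indicator_of_mem h]
    have := enorm_mt_le hφ hδ t ξ
    rw [Set.indicator_of_mem h] at this
    calc _ ≤ (1:ℝ≥0∞) ^ 2 * ‖𝓕 g ξ‖ₑ ^ 2 := by gcongr
      _ = _ := by simp
  · rw [mt_zero hφ hδ t h]; simp

theorem t_meas (n : ℕ) {δ : ℝ} (hδ : 0 < δ) (hδ1 : δ ≤ 1) (ξ : V n) :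
    ∫⁻ t in Set.Ioi (0:ℝ), (AA n δ t).indicator (fun _ => 1) ξ * ENNReal.ofReal t⁻¹ ≤
      ENNReal.ofReal (2 * δ) := by
  by_cases hξ : ξ = 0
  · subst hξ
    rw [setLIntegral_congr_fun (g := fun _ => 0) measurableSet_Ioi]
    · simp
    · intro t ht
      have : (0 : V n) ∉ AA n δ t := by
        simp [AA]; linarith
      simp [this]
  set ρ := ‖ξ‖ with hρ
  have hρ0 : 0 < ρ := norm_pos_iff.2 hξ
  set d := δ / 2 with hd
  have hd0 : 0 < d := by positivity
  have hd1 : d ≤ 1 / 2 := by linarith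
  set A := Real.sqrt (1 + d) with hA
  set B := Real.sqrt (1 - d) with hB
  have hA0 : 0 < A := Real.sqrt_pos.2 (by linarith)
  have hB0 : 0 < B := Real.sqrt_pos.2 (by linarith)
  have hA2 : A ^ 2 = 1 + d := Real.sq_sqrt (by linarith)
  have hB2 : B ^ 2 = 1 - d := Real.sq_sqrt (by linarith)
  have key : ∀ t ∈ Set.Ioi (0:ℝ), (AA n δ t).indicator (fun _ => (1:ℝ≥0∞)) ξ * ENNReal.ofReal t⁻¹ ≤
      (Set.Icc (ρ / A) (ρ / B)).indicator (fun _ => ENNReal.ofReal (A / ρ)) t := by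
    intro t ht
    have ht : 0 < t := ht
    by_cases h : ξ ∈ AA n δ t
    · have h2 : |1 - ρ ^ 2 / t ^ 2| ≤ δ / 2 := h
      rw [abs_le] at h2
      have ht2 : 0 < t ^ 2 := by positivity
      have h3 : ρ ^ 2 ≤ (1 + d) * t ^ 2 := by rw [← div_le_iff₀ ht2]; linarith
      have h4 : (1 - d) * t ^ 2 ≤ ρ ^ 2 := by rw [← le_div_iff₀ ht2]; linarith
      have h5 : ρ ≤ A * t := le_of_sq_le_sq (by rw [mul_pow, hA2]; exact h3) (by positivity)
      have h6 : B * t ≤ ρ := le_of_sq_le_sq (by rw [mul_pow, hB2]; exact h4) (by positivity)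
      have h7 : ρ / A ≤ t := by rw [div_le_iff₀ hA0]; linarith
      have h8 : t ≤ ρ / B := by rw [le_div_iff₀ hB0]; linarith
      rw [Set.indicator_of_mem h, Set.indicator_of_mem (Set.mem_Icc.2 ⟨h7, h8⟩), one_mul]
      apply ENNReal.ofReal_le_ofReal
      rw [inv_le_comm₀ ht (by positivity), inv_div]; exact h7
    · rw [Set.indicator_of_notMem h, zero_mul]; exact zero_le
  refine (setLIntegral_mono' measurableSet_Ioi key).trans ?_
  refine (setLIntegral_le_lintegral _ _).trans ?_
  rw [lintegral_indicator measurableSet_Icc, setLIntegral_const, Real.volume_Icc,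
    ← ENNReal.ofReal_mul (by positivity)]
  apply ENNReal.ofReal_le_ofReal
  have e1 : A / ρ * (ρ / B - ρ / A) = A / B - 1 := by field_simp
  rw [e1]
  have e2 : A / B ≤ 1 + 2 * δ := by
    rw [div_le_iff₀ hB0]
    apply le_of_sq_le_sq _ (by positivity)
    rw [mul_pow, hA2, hB2]
    have : δ = 2 * d := by rw [hd]; ring
    rw [this]; nlinarith [mul_pos hd0 hd0]
  linarith

theorem meas_AA_joint (n : ℕ) (δ : ℝ) : MeasurableSet {z : ℝ × V n | z.2 ∈ AA n δ z.1} := by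
  exact measurableSet_le (f := fun z : ℝ × V n => |1 - ‖z.2‖ ^ 2 / z.1 ^ 2|) (g := fun _ => δ / 2)
    (by fun_prop) (by fun_prop)

theorem measurable_AA_ind (n : ℕ) (δ : ℝ) :
    Measurable (fun z : ℝ × V n => (AA n δ z.1).indicator (fun _ => (1:ℝ≥0∞)) z.2) := by
  have : (fun z : ℝ × V n => (AA n δ z.1).indicator (fun _ => (1:ℝ≥0∞)) z.2) =
    Set.indicator {z : ℝ × V n | z.2 ∈ AA n δ z.1} (fun _ => (1:ℝ≥0∞)) := by
    ext z; simp [Set.indicator]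
  rw [this]
  exact measurable_const.indicator (meas_AA_joint n δ)

theorem NN_eq (n : ℕ) (δ t : ℝ) (g : V n → ℂ) :
    NN n δ t g = ∫⁻ ξ, (AA n δ t).indicator (fun _ => (1:ℝ≥0∞)) ξ * ‖𝓕 g ξ‖ₑ ^ 2 := by
  unfold NN
  rw [← lintegral_indicator (measurableSet_AA n δ t)]
  refine lintegral_congr fun ξ => ?_
  simp [Set.indicator]

theorem measurable_NN {n : ℕ} (δ : ℝ) {g : V n → ℂ} (hg : Integrable g) :
    Measurable (fun t => NN n δ t g) := by
  simp_rw [NN_eq]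
  apply Measurable.lintegral_prod_right' (f := fun z : ℝ × V n =>
    (AA n δ z.1).indicator (fun _ => (1:ℝ≥0∞)) z.2 * ‖𝓕 g z.2‖ₑ ^ 2)
  have := (continuous_fourier hg).measurable.enorm
  exact (measurable_AA_ind n δ).mul ((this.comp measurable_snd).pow_const 2)

theorem NN_t {n : ℕ} {δ : ℝ} (hδ : 0 < δ) (hδ1 : δ ≤ 1) {g : V n → ℂ} (hg : Integrable g) :
    ∫⁻ t in Set.Ioi (0:ℝ), NN n δ t g * ENNReal.ofReal t⁻¹ ≤ ENNReal.ofReal (2 * δ) * ∫⁻ x, ‖g x‖ₑ ^ 2 := by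
  have hm := (continuous_fourier hg).measurable.enorm
  have hA := measurable_AA_ind n δ
  have hA1 : ∀ t, Measurable (fun ξ => (AA n δ t).indicator (fun _ => (1:ℝ≥0∞)) ξ) := fun t =>
    measurable_const.indicator (measurableSet_AA n δ t)
  calc _ = ∫⁻ t in Set.Ioi (0:ℝ), ∫⁻ ξ, (AA n δ t).indicator (fun _ => (1:ℝ≥0∞)) ξ * ENNReal.ofReal t⁻¹ * ‖𝓕 g ξ‖ₑ ^ 2 := by
        refine lintegral_congr fun t => ?_
        rw [NN_eq, ← lintegral_mul_const]
        · congr 1; ext ξ; ring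
        · exact (hA1 t).mul (by fun_prop)
    _ = ∫⁻ ξ, ∫⁻ t in Set.Ioi (0:ℝ), (AA n δ t).indicator (fun _ => (1:ℝ≥0∞)) ξ * ENNReal.ofReal t⁻¹ * ‖𝓕 g ξ‖ₑ ^ 2 := by
        apply lintegral_lintegral_swap
        apply Measurable.aemeasurable
        have : Measurable (fun z : ℝ × V n => (AA n δ z.1).indicator (fun _ => (1:ℝ≥0∞)) z.2 *
            ENNReal.ofReal z.1⁻¹ * ‖𝓕 g z.2‖ₑ ^ 2) := (hA.mul (by fun_prop)).mul ((hm.comp measurable_snd).pow_const 2)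
        exact this
    _ ≤ ∫⁻ ξ, ENNReal.ofReal (2 * δ) * ‖𝓕 g ξ‖ₑ ^ 2 := by
        refine lintegral_mono fun ξ => ?_
        simp only []
        rw [lintegral_mul_const]
        · exact mul_le_mul' (t_meas n hδ hδ1 ξ) le_rfl
        · exact (hA.comp (by fun_prop : Measurable fun t : ℝ => (t, ξ))).mul (by fun_prop)
    _ = ENNReal.ofReal (2 * δ) * ∫⁻ ξ, ‖𝓕 g ξ‖ₑ ^ 2 := by
        rw [lintegral_const_mul _ (by fun_prop)]
    _ ≤ _ := mul_le_mul' le_rfl (bessel hg)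

theorem stronglyMeasurable_FT {n : ℕ} {φ : ℝ → ℝ} (hφ : Good φ) (δ : ℝ) {g : V n → ℂ} (hg : Integrable g) :
    StronglyMeasurable (fun z : ℝ × V n => FT n φ δ z.1 g z.2) := by
  unfold FT iF
  apply StronglyMeasurable.integral_prod_right (f := fun (z : ℝ × V n) ξ => mt n φ δ z.1 ξ * 𝓕 g ξ * ex z.2 ξ)
  apply Measurable.stronglyMeasurable
  have h1 := (continuous_fourier hg).measurable
  have h2 : Measurable (fun w : (ℝ × V n) × V n => ex w.1.2 w.2) :=
    (continuous_ex.comp (by fun_prop : Continuous fun w : (ℝ × V n) × V n => (w.1.2, w.2))).measurable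
  have h3 : Measurable (fun w : (ℝ × V n) × V n => mt n φ δ w.1.1 w.2) := by
    have := hφ.smooth.continuous.measurable
    unfold mt; fun_prop
  exact (h3.mul (h1.comp measurable_snd)).mul h2

theorem measurable_FT {n : ℕ} {φ : ℝ → ℝ} (hφ : Good φ) (δ : ℝ) {g : V n → ℂ} (hg : Integrable g) :
    Measurable (fun z : ℝ × V n => ‖FT n φ δ z.1 g z.2‖ₑ) :=
  (stronglyMeasurable_FT hφ δ hg).measurable.enorm

theorem FT_add {n : ℕ} {φ : ℝ → ℝ} (hφ : Good φ) {δ : ℝ} (hδ : 0 < δ) (hδ1 : δ ≤ 1) {t : ℝ} (ht : 0 < t)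
    {g h : V n → ℂ} (hg : Integrable g) (hh : Integrable h) (x : V n) :
    FT n φ δ t (g + h) x = FT n φ δ t g x + FT n φ δ t h x := by
  unfold FT iF
  rw [← integral_add]
  · congr 1; ext ξ
    simp only []
    rw [fourier_ex, fourier_ex, fourier_ex]
    have : ∫ y, (g + h) y * ex (-y) ξ = (∫ y, g y * ex (-y) ξ) + ∫ y, h y * ex (-y) ξ := by
      rw [← integral_add]
      · congr 1; ext y; simp [add_mul]
      · refine (integrable_mul_ex hg (-ξ)).congr (Eventually.of_forall fun y => ?_)
        simp only [ex, inner_neg_left, real_inner_comm]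
      · refine (integrable_mul_ex hh (-ξ)).congr (Eventually.of_forall fun y => ?_)
        simp only [ex, inner_neg_left, real_inner_comm]
    rw [this]; ring
  · exact integrable_mul_ex (integrable_mul_fourier (integrable_mt hφ hδ hδ1 ht) hg) x
  · exact integrable_mul_ex (integrable_mul_fourier (integrable_mt hφ hδ hδ1 ht) hh) x

/-- global `L²` estimate -/
theorem FT_L2_t {n : ℕ} {φ : ℝ → ℝ} (hφ : Good φ) {δ : ℝ} (hδ : 0 < δ) (hδ1 : δ ≤ 1)
    {g : V n → ℂ} (hg : Integrable g) :
    ∫⁻ x, ∫⁻ t in Set.Ioi (0:ℝ), ‖FT n φ δ t g x‖ₑ ^ 2 * ENNReal.ofReal t⁻¹ ≤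
      ENNReal.ofReal (2 * δ) * ∫⁻ x, ‖g x‖ₑ ^ 2 := by
  have hm := measurable_FT hφ δ hg
  refine le_trans (le_of_eq ?_) (le_trans (setLIntegral_mono' measurableSet_Ioi
    fun t (ht : 0 < t) => mul_le_mul_left (FT_L2 hφ hδ hδ1 ht hg) (ENNReal.ofReal t⁻¹)) (NN_t hδ hδ1 hg))
  rw [lintegral_lintegral_swap]
  · refine lintegral_congr fun t => ?_
    rw [lintegral_mul_const]
    exact (hm.comp measurable_prodMk_left).pow_const 2
  · apply Measurable.aemeasurable
    have : Measurable (fun z : V n × ℝ => ‖FT n φ δ z.2 g z.1‖ₑ) :=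
      Measurable.comp (g := fun z : ℝ × V n => ‖FT n φ δ z.1 g z.2‖ₑ) (f := fun z : V n × ℝ => (z.2, z.1)) hm
        (measurable_snd.prodMk measurable_fst)
    have h2 : Measurable (fun z : V n × ℝ => ENNReal.ofReal z.2⁻¹) := measurable_snd.inv.ennreal_ofReal
    exact Measurable.fun_mul (this.pow_const 2) h2

end SqFn

namespace SqFn

theorem iF_scale {n : ℕ} (m : V n → ℂ) {t : ℝ} (ht : 0 < t) (x : V n) :
    iF (fun ξ => m (t⁻¹ • ξ)) x = (t ^ n : ℝ) * iF m (t • x) := by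
  have h := Measure.integral_comp_smul_of_nonneg (volume : Measure (V n))
    (fun ξ => m ξ * ex (t • x) ξ) t⁻¹ (hR := by positivity)
  unfold iF
  have e : ∀ ξ : V n, ex (t • x) (t⁻¹ • ξ) = ex x ξ := by
    intro ξ; unfold ex
    rw [real_inner_smul_left, real_inner_smul_right]
    rw [mul_inv_cancel_left₀ ht.ne']
  simp_rw [e] at h
  rw [h]
  simp

theorem decay_core {n : ℕ} (M : ℕ) : ∃ K : ℝ, 0 < K ∧ ∀ (m : V n → ℂ) (C D : ℝ), 0 ≤ C → 1 ≤ D →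
    ContDiff ℝ (⊤ : ℕ∞) m → (∀ ξ, ξ ∉ Metric.closedBall (0 : V n) 2 → m ξ = 0) →
    (∀ j ≤ M, ∀ x ∈ Metric.closedBall (0 : V n) 2, ‖iteratedFDeriv ℝ j m x‖ ≤ C * D ^ j) →
    ∀ x, ‖x‖ ^ M * ‖iF m x‖ ≤ K * C * D ^ M := by
  set vol := (volume (Metric.closedBall (0 : V n) 2)).toReal
  have hvt : volume (Metric.closedBall (0 : V n) 2) ≠ ⊤ := measure_closedBall_lt_top.ne
  refine ⟨2 ^ M * (M + 1) * (vol + 1), by positivity, ?_⟩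
  intro m C D hC hD hm hs hb x
  have hcs : HasCompactSupport m := HasCompactSupport.intro (isCompact_closedBall (0 : V n) 2) hs
  have hts : tsupport m ⊆ Metric.closedBall (0 : V n) 2 := by
    apply closure_minimal _ Metric.isClosed_closedBall
    intro y hy; by_contra h; exact hy (hs y h)
  have hint : ∀ j : ℕ, Integrable (fun v => ‖iteratedFDeriv ℝ j m v‖) := by
    intro j
    apply Continuous.integrable_of_hasCompactSupport
    · exact (hm.continuous_iteratedFDeriv (by exact_mod_cast le_top)).norm
    · exact (hcs.iteratedFDeriv j).norm
  have hle : ∀ j ≤ M, ∫ v, ‖iteratedFDeriv ℝ j m v‖ ≤ C * D ^ M * vol := by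
    intro j hj
    have : ∫ v, ‖iteratedFDeriv ℝ j m v‖ = ∫ v in Metric.closedBall (0 : V n) 2, ‖iteratedFDeriv ℝ j m v‖ := by
      symm
      apply setIntegral_eq_integral_of_forall_compl_eq_zero
      intro v hv
      rw [norm_eq_zero]
      by_contra h
      exact hv (hts (support_iteratedFDeriv_subset (𝕜 := ℝ) j h))
    rw [this]
    have h2 : ∫ v in Metric.closedBall (0 : V n) 2, ‖iteratedFDeriv ℝ j m v‖ ≤
        ∫ v in Metric.closedBall (0 : V n) 2, C * D ^ M := by
      apply setIntegral_mono_on (hint j).integrableOn _ measurableSet_closedBall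
      · intro v hv
        exact (hb j hj v hv).trans (by gcongr)
      · exact integrableOn_const hvt
    refine h2.trans (le_of_eq ?_)
    rw [setIntegral_const, smul_eq_mul, mul_comm]; rfl
  have key := Real.pow_mul_norm_iteratedFDeriv_fourier_le (f := m) (K := 0) (N := ⊤) (by exact_mod_cast hm)
    (fun k j hk _ => by
      have : k = 0 := by simpa using hk
      subst this; simpa using hint j) (k := 0) (n := M) le_rfl le_top (-x)
  rw [norm_neg, norm_iteratedFDeriv_zero, ← iF_neg] at key
  refine key.trans ?_
  have : ∑ p ∈ Finset.range (0 + 1) ×ˢ Finset.range (M + 1),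
        ∫ v, ‖v‖ ^ p.1 * ‖iteratedFDeriv ℝ p.2 m v‖ ≤ (M + 1) * (C * D ^ M * vol) := by
    rw [Finset.sum_product]
    simp only [zero_add, Finset.range_one, Finset.sum_singleton, pow_zero, one_mul]
    refine (Finset.sum_le_sum (fun j hj => hle j (by simpa [Nat.lt_succ_iff] using hj))).trans ?_
    simp
  calc _ ≤ (2 * Real.pi) ^ 0 * (2 * ((0:ℕ):ℝ) + 2) ^ M * ((M + 1) * (C * D ^ M * vol)) := by gcongr
    _ = 2 ^ M * (M + 1) * vol * C * D ^ M := by simp; ring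
    _ ≤ _ := by gcongr; linarith

theorem iterated_bound {E : Type*} [NormedAddCommGroup E] [NormedSpace ℝ E] {F : Type*} [NormedAddCommGroup F]
    [NormedSpace ℝ F] (g : E → F) (hg : ContDiff ℝ (⊤ : ℕ∞) g) (S : Set E) (hS : IsCompact S) (M : ℕ) :
    ∃ B : ℝ, 1 ≤ B ∧ ∀ i ≤ M, ∀ x ∈ S, ‖iteratedFDeriv ℝ i g x‖ ≤ B := by
  have : ∀ i : ℕ, ∃ C, ∀ x ∈ S, ‖iteratedFDeriv ℝ i g x‖ ≤ C := fun i =>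
    hS.exists_bound_of_continuousOn (hg.continuous_iteratedFDeriv (by exact_mod_cast le_top)).continuousOn
  choose c hc using this
  refine ⟨1 + ∑ i ∈ Finset.range (M + 1), |c i|, ?_, ?_⟩
  · have : 0 ≤ ∑ i ∈ Finset.range (M + 1), |c i| := Finset.sum_nonneg fun i _ => abs_nonneg _
    linarith
  · intro i hi x hx
    have : |c i| ≤ ∑ i ∈ Finset.range (M + 1), |c i| :=
      Finset.single_le_sum (f := fun i => |c i|) (fun i _ => abs_nonneg _) (Finset.mem_range.2 (by omega))
    linarith [hc i x hx, le_abs_self (c i)]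

theorem kernel_unit {n : ℕ} {φ : ℝ → ℝ} (hφ : Good φ) (M : ℕ) : ∃ C : ℝ, 0 < C ∧ ∀ δ : ℝ, 0 < δ → δ ≤ 1 →
    ∀ x : V n, (δ * ‖x‖) ^ M * ‖iF (mt n φ δ 1) x‖ ≤ C := by
  obtain ⟨K, hK, hcore⟩ := decay_core (n := n) M
  set Φ : ℝ → ℂ := fun s => (φ s : ℂ) with hΦ
  have hΦs : ContDiff ℝ (⊤ : ℕ∞) Φ := ofRealCLM.contDiff.comp hφ.smooth
  obtain ⟨B1, hB1, hb1⟩ := iterated_bound Φ hΦs (Set.Icc (-1) 1) isCompact_Icc M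
  have hcon : ContDiff ℝ (⊤ : ℕ∞) (fun ξ : V n => 1 - ‖ξ‖ ^ 2) := contDiff_const.sub (contDiff_norm_sq ℝ)
  obtain ⟨B2, hB2, hb2⟩ := iterated_bound (fun ξ : V n => 1 - ‖ξ‖ ^ 2) hcon (Metric.closedBall 0 2) (isCompact_closedBall _ _) M
  have hb1' : ∀ i ≤ M, ∀ s, ‖iteratedFDeriv ℝ i Φ s‖ ≤ B1 := by
    intro i hi s
    by_cases hs : s ∈ Set.Icc (-1:ℝ) 1
    · exact hb1 i hi s hs
    · have : iteratedFDeriv ℝ i Φ s = 0 := by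
        by_contra h
        have := support_iteratedFDeriv_subset (𝕜 := ℝ) i h
        apply hs
        revert this
        apply closure_minimal _ isClosed_Icc
        intro y hy
        by_contra h'
        apply hy
        rw [hΦ]; simp only [ofReal_eq_zero]
        apply hφ.supp
        by_contra h2
        push Not at h2
        exact h' ⟨by linarith [(abs_le.1 h2).1], by linarith [(abs_le.1 h2).2]⟩
      rw [this, norm_zero]; linarith
  refine ⟨K * (M.factorial * B1) * B2 ^ M, by positivity, ?_⟩
  intro δ hδ hδ1 x
  have hd1 : 1 ≤ δ⁻¹ := (one_le_inv₀ hδ).2 hδ1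
  have hD1 : 1 ≤ B2 * δ⁻¹ := one_le_mul_of_one_le_of_one_le hB2 hd1
  have hh : ContDiff ℝ (⊤ : ℕ∞) (fun ξ : V n => δ⁻¹ • (1 - ‖ξ‖ ^ 2)) := hcon.const_smul δ⁻¹
  have hmeq : mt n φ δ 1 = Φ ∘ (fun ξ : V n => δ⁻¹ • (1 - ‖ξ‖ ^ 2)) := by
    ext ξ; simp [mt, hΦ]
  have hsm : ContDiff ℝ (⊤ : ℕ∞) (mt n φ δ 1) := by rw [hmeq]; exact hΦs.comp hh
  have := hcore (mt n φ δ 1) (M.factorial * B1) (B2 * δ⁻¹) (by positivity) hD1 hsm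
    (fun ξ h => mt_zero_of_norm hφ hδ hδ1 one_pos (fun h' => h (Metric.closedBall_subset_closedBall (by norm_num) h')))
    (by
      intro j hj y hy
      rw [hmeq]
      refine (norm_iteratedFDeriv_comp_le hΦs hh (n := j) (by exact_mod_cast le_top) y (C := B1) (D := B2 * δ⁻¹)
        (fun i hi => hb1' i (hi.trans hj) _) ?_).trans ?_
      · intro i hi1 hi
        rw [iteratedFDeriv_const_smul_apply' (hcon.contDiffAt.of_le (by exact_mod_cast le_top)), norm_smul,
          Real.norm_of_nonneg (by positivity)]
        calc _ ≤ δ⁻¹ * B2 := by gcongr; exact hb2 i (hi.trans hj) y hy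
          _ = (B2 * δ⁻¹) ^ 1 := by ring
          _ ≤ _ := pow_le_pow_right₀ hD1 hi1
      · gcongr) x
  rw [mul_pow]
  calc δ ^ M * ‖x‖ ^ M * ‖iF (mt n φ δ 1) x‖ = δ ^ M * (‖x‖ ^ M * ‖iF (mt n φ δ 1) x‖) := by ring
    _ ≤ δ ^ M * (K * (M.factorial * B1) * (B2 * δ⁻¹) ^ M) := by gcongr
    _ = _ := by rw [mul_pow, inv_pow]; field_simp

theorem kernel_decay {n : ℕ} {φ : ℝ → ℝ} (hφ : Good φ) (M : ℕ) : ∃ C : ℝ, 0 < C ∧ ∀ δ : ℝ, 0 < δ → δ ≤ 1 →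
    ∀ t : ℝ, 0 < t → ∀ x : V n, ‖iF (mt n φ δ t) x‖ ≤ C * t ^ n / (1 + δ * t * ‖x‖) ^ M := by
  obtain ⟨C0, hC0, h0⟩ := kernel_unit (n := n) hφ 0
  obtain ⟨C1, hC1, h1⟩ := kernel_unit (n := n) hφ M
  refine ⟨2 ^ M * (C0 + C1), by positivity, ?_⟩
  intro δ hδ hδ1 t ht x
  have hmt : mt n φ δ t = fun ξ => mt n φ δ 1 (t⁻¹ • ξ) := by
    ext ξ; simp only [mt, norm_smul, Real.norm_of_nonneg (inv_pos.2 ht).le]; congr 3; field_simp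
  rw [hmt, iF_scale _ ht, norm_mul, Complex.norm_real, Real.norm_of_nonneg (by positivity)]
  have a0 := h0 δ hδ hδ1 (t • x)
  have a1 := h1 δ hδ hδ1 (t • x)
  rw [norm_smul, Real.norm_of_nonneg ht.le, ← mul_assoc] at a0 a1
  rw [le_div_iff₀ (by positivity)]
  set I := ‖iF (mt n φ δ 1) (t • x)‖
  set a := δ * t * ‖x‖
  have ha : 0 ≤ a := by positivity
  have hp : (1 + a) ^ M ≤ 2 ^ M * (1 + a ^ M) := by
    have h3 : 1 + a ≤ 2 * max 1 a := by linarith [le_max_left 1 a, le_max_right 1 a]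
    calc (1 + a) ^ M ≤ (2 * max 1 a) ^ M := by gcongr
      _ = 2 ^ M * (max 1 a) ^ M := by rw [mul_pow]
      _ ≤ _ := by
        gcongr
        rcases max_cases 1 a with h | h
        · rw [h.1]; simp; positivity
        · rw [h.1]; simp
  calc t ^ n * I * (1 + a) ^ M ≤ t ^ n * I * (2 ^ M * (1 + a ^ M)) := by gcongr
    _ = 2 ^ M * (a ^ 0 * I + a ^ M * I) * t ^ n := by ring
    _ ≤ _ := by gcongr

end SqFn

namespace SqFn

theorem kernel_tail {n : ℕ} {φ : ℝ → ℝ} (hφ : Good φ) (ν M : ℕ) (hM : n + 1 + ν ≤ M) : ∃ C : ℝ, 0 < C ∧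
    ∀ δ : ℝ, 0 < δ → δ ≤ 1 → ∀ t : ℝ, 0 < t → ∀ R : ℝ, 0 < R → ∀ x : V n, R⁻¹ ≤ ‖x‖ →
    (1 + R * ‖x‖) ^ ν * ‖iF (mt n φ δ t) x‖ ≤
      C * (t / R) ^ n / (δ * (t / R)) ^ M * (R ^ n / (1 + R * ‖x‖) ^ (n + 1)) := by
  obtain ⟨C, hC, h⟩ := kernel_decay (n := n) hφ M
  refine ⟨2 ^ M * C, by positivity, ?_⟩
  intro δ hδ hδ1 t ht R hR x hx
  have h1 := h δ hδ hδ1 t ht x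
  set w := R * ‖x‖ with hw
  have hw1 : 1 ≤ w := by rw [hw]; rw [inv_le_iff_one_le_mul₀ hR] at hx; linarith
  have e1 : C * t ^ n / (1 + δ * t * ‖x‖) ^ M ≤ C * t ^ n / ((δ * (t / R)) * w) ^ M := by
    gcongr
    rw [hw]; field_simp; nlinarith [norm_nonneg x, mul_pos hδ ht]
  have e2 : (1 + w) ^ (n + 1 + ν) ≤ 2 ^ M * w ^ M := by
    rw [← mul_pow]
    calc (1 + w) ^ (n + 1 + ν) ≤ (1 + w) ^ M := pow_le_pow_right₀ (by linarith) hM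
      _ ≤ _ := by gcongr; linarith
  have e3 : (1 + w) ^ ν * (1 + w) ^ (n + 1) ≤ 2 ^ M * w ^ M := by
    rw [← pow_add]; rw [add_comm ν]; exact e2
  calc (1 + w) ^ ν * ‖iF (mt n φ δ t) x‖ ≤ (1 + w) ^ ν * (C * t ^ n / ((δ * (t / R)) * w) ^ M) := by
        gcongr; exact h1.trans e1
    _ = C * t ^ n / (δ * (t / R)) ^ M * ((1 + w) ^ ν / w ^ M) := by rw [mul_pow]; field_simp
    _ ≤ C * t ^ n / (δ * (t / R)) ^ M * (2 ^ M / (1 + w) ^ (n + 1)) := by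
        refine mul_le_mul_of_nonneg_left ?_ (by positivity)
        rw [div_le_div_iff₀ (by positivity) (by positivity)]; exact e3
    _ = _ := by rw [div_pow t R n]; field_simp

theorem continuous_iF {n : ℕ} {h : V n → ℂ} (hh : Integrable h) : Continuous (iF h) := by
  have : iF h = fun x => 𝓕 h (-x) := by ext x; exact iF_neg h x
  rw [this]; exact (continuous_fourier hh).comp continuous_neg

theorem FT_split {n : ℕ} {φ : ℝ → ℝ} (hφ : Good φ) (ν M : ℕ) (hM : n + 1 + ν ≤ M) : ∃ C : ℝ, 0 < C ∧
    ∀ δ : ℝ, 0 < δ → δ ≤ 1 → ∀ t : ℝ, 0 < t → ∀ R : ℝ, 0 < R → ∀ z x : V n, x ∈ Metric.ball z R⁻¹ →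
    ∀ f : V n → ℂ, Integrable f → Measurable f → ∀ w : V n → ℝ≥0∞, Measurable w →
    (∀ x y, w x ≤ ENNReal.ofReal ((1 + R * ‖x - y‖) ^ ν) * w y) →
    w x * ‖FT n φ δ t f x‖ₑ ≤ w x * ‖FT n φ δ t ((Metric.ball z (2 * R⁻¹)).indicator f) x‖ₑ +
      ENNReal.ofReal (C * (t / R) ^ n / (δ * (t / R)) ^ M) * cv n R (fun y => w y * ‖f y‖ₑ) x := by
  obtain ⟨C, hC, h⟩ := kernel_tail (n := n) hφ ν M hM
  refine ⟨C, hC, ?_⟩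
  intro δ hδ hδ1 t ht R hR z x hx f hf hfm w hw hws
  set B := Metric.ball z (2 * R⁻¹) with hB
  have hBm : MeasurableSet B := measurableSet_ball
  have e1 : FT n φ δ t f x = FT n φ δ t (B.indicator f) x + FT n φ δ t (Bᶜ.indicator f) x := by
    rw [← FT_add hφ hδ hδ1 ht (hf.indicator hBm) (hf.indicator hBm.compl), Set.indicator_self_add_compl]
  have hK := (continuous_iF (integrable_mt (n := n) hφ hδ hδ1 ht)).measurable
  calc w x * ‖FT n φ δ t f x‖ₑ ≤ w x * (‖FT n φ δ t (B.indicator f) x‖ₑ + ‖FT n φ δ t (Bᶜ.indicator f) x‖ₑ) := by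
        rw [e1]; exact mul_le_mul' le_rfl (enorm_add_le _ _)
    _ = w x * ‖FT n φ δ t (B.indicator f) x‖ₑ + w x * ‖FT n φ δ t (Bᶜ.indicator f) x‖ₑ := mul_add _ _ _
    _ ≤ _ := by
      refine add_le_add le_rfl ?_
      rw [FT_conv hφ hδ hδ1 ht (hf.indicator hBm.compl)]
      refine (mul_le_mul' le_rfl (enorm_integral_le_lintegral_enorm _)).trans ?_
      have hmm : Measurable fun y => ‖iF (mt n φ δ t) (x - y) * Bᶜ.indicator f y‖ₑ := by
        apply Measurable.enorm
        exact (hK.comp (by fun_prop : Measurable fun y => x - y)).mul (hfm.indicator hBm.compl)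
      rw [← lintegral_const_mul _ hmm]
      unfold cv
      rw [← lintegral_const_mul' _ _ ENNReal.ofReal_ne_top]
      refine lintegral_mono fun y => ?_
      by_cases hy : y ∈ B
      · simp [hy]
      · rw [Set.indicator_of_mem (show y ∈ Bᶜ from hy), enorm_mul]
        have hxy : R⁻¹ ≤ ‖x - y‖ := by
          rw [hB, Metric.mem_ball, not_lt] at hy
          rw [Metric.mem_ball] at hx
          rw [← dist_eq_norm]
          have := dist_triangle y x z
          rw [dist_comm y x] at this; linarith
        have h1 := h δ hδ hδ1 t ht R hR (x - y) hxy
        calc w x * (‖iF (mt n φ δ t) (x - y)‖ₑ * ‖f y‖ₑ)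
            ≤ (ENNReal.ofReal ((1 + R * ‖x - y‖) ^ ν) * w y) * (‖iF (mt n φ δ t) (x - y)‖ₑ * ‖f y‖ₑ) :=
              mul_le_mul' (hws x y) le_rfl
          _ = ENNReal.ofReal ((1 + R * ‖x - y‖) ^ ν * ‖iF (mt n φ δ t) (x - y)‖) * (w y * ‖f y‖ₑ) := by
              rw [ENNReal.ofReal_mul (by positivity), ofReal_norm]; ring
          _ ≤ ENNReal.ofReal (C * (t / R) ^ n / (δ * (t / R)) ^ M * (R ^ n / (1 + R * ‖x - y‖) ^ (n + 1))) * (w y * ‖f y‖ₑ) :=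
              mul_le_mul' (ENNReal.ofReal_le_ofReal h1) le_rfl
          _ = _ := by
              rw [ENNReal.ofReal_mul (by positivity)]; unfold kap; ring

theorem avg {n : ℕ} (U : V n → ℝ≥0∞) (hU : Measurable U) {r : ℝ} (hr : 0 < r) :
    ∫⁻ z, ∫⁻ x in Metric.ball z r, U x = ENNReal.ofReal (r ^ n) * vb n * ∫⁻ x, U x := by
  have : ∀ z : V n, ∫⁻ x in Metric.ball z r, U x = ∫⁻ x, (Metric.ball x r).indicator (fun _ => U x) z := by
    intro z
    rw [← lintegral_indicator measurableSet_ball]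
    refine lintegral_congr fun x => ?_
    simp only [Set.indicator, Metric.mem_ball, dist_comm]
  simp_rw [this]
  rw [lintegral_lintegral_swap]
  · rw [← lintegral_const_mul _ hU]
    refine lintegral_congr fun x => ?_
    rw [lintegral_indicator measurableSet_ball, setLIntegral_const, vol_ball x hr, mul_comm]
  · apply Measurable.aemeasurable
    have : Measurable (fun z : V n × V n => if dist z.1 z.2 < r then U z.2 else 0) := by
      apply Measurable.ite
      · exact measurableSet_lt (by fun_prop) (by fun_prop)
      · fun_prop
      · fun_prop
    exact this

theorem lint_cube {T : ℝ} (hT : 0 < T) :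
    ∫⁻ t in Set.Ioi T, ENNReal.ofReal ((t ^ 3)⁻¹) ≤ ENNReal.ofReal ((T ^ 2)⁻¹) := by
  have e : ∀ t ∈ Set.Ioi T, ENNReal.ofReal ((t ^ 3)⁻¹) = ENNReal.ofReal (t ^ (-3 : ℝ)) := by
    intro t ht
    have : 0 < t := hT.trans ht
    rw [Real.rpow_neg this.le]; norm_cast
  rw [setLIntegral_congr_fun measurableSet_Ioi e,
    ← ofReal_integral_eq_lintegral_ofReal (integrableOn_Ioi_rpow_of_lt (by norm_num) hT),
    integral_Ioi_rpow_of_lt (by norm_num) hT]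
  · apply ENNReal.ofReal_le_ofReal
    have h2 : T ^ (-3 + 1 : ℝ) = (T ^ 2)⁻¹ := by
      rw [show (-3 + 1 : ℝ) = -((2:ℕ):ℝ) by norm_num, Real.rpow_neg hT.le, Real.rpow_natCast]
    rw [h2]
    have : 0 < (T ^ 2)⁻¹ := by positivity
    rw [show -(T ^ 2)⁻¹ / (-3 + 1 : ℝ) = (T ^ 2)⁻¹ / 2 by ring]; linarith
  · filter_upwards [ae_restrict_mem measurableSet_Ioi] with t ht
    have : 0 < t := hT.trans ht
    positivity

theorem enn_sq_add (a b : ℝ≥0∞) : (a + b) ^ 2 ≤ 2 * a ^ 2 + 2 * b ^ 2 := by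
  have := enn_amgm a b
  have h2 : 2 * (a * b) ≤ a ^ 2 + b ^ 2 := by
    calc 2 * (a * b) ≤ 2 * (2⁻¹ * (a ^ 2 + b ^ 2)) := mul_le_mul' le_rfl this
      _ = _ := by rw [← mul_assoc, ENNReal.mul_inv_cancel (by simp) (by simp), one_mul]
  calc (a + b) ^ 2 = a ^ 2 + b ^ 2 + 2 * (a * b) := by ring
    _ ≤ a ^ 2 + b ^ 2 + (a ^ 2 + b ^ 2) := by gcongr
    _ = _ := by ring

theorem measurable_tint {n : ℕ} {φ : ℝ → ℝ} (hφ : Good φ) (δ : ℝ) {g : V n → ℂ} (hg : Integrable g) (S : Set ℝ) :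
    Measurable (fun x => ∫⁻ t in S, ‖FT n φ δ t g x‖ₑ ^ 2 * ENNReal.ofReal t⁻¹) := by
  have hm := measurable_FT hφ δ hg
  have this : Measurable (fun z : V n × ℝ => ‖FT n φ δ z.2 g z.1‖ₑ) :=
      Measurable.comp (g := fun z : ℝ × V n => ‖FT n φ δ z.1 g z.2‖ₑ) (f := fun z : V n × ℝ => (z.2, z.1)) hm
        (measurable_snd.prodMk measurable_fst)
  have h2 : Measurable (fun z : V n × ℝ => ENNReal.ofReal z.2⁻¹) := measurable_snd.inv.ennreal_ofReal
  exact Measurable.lintegral_prod_right' (ν := volume.restrict S)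
    (f := fun z : V n × ℝ => ‖FT n φ δ z.2 g z.1‖ₑ ^ 2 * ENNReal.ofReal z.2⁻¹)
    (Measurable.fun_mul (this.pow_const 2) h2)

theorem measurable_FT_t {n : ℕ} {φ : ℝ → ℝ} (hφ : Good φ) (δ : ℝ) {g : V n → ℂ} (hg : Integrable g) (x : V n) :
    Measurable (fun t => ‖FT n φ δ t g x‖ₑ) :=
  Measurable.comp (g := fun z : ℝ × V n => ‖FT n φ δ z.1 g z.2‖ₑ) (f := fun t : ℝ => (t, x))
    (measurable_FT hφ δ hg) measurable_prodMk_right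

theorem sqrt_slow {a b : ℝ≥0∞} {c : ℝ} (hc : 1 ≤ c) (h : a ≤ ENNReal.ofReal c * b) :
    a ^ (1 / 2 : ℝ) ≤ ENNReal.ofReal c * b ^ (1 / 2 : ℝ) := by
  have h1 : (1:ℝ≥0∞) ≤ ENNReal.ofReal c := by rw [← ENNReal.ofReal_one]; exact ENNReal.ofReal_le_ofReal hc
  calc a ^ (1 / 2 : ℝ) ≤ (ENNReal.ofReal c * b) ^ (1 / 2 : ℝ) := by gcongr
    _ = ENNReal.ofReal c ^ (1 / 2 : ℝ) * b ^ (1 / 2 : ℝ) := ENNReal.mul_rpow_of_nonneg _ _ (by norm_num)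
    _ ≤ _ := by
      refine mul_le_mul' ?_ le_rfl
      calc ENNReal.ofReal c ^ (1 / 2 : ℝ) ≤ ENNReal.ofReal c ^ (1 : ℝ) :=
            ENNReal.rpow_le_rpow_of_exponent_le h1 (by norm_num)
        _ = _ := ENNReal.rpow_one _

theorem sqrt_sq (a : ℝ≥0∞) : (a ^ (1 / 2 : ℝ)) ^ 2 = a := by
  rw [← ENNReal.rpow_natCast, ← ENNReal.rpow_mul]; norm_num

/-- the high part estimate -/
theorem high {n : ℕ} {φ : ℝ → ℝ} (hφ : Good φ) (ν M : ℕ) (hM : n + 1 + ν ≤ M) : ∃ C : ℝ, 0 < C ∧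
    ∀ δ : ℝ, 0 < δ → δ ≤ 1 → ∀ T : ℝ, 0 < T → ∀ R : ℝ, 0 < R → 1 ≤ δ ^ (M + 1) * (T / R) →
    ∀ f : V n → ℂ, Integrable f → Measurable f → ∀ ω : V n → ℝ≥0∞, Measurable ω →
    (∀ x y, ω x ≤ ENNReal.ofReal ((1 + R * ‖x - y‖) ^ ν) * ω y) →
    ∫⁻ x, (∫⁻ t in Set.Ioi T, ‖FT n φ δ t f x‖ₑ ^ 2 * ENNReal.ofReal t⁻¹) * ω x ≤
      ENNReal.ofReal (C * δ) * ∫⁻ x, ‖f x‖ₑ ^ 2 * ω x := by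
  obtain ⟨C, hC, h⟩ := FT_split (n := n) hφ ν M hM
  obtain ⟨C2, hC2, hcv⟩ := cv_Lp n 2 (by norm_num)
  refine ⟨4 * 6 ^ ν * 2 ^ n + 2 * C ^ 2 * C2, by positivity, ?_⟩
  intro δ hδ hδ1 T hT R hR hTR f hf hfm ω hω hωs
  set w : V n → ℝ≥0∞ := fun x => ω x ^ (1 / 2 : ℝ) with hw
  have hwm : Measurable w := hω.pow_const _
  have hw2 : ∀ x, w x ^ 2 = ω x := fun x => sqrt_sq _
  have hws : ∀ x y, w x ≤ ENNReal.ofReal ((1 + R * ‖x - y‖) ^ ν) * w y := fun x y =>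
    sqrt_slow (one_le_pow₀ (by linarith [mul_nonneg hR.le (norm_nonneg (x - y))])) (hωs x y)
  set a : ℝ → ℝ := fun t => C * (t / R) ^ n / (δ * (t / R)) ^ M with ha
  set r := R⁻¹ with hr
  have hr0 : 0 < r := inv_pos.2 hR
  set E : ℝ≥0∞ := ENNReal.ofReal (C ^ 2 * δ) with hE
  set W : V n → ℝ≥0∞ := cv n R (fun y => w y * ‖f y‖ₑ) with hWdef
  have hfe : Measurable (fun y => ‖f y‖ₑ) := hfm.enorm
  have hWm : Measurable W := measurable_cv R _ (hwm.fun_mul hfe)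
  -- tail integral
  have hTR1 : 1 ≤ T / R := by
    have : δ ^ (M + 1) ≤ 1 := pow_le_one₀ hδ.le hδ1
    have h0 : 0 < T / R := by positivity
    nlinarith
  have hat : ∀ t ∈ Set.Ioi T, ENNReal.ofReal (a t) ^ 2 * ENNReal.ofReal t⁻¹ ≤
      ENNReal.ofReal (C ^ 2 * (δ ^ M)⁻¹ ^ 2 * R ^ 2) * ENNReal.ofReal ((t ^ 3)⁻¹) := by
    intro t ht
    have ht' : T < t := ht
    have ht0 : 0 < t := hT.trans ht'
    have hs1 : 1 ≤ t / R := hTR1.trans (by gcongr)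
    have a0 : 0 ≤ a t := by rw [ha]; positivity
    have a1 : a t ≤ C * (δ ^ M)⁻¹ * (R / t) := by
      have : (t / R) ^ (n + 1) ≤ (t / R) ^ M := pow_le_pow_right₀ hs1 (by omega)
      rw [ha]; simp only []
      rw [mul_pow, div_le_iff₀ (by positivity)]
      calc C * (t / R) ^ n = C * (δ ^ M)⁻¹ * (R / t) * (δ ^ M * (t / R) ^ (n + 1)) := by
            rw [pow_succ]; field_simp
        _ ≤ _ := by gcongr
    rw [← ENNReal.ofReal_pow a0, ← ENNReal.ofReal_mul (by positivity), ← ENNReal.ofReal_mul (by positivity)]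
    apply ENNReal.ofReal_le_ofReal
    calc a t ^ 2 * t⁻¹ ≤ (C * (δ ^ M)⁻¹ * (R / t)) ^ 2 * t⁻¹ := by gcongr
      _ = _ := by field_simp
  have hEt : ∫⁻ t in Set.Ioi T, ENNReal.ofReal (a t) ^ 2 * ENNReal.ofReal t⁻¹ ≤ E := by
    refine (setLIntegral_mono' measurableSet_Ioi hat).trans ?_
    rw [lintegral_const_mul' _ _ ENNReal.ofReal_ne_top]
    refine (mul_le_mul' le_rfl (lint_cube hT)).trans ?_
    rw [← ENNReal.ofReal_mul (by positivity)]
    apply ENNReal.ofReal_le_ofReal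
    have h3 : (δ ^ M)⁻¹ * (R / T) ≤ δ := by
      rw [inv_mul_le_iff₀ (by positivity), div_le_iff₀ hT]
      rw [pow_succ] at hTR
      have : R ≤ δ ^ M * δ * (T / R) * R := by nlinarith
      calc R ≤ _ := this
        _ = _ := by field_simp
    calc C ^ 2 * (δ ^ M)⁻¹ ^ 2 * R ^ 2 * (T ^ 2)⁻¹ = C ^ 2 * ((δ ^ M)⁻¹ * (R / T)) ^ 2 := by field_simp
      _ ≤ C ^ 2 * δ ^ 2 := by gcongr
      _ ≤ C ^ 2 * δ := by gcongr; nlinarith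
  set U : V n → ℝ≥0∞ := fun x => (∫⁻ t in Set.Ioi T, ‖FT n φ δ t f x‖ₑ ^ 2 * ENNReal.ofReal t⁻¹) * ω x with hU
  have hUm : Measurable U := (measurable_tint hφ δ hf _).fun_mul hω
  -- pointwise
  have hpt : ∀ z x : V n, x ∈ Metric.ball z r → U x ≤
      2 * (ENNReal.ofReal (2 ^ ν) * ω z * ∫⁻ t in Set.Ioi (0:ℝ), ‖FT n φ δ t ((Metric.ball z (2 * r)).indicator f) x‖ₑ ^ 2 * ENNReal.ofReal t⁻¹) +
        2 * E * W x ^ 2 := by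
    intro z x hx
    have hfi := hf.indicator (measurableSet_ball (x := z) (ε := 2 * r))
    have m1 := measurable_FT_t hφ δ hfi x
    have m0 := measurable_FT_t hφ δ hf x
    have mt' : Measurable (fun t : ℝ => ENNReal.ofReal t⁻¹) := by fun_prop
    have hωz : ω x ≤ ENNReal.ofReal (2 ^ ν) * ω z := by
      refine (hωs x z).trans (mul_le_mul' (ENNReal.ofReal_le_ofReal ?_) le_rfl)
      gcongr
      have : ‖x - z‖ < R⁻¹ := by rw [← dist_eq_norm]; exact hx
      have : R * ‖x - z‖ ≤ 1 := by
        calc R * ‖x - z‖ ≤ R * R⁻¹ := by gcongr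
          _ = 1 := by field_simp
      linarith
    have step : U x ≤ ∫⁻ t in Set.Ioi T, (2 * ω x * (‖FT n φ δ t ((Metric.ball z (2 * r)).indicator f) x‖ₑ ^ 2 * ENNReal.ofReal t⁻¹) +
        2 * W x ^ 2 * (ENNReal.ofReal (a t) ^ 2 * ENNReal.ofReal t⁻¹)) := by
      rw [hU]; simp only []
      rw [← lintegral_mul_const _ ((m0.pow_const 2).fun_mul mt')]
      refine setLIntegral_mono' measurableSet_Ioi fun t ht => ?_
      have ht0 : 0 < t := hT.trans ht
      have h1 := h δ hδ hδ1 t ht0 R hR z x hx f hf hfm w hwm hws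
      calc ‖FT n φ δ t f x‖ₑ ^ 2 * ENNReal.ofReal t⁻¹ * ω x = (w x * ‖FT n φ δ t f x‖ₑ) ^ 2 * ENNReal.ofReal t⁻¹ := by
            rw [mul_pow, hw2]; ring
        _ ≤ (w x * ‖FT n φ δ t ((Metric.ball z (2 * r)).indicator f) x‖ₑ + ENNReal.ofReal (a t) * W x) ^ 2 * ENNReal.ofReal t⁻¹ :=
            mul_le_mul_left (pow_le_pow_left' h1 2) _
        _ ≤ (2 * (w x * ‖FT n φ δ t ((Metric.ball z (2 * r)).indicator f) x‖ₑ) ^ 2 + 2 * (ENNReal.ofReal (a t) * W x) ^ 2) * ENNReal.ofReal t⁻¹ :=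
            mul_le_mul_left (enn_sq_add _ _) _
        _ = _ := by rw [mul_pow, mul_pow, hw2]; ring
    refine step.trans ?_
    rw [lintegral_add_left (((m1.pow_const 2).fun_mul mt').const_mul _), lintegral_const_mul _ ((m1.pow_const 2).fun_mul mt')]
    have ma : Measurable a := by rw [ha]; fun_prop
    rw [lintegral_const_mul _ ((ma.ennreal_ofReal.pow_const 2).fun_mul mt')]
    refine add_le_add ?_ ?_
    · rw [← mul_assoc 2]
      exact mul_le_mul' (mul_le_mul' le_rfl hωz) (lintegral_mono_set (Set.Ioi_subset_Ioi hT.le))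
    · calc _ ≤ 2 * W x ^ 2 * E := mul_le_mul' le_rfl hEt
        _ = _ := by ring
  have hω3 : ∀ z y : V n, y ∈ Metric.ball z (2 * r) → ω z ≤ ENNReal.ofReal (3 ^ ν) * ω y := by
    intro z y hy
    refine (hωs z y).trans (mul_le_mul' (ENNReal.ofReal_le_ofReal ?_) le_rfl)
    gcongr
    have : ‖z - y‖ < 2 * R⁻¹ := by rw [← dist_eq_norm, dist_comm]; exact hy
    have : R * ‖z - y‖ ≤ 2 := by
      calc R * ‖z - y‖ ≤ R * (2 * R⁻¹) := by gcongr
        _ = 2 := by field_simp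
    linarith
  have hz : ∀ z : V n, ∫⁻ x in Metric.ball z r, U x ≤
      ENNReal.ofReal (4 * 6 ^ ν * δ) * (∫⁻ x in Metric.ball z (2 * r), ‖f x‖ₑ ^ 2 * ω x) +
        ∫⁻ x in Metric.ball z r, 2 * E * W x ^ 2 := by
    intro z
    have hfi := hf.indicator (measurableSet_ball (x := z) (ε := 2 * r))
    refine (setLIntegral_mono' measurableSet_ball (hpt z)).trans ?_
    rw [lintegral_add_right _ ((hWm.pow_const 2).const_mul _)]
    refine add_le_add ?_ le_rfl
    rw [lintegral_const_mul _ ((measurable_tint hφ δ hfi _).const_mul _), lintegral_const_mul _ (measurable_tint hφ δ hfi _)]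
    refine (mul_le_mul' le_rfl (mul_le_mul' le_rfl ((setLIntegral_le_lintegral _ _).trans (FT_L2_t hφ hδ hδ1 hfi)))).trans ?_
    have e1 : ∫⁻ x, ‖(Metric.ball z (2 * r)).indicator f x‖ₑ ^ 2 = ∫⁻ x in Metric.ball z (2 * r), ‖f x‖ₑ ^ 2 := by
      rw [← lintegral_indicator measurableSet_ball]
      refine lintegral_congr fun x => ?_
      by_cases hx : x ∈ Metric.ball z (2 * r) <;> simp [Set.indicator, hx]
    rw [e1]
    have e2 : ω z * ∫⁻ x in Metric.ball z (2 * r), ‖f x‖ₑ ^ 2 ≤ ENNReal.ofReal (3 ^ ν) * ∫⁻ x in Metric.ball z (2 * r), ‖f x‖ₑ ^ 2 * ω x := by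
      rw [← lintegral_const_mul _ (hfe.pow_const 2), ← lintegral_const_mul' _ _ ENNReal.ofReal_ne_top]
      refine setLIntegral_mono' measurableSet_ball fun y hy => ?_
      calc _ ≤ ENNReal.ofReal (3 ^ ν) * ω y * ‖f y‖ₑ ^ 2 := mul_le_mul_left (hω3 z y hy) _
        _ = _ := by ring
    calc _ = ENNReal.ofReal (2 * 2 ^ ν * (2 * δ)) * (ω z * ∫⁻ x in Metric.ball z (2 * r), ‖f x‖ₑ ^ 2) := by
          rw [ENNReal.ofReal_mul (by positivity) (p := 2 * 2 ^ ν), ENNReal.ofReal_mul (by positivity) (p := 2) (q := 2 ^ ν), ENNReal.ofReal_ofNat]; ring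
      _ ≤ ENNReal.ofReal (2 * 2 ^ ν * (2 * δ)) * (ENNReal.ofReal (3 ^ ν) * ∫⁻ x in Metric.ball z (2 * r), ‖f x‖ₑ ^ 2 * ω x) :=
          mul_le_mul' le_rfl e2
      _ = _ := by
          rw [← mul_assoc, ← ENNReal.ofReal_mul (by positivity)]
          congr 2
          rw [show (6:ℝ) = 2 * 3 by norm_num, mul_pow]; ring
  have hWL : ∫⁻ x, W x ^ 2 ≤ ENNReal.ofReal C2 * ∫⁻ x, ‖f x‖ₑ ^ 2 * ω x := by
    have := hcv R hR (fun y => w y * ‖f y‖ₑ) (hwm.fun_mul hfe)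
    simp only [ENNReal.rpow_ofNat] at this
    refine this.trans (le_of_eq ?_)
    congr 1
    refine lintegral_congr fun x => ?_
    rw [mul_pow, hw2, mul_comm]
  set X := ∫⁻ x, ‖f x‖ₑ ^ 2 * ω x with hX
  have main : ENNReal.ofReal (r ^ n) * vb n * ∫⁻ x, U x ≤ ENNReal.ofReal (r ^ n) * vb n *
      (ENNReal.ofReal ((4 * 6 ^ ν * 2 ^ n + 2 * C ^ 2 * C2) * δ) * X) := by
    rw [← avg U hUm hr0]
    refine (lintegral_mono hz).trans ?_
    rw [lintegral_add_right _ (measurable_ball_int _ ((hWm.pow_const 2).const_mul _) r),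
      lintegral_const_mul' _ _ ENNReal.ofReal_ne_top, avg _ ((hfe.pow_const 2).fun_mul hω) (by positivity),
      avg _ ((hWm.pow_const 2).const_mul _) hr0, lintegral_const_mul _ (hWm.pow_const 2)]
    calc _ ≤ ENNReal.ofReal (4 * 6 ^ ν * δ) * (ENNReal.ofReal ((2 * r) ^ n) * vb n * X) +
          ENNReal.ofReal (r ^ n) * vb n * (2 * E * (ENNReal.ofReal C2 * X)) := by gcongr
      _ = ENNReal.ofReal (r ^ n) * vb n * ((ENNReal.ofReal (4 * 6 ^ ν * δ) * ENNReal.ofReal (2 ^ n) + 2 * E * ENNReal.ofReal C2) * X) := by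
          rw [mul_pow, ENNReal.ofReal_mul (by positivity) (p := 2 ^ n)]; ring
      _ = _ := by
          congr 2
          rw [hE, ← ENNReal.ofReal_mul (by positivity), ← ENNReal.ofReal_ofNat, ← ENNReal.ofReal_mul (by positivity),
            ← ENNReal.ofReal_mul (by positivity), ← ENNReal.ofReal_add (by positivity) (by positivity)]
          congr 1; ring
  have hv0 : ENNReal.ofReal (r ^ n) * vb n ≠ 0 :=
    mul_ne_zero (by simpa using pow_pos hr0 n) (vb_pos n).ne'
  have hvt : ENNReal.ofReal (r ^ n) * vb n ≠ ⊤ := ENNReal.mul_ne_top ENNReal.ofReal_ne_top (vb_ne_top n)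
  exact (ENNReal.mul_le_mul_iff_right hv0 hvt).1 main

end SqFn

namespace SqFn

/-- quadratic phase -/
noncomputable def qp (y : ℝ) : ℂ := cexp (((2 * Real.pi * y ^ 2 : ℝ) : ℂ) * I)

theorem norm_qp (y : ℝ) : ‖qp y‖ = 1 := Complex.norm_exp_ofReal_mul_I _

theorem continuous_qp : Continuous qp := by unfold qp; fun_prop

theorem hasDerivAt_qp (y : ℝ) : HasDerivAt qp ((4 * Real.pi * y : ℝ) * I * qp y) y := by
  have h1 : HasDerivAt (fun y : ℝ => 2 * Real.pi * y ^ 2) (4 * Real.pi * y) y := by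
    have := (hasDerivAt_pow 2 y).const_mul (2 * Real.pi)
    exact this.congr_deriv (by push_cast; ring)
  have h2 := (h1.ofReal_comp.mul_const I).cexp
  unfold qp
  exact h2.congr_deriv (by push_cast; ring)

/-- Fresnel integral -/
noncomputable def fr (w : ℝ) : ℂ := ∫ y in (0:ℝ)..w, qp y

theorem hasDerivAt_fr (w : ℝ) : HasDerivAt fr (qp w) w :=
  (continuous_qp.integral_hasStrictDerivAt 0 w).hasDerivAt

theorem fr_neg (w : ℝ) : fr (-w) = - fr w := by
  unfold fr
  have h := intervalIntegral.integral_comp_neg (a := 0) (b := w) qp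
  have e : ∀ y, qp (-y) = qp y := fun y => by unfold qp; rw [neg_sq]
  simp_rw [e] at h
  rw [h, neg_zero, intervalIntegral.integral_symm]

theorem fr_bound_ge {w : ℝ} (hw : 1 ≤ w) : ‖fr w‖ ≤ 4 := by
  have hpi := Real.pi_gt_three
  have hsplit : fr w = fr 1 + ∫ y in (1:ℝ)..w, qp y := by
    unfold fr
    rw [intervalIntegral.integral_add_adjacent_intervals] <;> exact continuous_qp.intervalIntegrable _ _
  have h1 : ‖fr 1‖ ≤ 1 := by
    unfold fr
    have := intervalIntegral.norm_integral_le_of_norm_le_const (a := (0:ℝ)) (b := 1) (C := 1) (f := qp)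
      (fun y _ => (norm_qp y).le)
    simpa using this
  set Q : ℝ → ℂ := fun y => qp y * ((4 * Real.pi * y : ℝ) * I)⁻¹ with hQ
  set e : ℝ → ℂ := fun y => qp y * I⁻¹ * (((4 * Real.pi)⁻¹ * (y ^ 2)⁻¹ : ℝ) : ℂ) with he
  have hpos : ∀ y ∈ Set.uIcc 1 w, 0 < y := by
    intro y hy; rw [Set.uIcc_of_le hw] at hy; linarith [hy.1]
  have hQd : ∀ y ∈ Set.uIcc 1 w, HasDerivAt Q (qp y - e y) y := by
    intro y hy
    have hy0 := hpos y hy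
    have h3 : HasDerivAt (fun y : ℝ => ((4 * Real.pi * y : ℝ) * I : ℂ)⁻¹)
        (-(((4 * Real.pi : ℝ) : ℂ) * I) / ((4 * Real.pi * y : ℝ) * I : ℂ) ^ 2) y := by
      have h4 : HasDerivAt (fun y : ℝ => ((4 * Real.pi * y : ℝ) * I : ℂ)) (((4 * Real.pi : ℝ) : ℂ) * I) y := by
        have := ((hasDerivAt_id y).const_mul (4 * Real.pi)).ofReal_comp.mul_const I
        simpa using this
      apply h4.inv
      simp [hy0.ne', Real.pi_ne_zero]
    have h5 := (hasDerivAt_qp y).mul h3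
    refine h5.congr_deriv ?_
    rw [he]; push_cast
    have : (y:ℂ) ≠ 0 := by exact_mod_cast hy0.ne'
    have hp : (Real.pi : ℂ) ≠ 0 := by exact_mod_cast Real.pi_ne_zero
    field_simp
    ring
  have hec : ContinuousOn e (Set.uIcc 1 w) := by
    rw [he]
    apply ContinuousOn.mul
    · exact (continuous_qp.mul continuous_const).continuousOn
    · apply Complex.continuous_ofReal.comp_continuousOn
      apply continuousOn_const.mul
      apply ContinuousOn.inv₀ (by fun_prop)
      intro y hy; have := hpos y hy; positivity
  have hei : IntervalIntegrable e volume 1 w := hec.intervalIntegrable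
  have hI : ∫ y in (1:ℝ)..w, (qp y - e y) = Q w - Q 1 :=
    intervalIntegral.integral_eq_sub_of_hasDerivAt hQd
      ((continuous_qp.intervalIntegrable _ _).sub hei)
  rw [intervalIntegral.integral_sub (continuous_qp.intervalIntegrable _ _) hei] at hI
  have hI2 : ∫ y in (1:ℝ)..w, qp y = Q w - Q 1 + ∫ y in (1:ℝ)..w, e y := by rw [← hI]; ring
  have hQn : ∀ y, 1 ≤ y → ‖Q y‖ ≤ 1 := by
    intro y hy
    rw [hQ]; simp only []
    rw [norm_mul, norm_qp, norm_inv, norm_mul, Complex.norm_real, Complex.norm_I, one_mul, mul_one]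
    rw [Real.norm_of_nonneg (by positivity)]
    apply inv_le_one_of_one_le₀
    have : 4 * Real.pi * 1 ≤ 4 * Real.pi * y := mul_le_mul_of_nonneg_left hy (by positivity)
    linarith
  have hen : ‖∫ y in (1:ℝ)..w, e y‖ ≤ 1 := by
    have hd : ∀ y ∈ Set.uIcc 1 w, HasDerivAt (fun y : ℝ => -(4 * Real.pi)⁻¹ * y⁻¹) ((4 * Real.pi)⁻¹ * (y ^ 2)⁻¹) y := by
      intro y hy
      have := (hasDerivAt_inv (hpos y hy).ne').const_mul (-(4 * Real.pi)⁻¹)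
      exact this.congr_deriv (by ring)
    have hcc : ContinuousOn (fun y : ℝ => (4 * Real.pi)⁻¹ * (y ^ 2)⁻¹) (Set.uIcc 1 w) := by
      apply continuousOn_const.mul
      apply ContinuousOn.inv₀ (by fun_prop)
      intro y hy; have := hpos y hy; positivity
    have h6 := intervalIntegral.integral_eq_sub_of_hasDerivAt hd hcc.intervalIntegrable
    have h7 : ‖∫ y in (1:ℝ)..w, e y‖ ≤ ∫ y in (1:ℝ)..w, (4 * Real.pi)⁻¹ * (y ^ 2)⁻¹ := by
      apply intervalIntegral.norm_integral_le_of_norm_le hw _ hcc.intervalIntegrable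
      refine Eventually.of_forall fun y hy => ?_
      rw [he]; simp only []
      rw [norm_mul, norm_mul, norm_qp, norm_inv, Complex.norm_I, one_mul, inv_one, one_mul, Complex.norm_real,
        Real.norm_of_nonneg (by positivity)]
    rw [h6] at h7
    have h8 : (4 * Real.pi)⁻¹ ≤ 1 := inv_le_one_of_one_le₀ (by linarith)
    have h9 : 0 < (4 * Real.pi)⁻¹ * w⁻¹ := by positivity
    simp only [inv_one, mul_one] at h7
    linarith
  rw [hsplit, hI2]
  calc _ ≤ ‖fr 1‖ + (‖Q w‖ + ‖Q 1‖ + ‖∫ y in (1:ℝ)..w, e y‖) := by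
        refine (norm_add_le _ _).trans (add_le_add le_rfl ((norm_add_le _ _).trans (add_le_add (norm_sub_le _ _) le_rfl)))
    _ ≤ 1 + (1 + 1 + 1) := by
        have := hQn w hw; have := hQn 1 le_rfl
        linarith
    _ = 4 := by norm_num

theorem fr_bound (w : ℝ) : ‖fr w‖ ≤ 4 := by
  rcases le_total 1 |w| with h | h
  · rcases abs_cases w with ⟨h1, h2⟩ | ⟨h1, h2⟩
    · exact fr_bound_ge (by linarith)
    · rw [← norm_neg, ← fr_neg]; exact fr_bound_ge (by linarith)
  · unfold fr
    have := intervalIntegral.norm_integral_le_of_norm_le_const (a := (0:ℝ)) (b := w) (C := 1) (f := qp)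
      (fun y _ => (norm_qp y).le)
    simp only [sub_zero, one_mul] at this
    linarith

/-- primitive of the oscillating factor -/
noncomputable def GG (c τ : ℝ) : ℂ :=
  cexp (((-4 * Real.pi * c : ℝ) : ℂ) * I) * fr (Real.sqrt τ + c / Real.sqrt τ) +
    cexp (((4 * Real.pi * c : ℝ) : ℂ) * I) * fr (Real.sqrt τ - c / Real.sqrt τ)

theorem GG_bound (c τ : ℝ) : ‖GG c τ‖ ≤ 8 := by
  unfold GG
  refine (norm_add_le _ _).trans ?_
  rw [norm_mul, norm_mul, Complex.norm_exp_ofReal_mul_I, Complex.norm_exp_ofReal_mul_I]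
  have := fr_bound (Real.sqrt τ + c / Real.sqrt τ)
  have := fr_bound (Real.sqrt τ - c / Real.sqrt τ)
  linarith

theorem hasDerivAt_GG (c : ℝ) {τ : ℝ} (hτ : 0 < τ) : HasDerivAt (GG c)
    (((Real.sqrt τ)⁻¹ : ℝ) * cexp (((2 * Real.pi * (τ + c ^ 2 / τ) : ℝ) : ℂ) * I)) τ := by
  have hs : 0 < Real.sqrt τ := Real.sqrt_pos.2 hτ
  have hs2 : Real.sqrt τ ^ 2 = τ := Real.sq_sqrt hτ.le
  have d0 : HasDerivAt Real.sqrt (1 / (2 * Real.sqrt τ)) τ := Real.hasDerivAt_sqrt hτ.ne'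
  have d1 : HasDerivAt (fun τ => c / Real.sqrt τ) (-(c / (2 * Real.sqrt τ ^ 3))) τ := by
    have := (d0.inv hs.ne').const_mul c
    exact this.congr_deriv (by field_simp)
  have p1 := (hasDerivAt_fr (Real.sqrt τ + c / Real.sqrt τ)).scomp τ (d0.add d1)
  have p2 := (hasDerivAt_fr (Real.sqrt τ - c / Real.sqrt τ)).scomp τ (d0.sub d1)
  have p3 := (p1.const_mul (cexp (((-4 * Real.pi * c : ℝ) : ℂ) * I))).add
    (p2.const_mul (cexp (((4 * Real.pi * c : ℝ) : ℂ) * I)))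
  have e1 : cexp (((-4 * Real.pi * c : ℝ) : ℂ) * I) * qp (Real.sqrt τ + c / Real.sqrt τ) =
      cexp (((2 * Real.pi * (τ + c ^ 2 / τ) : ℝ) : ℂ) * I) := by
    unfold qp; rw [← Complex.exp_add, ← add_mul, ← ofReal_add]
    congr 3
    have : (Real.sqrt τ + c / Real.sqrt τ) ^ 2 = τ + c ^ 2 / τ + 2 * c := by
      calc _ = Real.sqrt τ ^ 2 + c ^ 2 / Real.sqrt τ ^ 2 + 2 * c := by field_simp; ring
        _ = _ := by rw [hs2]
    rw [this]; ring
  have e2 : cexp (((4 * Real.pi * c : ℝ) : ℂ) * I) * qp (Real.sqrt τ - c / Real.sqrt τ) =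
      cexp (((2 * Real.pi * (τ + c ^ 2 / τ) : ℝ) : ℂ) * I) := by
    unfold qp; rw [← Complex.exp_add, ← add_mul, ← ofReal_add]
    congr 3
    have : (Real.sqrt τ - c / Real.sqrt τ) ^ 2 = τ + c ^ 2 / τ - 2 * c := by
      calc _ = Real.sqrt τ ^ 2 + c ^ 2 / Real.sqrt τ ^ 2 - 2 * c := by field_simp; ring
        _ = _ := by rw [hs2]
    rw [this]; ring
  have e3 := p3
  refine e3.congr_deriv ?_
  rw [mul_smul_comm, mul_smul_comm, e1, e2, ← add_smul, Complex.real_smul]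
  congr 2
  field_simp; ring

/-- oscillatory integral on a finite interval -/
theorem osc_fin (c : ℝ) {S N : ℝ} (hS : 0 < S) (hSN : S ≤ N) (h h' : ℝ → ℝ)
    (hd : ∀ τ, 0 < τ → HasDerivAt h (h' τ) τ) (hc : ContinuousOn h' (Set.Ioi 0)) (hneg : ∀ τ, 0 < τ → h' τ ≤ 0)
    (hpos : ∀ τ, 0 < τ → 0 ≤ h τ) :
    ‖∫ τ in S..N, (h τ : ℂ) * (((Real.sqrt τ)⁻¹ : ℝ) * cexp (((2 * Real.pi * (τ + c ^ 2 / τ) : ℝ) : ℂ) * I))‖ ≤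
      24 * h S := by
  have hsub : ∀ τ ∈ Set.uIcc S N, 0 < τ := by
    intro τ hτ; rw [Set.uIcc_of_le hSN] at hτ; linarith [hτ.1]
  have hsub' : Set.uIcc S N ⊆ Set.Ioi 0 := hsub
  have hci : IntervalIntegrable h' volume S N := (hc.mono hsub').intervalIntegrable
  have hgc : ContinuousOn (fun τ : ℝ => (((Real.sqrt τ)⁻¹ : ℝ) * cexp (((2 * Real.pi * (τ + c ^ 2 / τ) : ℝ) : ℂ) * I) : ℂ)) (Set.uIcc S N) := by
    apply ContinuousOn.mul
    · apply Complex.continuous_ofReal.comp_continuousOn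
      apply ContinuousOn.inv₀ (by fun_prop)
      intro τ hτ; exact (Real.sqrt_pos.2 (hsub τ hτ)).ne'
    · apply Complex.continuous_exp.comp_continuousOn
      apply ContinuousOn.mul _ continuousOn_const
      apply Complex.continuous_ofReal.comp_continuousOn
      apply continuousOn_const.mul
      apply continuousOn_id.add
      apply continuousOn_const.div continuousOn_id
      intro τ hτ; exact (hsub τ hτ).ne'
  have ibp := intervalIntegral.integral_mul_deriv_eq_deriv_mul (a := S) (b := N)
    (u := fun τ => (h τ : ℂ)) (u' := fun τ => (h' τ : ℂ)) (v := GG c)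
    (v' := fun τ => (((Real.sqrt τ)⁻¹ : ℝ) * cexp (((2 * Real.pi * (τ + c ^ 2 / τ) : ℝ) : ℂ) * I) : ℂ))
    (fun τ hτ => (hd τ (hsub τ hτ)).ofReal_comp) (fun τ hτ => hasDerivAt_GG c (hsub τ hτ))
    (Complex.continuous_ofReal.comp_continuousOn (hc.mono hsub')).intervalIntegrable hgc.intervalIntegrable
  rw [ibp]
  have hN : 0 < N := hS.trans_le hSN
  have hint : ∫ τ in S..N, h' τ = h N - h S :=
    intervalIntegral.integral_eq_sub_of_hasDerivAt (fun τ hτ => hd τ (hsub τ hτ)) hci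
  have hdec : h N ≤ h S := by
    have : ∫ τ in S..N, h' τ ≤ 0 := by
      rw [intervalIntegral.integral_of_le hSN]
      apply setIntegral_nonpos measurableSet_Ioc
      intro τ hτ; exact hneg τ (hS.trans hτ.1)
    linarith
  have h3 : ‖∫ τ in S..N, (h' τ : ℂ) * GG c τ‖ ≤ ∫ τ in S..N, -(8 * h' τ) := by
    apply intervalIntegral.norm_integral_le_of_norm_le hSN _ ((hci.const_mul 8).neg)
    refine Eventually.of_forall fun τ hτ => ?_
    rw [norm_mul, Complex.norm_real, Real.norm_eq_abs, abs_of_nonpos (hneg τ (hS.trans hτ.1))]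
    have := mul_le_mul_of_nonneg_left (GG_bound c τ) (neg_nonneg.2 (hneg τ (hS.trans hτ.1)))
    simp only [Pi.neg_apply, Pi.mul_apply]
    linarith
  rw [intervalIntegral.integral_neg, intervalIntegral.integral_const_mul, hint] at h3
  have h1 : ‖(h N : ℂ) * GG c N‖ ≤ h N * 8 := by
    rw [norm_mul, Complex.norm_real, Real.norm_of_nonneg (hpos N hN)]
    exact mul_le_mul_of_nonneg_left (GG_bound c N) (hpos N hN)
  have h2 : ‖(h S : ℂ) * GG c S‖ ≤ h S * 8 := by
    rw [norm_mul, Complex.norm_real, Real.norm_of_nonneg (hpos S hS)]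
    exact mul_le_mul_of_nonneg_left (GG_bound c S) (hpos S hS)
  calc _ ≤ ‖(h N : ℂ) * GG c N‖ + ‖(h S : ℂ) * GG c S‖ + ‖∫ τ in S..N, (h' τ : ℂ) * GG c τ‖ :=
        (norm_sub_le _ _).trans (add_le_add (norm_sub_le _ _) le_rfl)
    _ ≤ _ := by have := hpos S hS; have := hpos N hN; linarith

/-- oscillatory integral on a half line -/
theorem osc_inf (n : ℕ) (hn : 1 ≤ n) (c δ : ℝ) (hδ : 0 < δ) {S : ℝ} (hS : 0 < S) :
    IntegrableOn (fun τ : ℝ => ((Real.exp (-(2 * Real.pi * δ) * τ) * τ ^ (-(n / 2 : ℝ)) : ℝ) : ℂ) *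
      cexp (((2 * Real.pi * (τ + c ^ 2 / τ) : ℝ) : ℂ) * I)) (Set.Ioi S) ∧
    ‖∫ τ in Set.Ioi S, ((Real.exp (-(2 * Real.pi * δ) * τ) * τ ^ (-(n / 2 : ℝ)) : ℝ) : ℂ) *
      cexp (((2 * Real.pi * (τ + c ^ 2 / τ) : ℝ) : ℂ) * I)‖ ≤ 24 * S ^ (-((n - 1) / 2 : ℝ)) := by
  have hpi := Real.pi_pos
  set k := 2 * Real.pi * δ with hk
  have hk0 : 0 < k := by positivity
  set ρ : ℝ := (n - 1) / 2 with hρ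
  have hn' : (1:ℝ) ≤ n := by exact_mod_cast hn
  have hρ0 : 0 ≤ ρ := by rw [hρ]; linarith
  set F : ℝ → ℂ := fun τ : ℝ => ((Real.exp (-k * τ) * τ ^ (-(n / 2 : ℝ)) : ℝ) : ℂ) *
      cexp (((2 * Real.pi * (τ + c ^ 2 / τ) : ℝ) : ℂ) * I) with hF
  have hint : IntegrableOn F (Set.Ioi S) := by
    have hm : Measurable F := by rw [hF]; fun_prop
    refine Integrable.mono' (g := fun τ => Real.exp (-k * τ) * S ^ (-(n / 2 : ℝ)))
      ((integrableOn_exp_mul_Ioi (by linarith : -k < 0) S).mul_const _) hm.aestronglyMeasurable ?_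
    filter_upwards [ae_restrict_mem measurableSet_Ioi] with τ hτ
    have hτ' : S < τ := hτ
    rw [hF]; simp only [norm_mul, Complex.norm_exp_ofReal_mul_I, mul_one, Complex.norm_real]
    have hτ0 : 0 < τ := hS.trans hτ'
    rw [Real.norm_of_nonneg (by positivity), Real.norm_of_nonneg (by positivity)]
    refine mul_le_mul_of_nonneg_left ?_ (Real.exp_pos _).le
    have h0 : (0:ℝ) ≤ n := Nat.cast_nonneg n
    exact Real.rpow_le_rpow_of_nonpos hS hτ'.le (by linarith)
  refine ⟨hint, ?_⟩
  have hlim := intervalIntegral_tendsto_integral_Ioi S hint tendsto_id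
  refine le_of_tendsto hlim.norm ?_
  filter_upwards [eventually_ge_atTop S] with N hN
  set h : ℝ → ℝ := fun τ => Real.exp (-k * τ) * τ ^ (-ρ) with hh
  set h' : ℝ → ℝ := fun τ => (Real.exp (-k * τ) * -k) * τ ^ (-ρ) + Real.exp (-k * τ) * (-ρ * τ ^ (-ρ - 1)) with hh'
  have hd : ∀ τ, 0 < τ → HasDerivAt h (h' τ) τ := by
    intro τ hτ
    have a1 : HasDerivAt (fun τ => Real.exp (-k * τ)) (Real.exp (-k * τ) * -k) τ := by
      have := ((hasDerivAt_id τ).const_mul (-k)).exp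
      simpa using this
    exact a1.mul (Real.hasDerivAt_rpow_const (Or.inl hτ.ne'))
  have hc : ContinuousOn h' (Set.Ioi 0) := by
    intro τ hτ
    have : τ ≠ 0 := ne_of_gt hτ
    apply ContinuousAt.continuousWithinAt
    rw [hh']
    have r1 := Real.continuousAt_rpow_const τ (-ρ) (Or.inl this)
    have r2 := Real.continuousAt_rpow_const τ (-ρ - 1) (Or.inl this)
    fun_prop
  have key := osc_fin c hS hN h h' hd hc (by
    intro τ hτ
    rw [hh']; simp only []
    have q1 : 0 ≤ Real.exp (-k * τ) * k * τ ^ (-ρ) := by positivity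
    have q2 : 0 ≤ Real.exp (-k * τ) * (ρ * τ ^ (-ρ - 1)) := by positivity
    linarith) (by intro τ hτ; rw [hh]; positivity)
  have hcongr : ∫ τ in S..N, F τ = ∫ τ in S..N, (h τ : ℂ) * (((Real.sqrt τ)⁻¹ : ℝ) * cexp (((2 * Real.pi * (τ + c ^ 2 / τ) : ℝ) : ℂ) * I)) := by
    apply intervalIntegral.integral_congr
    intro τ hτ
    rw [Set.uIcc_of_le hN] at hτ
    have hτ0 : 0 < τ := hS.trans_le hτ.1
    simp only [hF, hh]
    rw [← mul_assoc, ← ofReal_mul]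
    congr 2
    rw [mul_assoc]
    congr 1
    rw [Real.sqrt_eq_rpow, ← Real.rpow_neg hτ0.le, ← Real.rpow_add hτ0]
    congr 1; rw [hρ]; ring
  simp only [id]
  rw [hcongr]
  refine key.trans ?_
  rw [hh]
  have : Real.exp (-k * S) ≤ 1 := Real.exp_le_one_iff.2 (by nlinarith)
  have h0 : 0 ≤ S ^ (-ρ) := by positivity
  simp only []
  nlinarith

end SqFn

namespace SqFn

/-- the Fresnel constant -/
noncomputable def kap0 (n : ℕ) : ℂ := (-I) ^ (n / 2 : ℂ)

theorem norm_kap0 (n : ℕ) : ‖kap0 n‖ = 1 := by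
  unfold kap0
  have := Complex.norm_cpow_real (-I) (n / 2 : ℝ)
  push_cast at this
  rw [this]; simp

theorem cpow_fresnel (n : ℕ) {σ : ℝ} (hσ : 0 < σ) :
    ((Real.pi : ℂ) / (((2 * Real.pi * σ : ℝ) : ℂ) * I)) ^ (n / 2 : ℂ) = kap0 n * (((1 / (2 * σ)) ^ (n / 2 : ℝ) : ℝ) : ℂ) := by
  have hpi : (Real.pi : ℂ) ≠ 0 := by exact_mod_cast Real.pi_ne_zero
  have hσ' : (σ : ℂ) ≠ 0 := by exact_mod_cast hσ.ne'
  have e : (Real.pi : ℂ) / (((2 * Real.pi * σ : ℝ) : ℂ) * I) = ((1 / (2 * σ) : ℝ) : ℂ) * (-I) := by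
    push_cast
    field_simp
    simp
  have h0 : (0:ℝ) < 1 / (2 * σ) := by positivity
  have hI : (-I : ℂ) ≠ 0 := by simp
  rw [e, Complex.cpow_def_of_ne_zero (mul_ne_zero (by exact_mod_cast h0.ne') hI), Complex.log_ofReal_mul h0 hI,
    add_mul, Complex.exp_add, kap0, Complex.cpow_def_of_ne_zero hI, mul_comm]
  congr 1
  rw [Real.rpow_def_of_pos h0]; push_cast; rfl

theorem gauss_id0 {n : ℕ} {σ : ℝ} (hσ : 0 < σ) {u : V n → ℂ} (hu : Integrable u)
    (hu2 : Integrable (fun ξ => ‖𝓕 u ξ‖ ^ 2)) :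
    ∫ ξ, cexp (((-(2 * Real.pi * σ) * ‖ξ‖ ^ 2 : ℝ) : ℂ) * I) * ((‖𝓕 u ξ‖ ^ 2 : ℝ) : ℂ) =
      ∫ x, (starRingEnd ℂ) (u x) * ∫ y, (kap0 n * (((1 / (2 * σ)) ^ (n / 2 : ℝ) : ℝ) : ℂ) *
        cexp (((Real.pi * ‖x - y‖ ^ 2 / (2 * σ) : ℝ) : ℂ) * I)) * u y := by
  have hpi := Real.pi_pos
  set b0 : ℂ := ((2 * Real.pi * σ : ℝ) : ℂ) * I with hb0
  have hb0ne : b0 ≠ 0 := by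
    rw [hb0]; exact mul_ne_zero (by exact_mod_cast (by positivity : (2 * Real.pi * σ) ≠ 0)) I_ne_zero
  set b : ℕ → ℂ := fun m => b0 + ((1 / ((m:ℝ) + 1) : ℝ) : ℂ) with hb
  have hbre : ∀ m, (b m).re = 1 / ((m:ℝ) + 1) := by
    intro m; rw [hb, hb0]
    simp only [add_re, ofReal_re, mul_re, I_re, I_im, ofReal_im]; ring
  have hbre0 : ∀ m, 0 < (b m).re := fun m => by rw [hbre]; positivity
  have hbim : ∀ m, (b m).im = 2 * Real.pi * σ := by
    intro m; rw [hb, hb0]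
    simp only [add_im, ofReal_re, mul_im, I_re, I_im, ofReal_im]; ring
  have hbne : ∀ m, b m ≠ 0 := fun m h => by have := hbre0 m; rw [h] at this; simp at this
  have hblim : Tendsto b atTop (𝓝 b0) := by
    have h1 : Tendsto (fun m : ℕ => ((1 / ((m:ℝ) + 1) : ℝ) : ℂ)) atTop (𝓝 ((0:ℝ):ℂ)) :=
      (Complex.continuous_ofReal.tendsto 0).comp tendsto_one_div_add_atTop_nhds_zero_nat
    have := h1.const_add b0
    rw [ofReal_zero, add_zero] at this
    exact this
  have hnb : ∀ m, ‖((Real.pi : ℂ) / b m) ^ (n / 2 : ℂ)‖ ≤ (1 / (2 * σ)) ^ (n / 2 : ℝ) := by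
    intro m
    have h1 := Complex.norm_cpow_real ((Real.pi : ℂ) / b m) (n / 2 : ℝ)
    push_cast at h1
    rw [h1]
    apply Real.rpow_le_rpow (norm_nonneg _) _ (by positivity)
    have h2 : 2 * Real.pi * σ ≤ ‖b m‖ := by
      have := Complex.abs_im_le_norm (b m)
      rw [hbim] at this
      exact (le_abs_self _).trans this
    rw [norm_div, Complex.norm_real, Real.norm_of_nonneg hpi.le]
    calc Real.pi / ‖b m‖ ≤ Real.pi / (2 * Real.pi * σ) := by
          apply div_le_div_of_nonneg_left hpi.le (by positivity) h2
      _ = _ := by field_simp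
  have hne : ∀ m (r : ℝ), ‖cexp (-(Real.pi : ℂ) ^ 2 * (r : ℂ) ^ 2 / b m)‖ ≤ 1 := by
    intro m r
    rw [Complex.norm_exp, Real.exp_le_one_iff]
    have e : -(Real.pi : ℂ) ^ 2 * (r : ℂ) ^ 2 / b m = ((-(Real.pi ^ 2 * r ^ 2) : ℝ) : ℂ) * (b m)⁻¹ := by
      push_cast; rw [div_eq_mul_inv]; ring
    rw [e, Complex.re_ofReal_mul, Complex.inv_re]
    have : 0 ≤ (b m).re / normSq (b m) := div_nonneg (hbre0 m).le (normSq_nonneg _)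
    have h3 : 0 ≤ Real.pi ^ 2 * r ^ 2 := by positivity
    nlinarith
  have hgl : ∀ ξ : V n, ‖ξ‖ = ‖ξ‖ := fun _ => rfl
  have hconj : ∀ ξ : V n, 𝓕 u ξ * (starRingEnd ℂ) (𝓕 u ξ) = ((‖𝓕 u ξ‖ ^ 2 : ℝ) : ℂ) := by
    intro ξ; rw [Complex.mul_conj, Complex.normSq_eq_norm_sq]
  have hfc := continuous_fourier hu
  -- left side
  have L : Tendsto (fun m => ∫ ξ, cexp (-b m * ‖ξ‖ ^ 2) * 𝓕 u ξ * (starRingEnd ℂ) (𝓕 u ξ)) atTop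
      (𝓝 (∫ ξ, cexp (((-(2 * Real.pi * σ) * ‖ξ‖ ^ 2 : ℝ) : ℂ) * I) * ((‖𝓕 u ξ‖ ^ 2 : ℝ) : ℂ))) := by
    apply tendsto_integral_of_dominated_convergence (fun ξ => ‖𝓕 u ξ‖ ^ 2) _ hu2
    · intro m
      refine Eventually.of_forall fun ξ => ?_
      rw [mul_assoc, hconj, norm_mul, Complex.norm_real, Real.norm_of_nonneg (sq_nonneg _)]
      apply mul_le_of_le_one_left (sq_nonneg _)
      rw [Complex.norm_exp, Real.exp_le_one_iff]
      rw [show -b m * (‖ξ‖ : ℂ) ^ 2 = ((‖ξ‖ ^ 2 : ℝ) : ℂ) * (-b m) by push_cast; ring, Complex.re_ofReal_mul, neg_re]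
      have := hbre0 m
      have := sq_nonneg ‖ξ‖
      nlinarith
    · refine Eventually.of_forall fun ξ => ?_
      simp_rw [mul_assoc, hconj]
      apply Tendsto.mul_const
      have e : (((-(2 * (Real.pi * σ)) * ‖ξ‖ ^ 2 : ℝ) : ℂ) * I) = -b0 * (‖ξ‖ : ℂ) ^ 2 := by
        rw [hb0]; push_cast; ring
      rw [e]
      exact (Complex.continuous_exp.tendsto _).comp (hblim.neg.mul_const _)
    · intro m
      have : Continuous fun ξ => cexp (-b m * ‖ξ‖ ^ 2) * 𝓕 u ξ * (starRingEnd ℂ) (𝓕 u ξ) := by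
        apply Continuous.mul (Continuous.mul (by fun_prop) hfc)
        exact Complex.continuous_conj.comp hfc
      exact this.aestronglyMeasurable
  have hker : ∀ z : ℝ, Tendsto (fun m => ((Real.pi : ℂ) / b m) ^ (n / 2 : ℂ) *
        cexp (-(Real.pi : ℂ) ^ 2 * (z : ℂ) ^ 2 / b m)) atTop (𝓝 (kap0 n * (((1 / (2 * σ)) ^ (n / 2 : ℝ) : ℝ) : ℂ) *
        cexp (((Real.pi * z ^ 2 / (2 * σ) : ℝ) : ℂ) * I))) := by
    intro z
    rw [← cpow_fresnel n hσ, ← hb0]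
    have e2 : (((Real.pi * z ^ 2 / (2 * σ) : ℝ) : ℂ) * I) = -(Real.pi : ℂ) ^ 2 * (z : ℂ) ^ 2 / b0 := by
      rw [hb0]
      have hpi' : (Real.pi : ℂ) ≠ 0 := by exact_mod_cast Real.pi_ne_zero
      have hσ' : (σ : ℂ) ≠ 0 := by exact_mod_cast hσ.ne'
      push_cast
      field_simp
      rw [I_sq]; ring
    rw [e2]
    apply Tendsto.mul
    · have hc : ContinuousAt (fun z : ℂ => z ^ (n / 2 : ℂ)) ((Real.pi : ℂ) / b0) := by
        apply continuousAt_cpow_const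
        right
        rw [hb0, div_eq_mul_inv, Complex.im_ofReal_mul, Complex.inv_im]
        simp
        exact hσ.ne'
      exact hc.tendsto.comp (tendsto_const_nhds.div hblim hb0ne)
    · exact (Complex.continuous_exp.tendsto _).comp (tendsto_const_nhds.div hblim hb0ne)
  set A : ℝ := (1 / (2 * σ)) ^ (n / 2 : ℝ) with hA
  have hkn : ∀ m (z : ℝ), ‖((Real.pi : ℂ) / b m) ^ (n / 2 : ℂ) *
        cexp (-(Real.pi : ℂ) ^ 2 * (z : ℂ) ^ 2 / b m)‖ ≤ A := by
    intro m z
    rw [norm_mul]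
    exact (mul_le_of_le_one_right (norm_nonneg _) (hne m z)).trans (hnb m)
  have hum := hu.aestronglyMeasurable
  have Rr : Tendsto (fun m => ∫ x, (starRingEnd ℂ) (u x) * ∫ y, (((Real.pi : ℂ) / b m) ^ (n / 2 : ℂ) *
        cexp (-(Real.pi : ℂ) ^ 2 * ‖x - y‖ ^ 2 / b m)) * u y) atTop
      (𝓝 (∫ x, (starRingEnd ℂ) (u x) * ∫ y, (kap0 n * (A : ℂ) *
        cexp (((Real.pi * ‖x - y‖ ^ 2 / (2 * σ) : ℝ) : ℂ) * I)) * u y)) := by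
    apply tendsto_integral_of_dominated_convergence (fun x => ‖u x‖ * (A * ∫ y, ‖u y‖)) _ (hu.norm.mul_const _)
    · intro m
      refine Eventually.of_forall fun x => ?_
      rw [norm_mul, RCLike.norm_conj]
      apply mul_le_mul_of_nonneg_left _ (norm_nonneg _)
      rw [← integral_const_mul]
      apply norm_integral_le_of_norm_le (hu.norm.const_mul A)
      refine Eventually.of_forall fun y => ?_
      rw [norm_mul]
      exact mul_le_mul_of_nonneg_right (hkn m _) (norm_nonneg _)
    · refine Eventually.of_forall fun x => ?_
      apply Tendsto.const_mul
      apply tendsto_integral_of_dominated_convergence (fun y => A * ‖u y‖) _ (hu.norm.const_mul A)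
      · intro m
        refine Eventually.of_forall fun y => ?_
        rw [norm_mul]
        exact mul_le_mul_of_nonneg_right (hkn m _) (norm_nonneg _)
      · refine Eventually.of_forall fun y => ?_
        exact (hker _).mul_const _
      · intro m
        refine AEStronglyMeasurable.mul ?_ hum
        exact (by fun_prop : Continuous fun y : V n => ((Real.pi : ℂ) / b m) ^ (n / 2 : ℂ) *
          cexp (-(Real.pi : ℂ) ^ 2 * ‖x - y‖ ^ 2 / b m)).aestronglyMeasurable
    · intro m
      refine AEStronglyMeasurable.mul (Complex.continuous_conj.comp_aestronglyMeasurable hum) ?_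
      have hg := integrable_gauss (n := n) (hbre0 m)
      have : (fun x => ∫ y, (((Real.pi : ℂ) / b m) ^ (n / 2 : ℂ) *
        cexp (-(Real.pi : ℂ) ^ 2 * ‖x - y‖ ^ 2 / b m)) * u y) = iF (fun ξ => cexp (-b m * ‖ξ‖ ^ 2) * 𝓕 u ξ) := by
        ext x
        rw [iF_conv hg hu]
        simp_rw [iF_gauss (hbre0 m)]
      rw [this]
      exact (continuous_iF (integrable_mul_fourier hg hu)).aestronglyMeasurable
  refine tendsto_nhds_unique L ?_
  simp_rw [gauss_id (hbre0 _) hu]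
  exact Rr

theorem st_core {n : ℕ} (hn : 1 ≤ n) {δ t S : ℝ} (hδ : 0 < δ) (ht : 0 < t) (hS : 0 < S) {u : V n → ℂ}
    (hu : Integrable u) (hum : Measurable u) (hu2 : Integrable (fun ξ => ‖𝓕 u ξ‖ ^ 2)) :
    ∫ ξ, (1 / (1 + (δ⁻¹ * (1 - ‖ξ‖ ^ 2 / t ^ 2)) ^ 2)) * ‖𝓕 u ξ‖ ^ 2 ≤
      2 * Real.pi * δ * S * (∫ ξ, ‖𝓕 u ξ‖ ^ 2) +
      48 * Real.pi * δ * (t ^ 2 / 2) ^ (n / 2 : ℝ) * S ^ (-((n - 1) / 2 : ℝ)) * (∫ x, ‖u x‖) ^ 2 := by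
  have hpi := Real.pi_pos
  set k := 2 * Real.pi * δ with hk
  have hk0 : 0 < k := by positivity
  set a : ℝ → ℂ := fun τ => ((k * Real.exp (-k * τ) : ℝ) : ℂ) * cexp (((2 * Real.pi * τ : ℝ) : ℂ) * I) with ha
  have han : ∀ τ, ‖a τ‖ = k * Real.exp (-k * τ) := by
    intro τ; rw [ha]; simp only []
    rw [norm_mul, Complex.norm_exp_ofReal_mul_I, mul_one, Complex.norm_real, Real.norm_of_nonneg (by positivity)]
  have ham : Continuous a := by rw [ha]; fun_prop
  set D : V n → ℝ → ℂ := fun ξ τ => cexp (((-(2 * Real.pi * (τ / t ^ 2)) * ‖ξ‖ ^ 2 : ℝ) : ℂ) * I) *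
    ((‖𝓕 u ξ‖ ^ 2 : ℝ) : ℂ) with hD
  have hDn : ∀ ξ τ, ‖D ξ τ‖ = ‖𝓕 u ξ‖ ^ 2 := by
    intro ξ τ; rw [hD]; simp only []
    rw [norm_mul, Complex.norm_exp_ofReal_mul_I, one_mul, Complex.norm_real, Real.norm_of_nonneg (by positivity)]
  have hfc := continuous_fourier hu
  have hDm : Continuous (fun z : ℝ × V n => D z.2 z.1) := by
    rw [hD]
    have : Continuous fun z : ℝ × V n => 𝓕 u z.2 := hfc.comp continuous_snd
    fun_prop
  set G : ℝ → ℂ := fun τ => a τ * ∫ ξ, D ξ τ with hG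
  have hexpi : IntegrableOn (fun τ => k * Real.exp (-k * τ)) (Set.Ioi 0) :=
    (integrableOn_exp_mul_Ioi (by linarith : -k < 0) 0).const_mul k
  have hFub : Integrable (Function.uncurry fun (τ : ℝ) (ξ : V n) => a τ * D ξ τ)
      ((volume.restrict (Set.Ioi 0)).prod volume) := by
    refine Integrable.mono' (Integrable.mul_prod (μ := volume.restrict (Set.Ioi (0:ℝ))) (ν := (volume : Measure (V n))) hexpi hu2) ?_ ?_
    · exact ((ham.comp continuous_fst).mul hDm).aestronglyMeasurable
    · refine Eventually.of_forall fun z => ?_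
      simp only [Function.uncurry]
      rw [norm_mul, han, hDn]
  have hGe : ∀ τ, G τ = ∫ ξ, a τ * D ξ τ := fun τ => by rw [hG]; simp only []; rw [integral_const_mul]
  have hGi : IntegrableOn G (Set.Ioi 0) := by
    have := hFub.integral_prod_left
    refine this.congr (Eventually.of_forall fun τ => ?_)
    simp only [Function.uncurry]
    exact (hGe τ).symm
  -- first identity
  have h1 : (∫ τ in Set.Ioi (0:ℝ), G τ).re =
      ∫ ξ, (1 / (1 + (δ⁻¹ * (1 - ‖ξ‖ ^ 2 / t ^ 2)) ^ 2)) * ‖𝓕 u ξ‖ ^ 2 := by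
    simp_rw [hGe]
    rw [integral_integral_swap hFub]
    have hinner : ∀ ξ : V n, ∫ τ in Set.Ioi (0:ℝ), a τ * D ξ τ =
        (1 / (1 - ((δ⁻¹ * (1 - ‖ξ‖ ^ 2 / t ^ 2) : ℝ) : ℂ) * I)) * ((‖𝓕 u ξ‖ ^ 2 : ℝ) : ℂ) := by
      intro ξ
      set v : ℝ := δ⁻¹ * (1 - ‖ξ‖ ^ 2 / t ^ 2) with hv
      set w : ℂ := ((-k : ℝ) : ℂ) + ((2 * Real.pi * (1 - ‖ξ‖ ^ 2 / t ^ 2) : ℝ) : ℂ) * I with hw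
      have e1 : ∀ τ : ℝ, a τ * D ξ τ = (k : ℂ) * ((‖𝓕 u ξ‖ ^ 2 : ℝ) : ℂ) * cexp (w * τ) := by
        intro τ
        rw [ha, hD]; simp only []
        rw [ofReal_mul k, ofReal_exp]
        have : cexp (w * τ) = cexp (((-k * τ : ℝ) : ℂ)) * cexp (((2 * Real.pi * τ : ℝ) : ℂ) * I) *
            cexp (((-(2 * Real.pi * (τ / t ^ 2)) * ‖ξ‖ ^ 2 : ℝ) : ℂ) * I) := by
          rw [← Complex.exp_add, ← Complex.exp_add, hw]
          congr 1; push_cast; ring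
        rw [this]; ring
      simp_rw [e1]
      have hwre : w.re = -k := by rw [hw, add_re, ofReal_re, Complex.re_ofReal_mul, I_re, mul_zero, add_zero]
      rw [integral_const_mul, integral_exp_mul_complex_Ioi (by rw [hwre]; linarith)]
      have hwk : w = -(k : ℂ) * (1 - (v : ℂ) * I) := by
        rw [hw, hv, hk]
        have hd' : (δ : ℂ) ≠ 0 := by exact_mod_cast hδ.ne'
        push_cast; field_simp; ring
      have hwne : (1 - (v : ℂ) * I) ≠ 0 := by
        intro h; have := congrArg Complex.re h; simp at this
      have hkne : (k : ℂ) ≠ 0 := by exact_mod_cast hk0.ne'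
      simp only [ofReal_zero, mul_zero, Complex.exp_zero]
      rw [hwk]
      field_simp
    simp_rw [hinner]
    have hint : Integrable fun ξ : V n => (1 / (1 - ((δ⁻¹ * (1 - ‖ξ‖ ^ 2 / t ^ 2) : ℝ) : ℂ) * I)) * ((‖𝓕 u ξ‖ ^ 2 : ℝ) : ℂ) := by
      have := hFub.integral_prod_right
      refine this.congr (Eventually.of_forall fun ξ => ?_)
      simp only [Function.uncurry]
      exact hinner ξ
    have := integral_re hint
    simp only [RCLike.re_to_complex] at this
    rw [← this]
    congr 1; ext ξ
    rw [Complex.re_mul_ofReal]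
    congr 1
    set v : ℝ := δ⁻¹ * (1 - ‖ξ‖ ^ 2 / t ^ 2)
    rw [one_div, Complex.inv_re]
    simp [Complex.normSq_apply]
    ring
  -- split
  have hsplit : ∫ τ in Set.Ioi (0:ℝ), G τ = (∫ τ in Set.Ioc 0 S, G τ) + ∫ τ in Set.Ioi S, G τ := by
    rw [← setIntegral_union (Set.Ioc_disjoint_Ioi le_rfl) measurableSet_Ioi
      (hGi.mono_set Set.Ioc_subset_Ioi_self) (hGi.mono_set (Set.Ioi_subset_Ioi hS.le)), Set.Ioc_union_Ioi_eq_Ioi hS.le]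
  have hA : ‖∫ τ in Set.Ioc 0 S, G τ‖ ≤ k * S * ∫ ξ, ‖𝓕 u ξ‖ ^ 2 := by
    have := norm_setIntegral_le_of_norm_le_const (μ := volume) (s := Set.Ioc 0 S) (f := G)
      (C := k * ∫ ξ, ‖𝓕 u ξ‖ ^ 2) (by simp) (by
        intro τ hτ
        rw [hG]; simp only []
        rw [norm_mul, han]
        apply mul_le_mul
        · apply mul_le_of_le_one_right hk0.le
          rw [Real.exp_le_one_iff]; nlinarith [hτ.1]
        · refine (norm_integral_le_integral_norm _).trans (le_of_eq ?_)
          simp_rw [hDn]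
        · exact norm_nonneg _
        · exact hk0.le)
    refine this.trans (le_of_eq ?_)
    rw [Measure.real, Real.volume_Ioc, sub_zero, ENNReal.toReal_ofReal hS.le]; ring
  -- tail
  set P : ℝ := (t ^ 2 / 2) ^ (n / 2 : ℝ) with hP
  have hP0 : 0 ≤ P := by positivity
  set F : V n → ℝ → ℂ := fun z τ => ((Real.exp (-k * τ) * τ ^ (-(n / 2 : ℝ)) : ℝ) : ℂ) *
      cexp (((2 * Real.pi * (τ + (t * ‖z‖ / 2) ^ 2 / τ) : ℝ) : ℂ) * I) with hF
  set Cc : ℂ := (k : ℂ) * kap0 n * (P : ℂ) with hCc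
  have hCn : ‖Cc‖ = k * P := by
    rw [hCc, norm_mul, norm_mul, norm_kap0, Complex.norm_real, Complex.norm_real, Real.norm_of_nonneg hk0.le,
      Real.norm_of_nonneg hP0, mul_one]
  have hFn : ∀ z τ, 0 < τ → ‖F z τ‖ = Real.exp (-k * τ) * τ ^ (-(n / 2 : ℝ)) := by
    intro z τ hτ; rw [hF]; simp only []
    rw [norm_mul, Complex.norm_exp_ofReal_mul_I, mul_one, Complex.norm_real, Real.norm_of_nonneg (by positivity)]
  have hFm : Measurable (fun z : (V n × V n) × ℝ => F (z.1.1 - z.1.2) z.2) := by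
    rw [hF]; fun_prop
  have hgi : IntegrableOn (fun τ : ℝ => Real.exp (-k * τ) * τ ^ (-(n / 2 : ℝ))) (Set.Ioi S) := by
    have := (osc_inf n hn 0 δ hδ hS).1.norm
    refine this.congr ?_
    filter_upwards [ae_restrict_mem measurableSet_Ioi] with τ hτ
    have hτ0 : 0 < τ := hS.trans hτ
    rw [norm_mul, Complex.norm_exp_ofReal_mul_I, mul_one, Complex.norm_real, Real.norm_of_nonneg (by positivity)]
  set H : (V n × V n) → ℝ → ℂ := fun z τ => ((starRingEnd ℂ) (u z.1) * u z.2) * (Cc * F (z.1 - z.2) τ) with hH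
  have hHm : Measurable (fun w : (V n × V n) × ℝ => H w.1 w.2) := by
    rw [hH]
    refine Measurable.mul ?_ (hFm.const_mul _)
    refine Measurable.mul ?_ (hum.comp (measurable_snd.comp measurable_fst))
    exact Complex.continuous_conj.measurable.comp (hum.comp (measurable_fst.comp measurable_fst))
  have huu : Integrable (fun z : V n × V n => ‖u z.1‖ * ‖u z.2‖) := hu.norm.mul_prod hu.norm
  have hHn : ∀ z τ, 0 < τ → ‖H z τ‖ = (‖u z.1‖ * ‖u z.2‖) * (k * P * (Real.exp (-k * τ) * τ ^ (-(n / 2 : ℝ)))) := by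
    intro z τ hτ
    rw [hH]; simp only []
    rw [norm_mul, norm_mul, norm_mul, RCLike.norm_conj, hCn, hFn _ _ hτ]
  have hGH : ∀ τ, S < τ → G τ = ∫ z, H z τ := by
    intro τ hτ'
    have hτ : 0 < τ := hS.trans hτ'
    have hHi : Integrable (fun z => H z τ) := by
      refine Integrable.mono' (huu.mul_const (k * P * (Real.exp (-k * τ) * τ ^ (-(n / 2 : ℝ))))) ?_ ?_
      · exact (hHm.comp (measurable_id.prodMk measurable_const)).aestronglyMeasurable
      · exact Eventually.of_forall fun z => (hHn z τ hτ).le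
    rw [Measure.volume_eq_prod, integral_prod _ hHi]
    have hσ : 0 < τ / t ^ 2 := by positivity
    rw [hG, hD]; simp only []
    rw [gauss_id0 hσ hu hu2, ← integral_const_mul]
    congr 1; ext x
    rw [← integral_const_mul, ← integral_const_mul]
    congr 1; ext y
    have e1 : (1 / (2 * (τ / t ^ 2))) ^ (n / 2 : ℝ) = P * τ ^ (-(n / 2 : ℝ)) := by
      rw [hP, Real.rpow_neg hτ.le, ← Real.inv_rpow hτ.le, ← Real.mul_rpow (by positivity) (by positivity)]
      congr 1; field_simp
    rw [e1, hH, hF, hCc, ha]; simp only []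
    have e2 : cexp (((2 * Real.pi * (τ + (t * ‖x - y‖ / 2) ^ 2 / τ) : ℝ) : ℂ) * I) =
        cexp (((2 * Real.pi * τ : ℝ) : ℂ) * I) * cexp (((Real.pi * ‖x - y‖ ^ 2 / (2 * (τ / t ^ 2)) : ℝ) : ℂ) * I) := by
      rw [← Complex.exp_add, ← add_mul, ← ofReal_add]
      congr 3
      field_simp
    rw [e2]
    push_cast
    ring
  have hB : ‖∫ τ in Set.Ioi S, G τ‖ ≤ k * P * (24 * S ^ (-((n - 1) / 2 : ℝ))) * (∫ x, ‖u x‖) ^ 2 := by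
    have e : ∫ τ in Set.Ioi S, G τ = ∫ τ in Set.Ioi S, ∫ z, H z τ :=
      setIntegral_congr_fun measurableSet_Ioi fun τ hτ => hGH τ hτ
    rw [e, integral_integral_swap]
    · have hb : ∀ z : V n × V n, ‖∫ τ in Set.Ioi S, H z τ‖ ≤
          (k * P * (24 * S ^ (-((n - 1) / 2 : ℝ)))) * (‖u z.1‖ * ‖u z.2‖) := by
        intro z
        rw [hH]; simp only []
        rw [integral_const_mul, integral_const_mul, norm_mul, norm_mul, norm_mul, RCLike.norm_conj, hCn, mul_comm]
        refine mul_le_mul_of_nonneg_right ?_ (by positivity)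
        refine mul_le_mul_of_nonneg_left ?_ (by positivity)
        exact (osc_inf n hn (t * ‖z.1 - z.2‖ / 2) δ hδ hS).2
      refine (norm_integral_le_of_norm_le (huu.const_mul _) (Eventually.of_forall hb)).trans (le_of_eq ?_)
      rw [integral_const_mul, Measure.volume_eq_prod, integral_prod_mul (fun x => ‖u x‖) (fun x => ‖u x‖), sq]
    · refine Integrable.mono' (Integrable.mul_prod (μ := volume.restrict (Set.Ioi S)) (hgi.const_mul (k * P)) huu) ?_ ?_
      · exact (hHm.comp (measurable_snd.prodMk measurable_fst)).aestronglyMeasurable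
      · have : ∀ᵐ w ∂((volume.restrict (Set.Ioi S)).prod (volume : Measure (V n × V n))), w.1 ∈ Set.Ioi S := by
          have := Measure.quasiMeasurePreserving_fst (μ := volume.restrict (Set.Ioi S)) (ν := (volume : Measure (V n × V n)))
          exact this.ae (ae_restrict_mem measurableSet_Ioi)
        filter_upwards [this] with w hw
        simp only [Function.uncurry]
        rw [hHn _ _ (hS.trans hw), mul_comm]
  rw [← h1, hsplit]
  calc _ ≤ ‖(∫ τ in Set.Ioc 0 S, G τ) + ∫ τ in Set.Ioi S, G τ‖ := Complex.re_le_norm _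
    _ ≤ k * S * (∫ ξ, ‖𝓕 u ξ‖ ^ 2) + k * P * (24 * S ^ (-((n - 1) / 2 : ℝ))) * (∫ x, ‖u x‖) ^ 2 :=
      (norm_add_le _ _).trans (add_le_add hA hB)
    _ = _ := by rw [hk]; ring

end SqFn

namespace SqFn

theorem weak_interp {X : Type*} [MeasurableSpace X] (μ : Measure X) [SFinite μ] (h : X → ℝ≥0∞) (hh : Measurable h)
    (N B θ p : ℝ) (hN : 0 < N) (hB : 0 < B) (hθ : 1 < θ) (hp : 2 < p) (hpθ : p < 2 * θ)
    (h1 : ∀ l : ℝ, 0 < l → μ {x | ENNReal.ofReal l < h x} ≤ ENNReal.ofReal (N * l ^ (-2:ℝ)))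
    (h2 : ∀ l : ℝ, 0 < l → μ {x | ENNReal.ofReal l < h x} ≤ ENNReal.ofReal ((N * B) ^ θ * l ^ (-(2 * θ)))) :
    ∫⁻ x, h x ^ p ∂μ ≤ ENNReal.ofReal (p * (1 / (p - 2) + 1 / (2 * θ - p)) *
      (N ^ (p / 2) * B ^ (θ * (p - 2) / (2 * (θ - 1))))) := by
  have hθ1 : 0 < θ - 1 := by linarith
  have hp2 : 0 < p - 2 := by linarith
  have hq2 : 0 < 2 * θ - p := by linarith
  rw [layercake μ h hh p (by linarith)]
  set L : ℝ := N ^ (1 / 2 : ℝ) * B ^ (θ / (2 * (θ - 1))) with hL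
  have hL0 : 0 < L := by positivity
  have hsplit : Set.Ioi (0:ℝ) = Set.Iic L ∩ Set.Ioi 0 ∪ Set.Ioi L := by
    ext x; simp only [Set.mem_Ioi, Set.mem_union, Set.mem_inter_iff, Set.mem_Iic]
    constructor
    · intro hx; rcases le_or_gt x L with h | h
      · exact Or.inl ⟨h, hx⟩
      · exact Or.inr h
    · rintro (h | h)
      · exact h.2
      · exact hL0.trans h
  have eA : N * L ^ (p - 2) = N ^ (p / 2) * B ^ (θ * (p - 2) / (2 * (θ - 1))) := by
    rw [hL, Real.mul_rpow (by positivity) (by positivity), ← Real.rpow_mul hN.le, ← Real.rpow_mul hB.le, ← mul_assoc]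
    nth_rewrite 1 [← Real.rpow_one N]
    rw [← Real.rpow_add hN]
    congr 2 <;> ring
  have eB : (N * B) ^ θ * L ^ (p - 2 * θ) = N ^ (p / 2) * B ^ (θ * (p - 2) / (2 * (θ - 1))) := by
    rw [hL, Real.mul_rpow (by positivity) (by positivity), Real.mul_rpow (by positivity) (by positivity),
      ← Real.rpow_mul hN.le, ← Real.rpow_mul hB.le]
    rw [show N ^ θ * B ^ θ * (N ^ (1 / 2 * (p - 2 * θ)) * B ^ (θ / (2 * (θ - 1)) * (p - 2 * θ))) =
      (N ^ θ * N ^ (1 / 2 * (p - 2 * θ))) * (B ^ θ * B ^ (θ / (2 * (θ - 1)) * (p - 2 * θ))) by ring,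
      ← Real.rpow_add hN, ← Real.rpow_add hB]
    congr 2
    · ring
    · field_simp; ring
  set Z := N ^ (p / 2) * B ^ (θ * (p - 2) / (2 * (θ - 1))) with hZ
  have hZ0 : 0 < Z := by positivity
  have IA : ∫⁻ l in Set.Iic L ∩ Set.Ioi 0, ENNReal.ofReal (l ^ (p - 1)) * μ {x | ENNReal.ofReal l < h x} ≤
      ENNReal.ofReal (Z / (p - 2)) := by
    calc _ ≤ ∫⁻ l in Set.Iic L ∩ Set.Ioi 0, ENNReal.ofReal (N * l ^ (p - 3)) := by
          refine setLIntegral_mono' (measurableSet_Iic.inter measurableSet_Ioi) fun l hl => ?_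
          have hl0 : 0 < l := hl.2
          refine (mul_le_mul' le_rfl (h1 l hl0)).trans ?_
          rw [← ENNReal.ofReal_mul (by positivity)]
          apply ENNReal.ofReal_le_ofReal
          rw [show l ^ (p - 1) * (N * l ^ (-2:ℝ)) = N * (l ^ (p - 1) * l ^ (-2:ℝ)) by ring, ← Real.rpow_add hl0]
          apply le_of_eq; congr 2; ring
      _ = ENNReal.ofReal (∫ l in Set.Iic L ∩ Set.Ioi 0, N * l ^ (p - 3)) := by
          rw [ofReal_integral_eq_lintegral_ofReal]
          · rw [Set.inter_comm, Set.Ioi_inter_Iic]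
            have := (intervalIntegral.intervalIntegrable_rpow' (a := 0) (b := L) (r := p - 3) (by linarith)).const_mul N
            rwa [intervalIntegrable_iff_integrableOn_Ioc_of_le hL0.le] at this
          · filter_upwards [ae_restrict_mem (measurableSet_Iic.inter measurableSet_Ioi)] with l hl
            have hl0 : 0 < l := hl.2
            simp only [Pi.zero_apply]; positivity
      _ ≤ _ := by
          apply ENNReal.ofReal_le_ofReal
          rw [Set.inter_comm, Set.Ioi_inter_Iic, ← intervalIntegral.integral_of_le hL0.le,
            intervalIntegral.integral_const_mul, integral_rpow (Or.inl (by linarith)), ← eA,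
            Real.zero_rpow (by linarith), sub_zero, show p - 3 + 1 = p - 2 by ring, mul_div_assoc]
  have IB : ∫⁻ l in Set.Ioi L, ENNReal.ofReal (l ^ (p - 1)) * μ {x | ENNReal.ofReal l < h x} ≤
      ENNReal.ofReal (Z / (2 * θ - p)) := by
    calc _ ≤ ∫⁻ l in Set.Ioi L, ENNReal.ofReal ((N * B) ^ θ * l ^ (p - 1 - 2 * θ)) := by
          refine setLIntegral_mono' measurableSet_Ioi fun l hl => ?_
          have hl0 : 0 < l := hL0.trans hl
          refine (mul_le_mul' le_rfl (h2 l hl0)).trans ?_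
          rw [← ENNReal.ofReal_mul (by positivity)]
          apply ENNReal.ofReal_le_ofReal
          rw [show l ^ (p - 1) * ((N * B) ^ θ * l ^ (-(2 * θ))) = (N * B) ^ θ * (l ^ (p - 1) * l ^ (-(2 * θ))) by ring,
            ← Real.rpow_add hl0]
          apply le_of_eq; congr 2
      _ = ENNReal.ofReal (∫ l in Set.Ioi L, (N * B) ^ θ * l ^ (p - 1 - 2 * θ)) := by
          rw [ofReal_integral_eq_lintegral_ofReal]
          · exact (integrableOn_Ioi_rpow_of_lt (by linarith) hL0).const_mul _
          · filter_upwards [ae_restrict_mem measurableSet_Ioi] with l hl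
            have hl0 : 0 < l := hL0.trans hl
            simp only [Pi.zero_apply]; positivity
      _ ≤ _ := by
          apply ENNReal.ofReal_le_ofReal
          rw [integral_const_mul, integral_Ioi_rpow_of_lt (by linarith) hL0, ← eB,
            show p - 1 - 2 * θ + 1 = p - 2 * θ by ring, mul_div_assoc]
          apply le_of_eq; congr 1
          rw [show 2 * θ - p = -(p - 2 * θ) by ring, div_neg, neg_div]
  have hp0 : (0:ℝ) ≤ p := by linarith
  calc _ ≤ ENNReal.ofReal p * (ENNReal.ofReal (Z / (p - 2)) + ENNReal.ofReal (Z / (2 * θ - p))) := by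
        refine mul_le_mul' le_rfl ?_
        conv_lhs => rw [hsplit]
        exact (lintegral_union_le _ _ _).trans (add_le_add IA IB)
    _ = _ := by
        rw [← ENNReal.ofReal_add (by positivity) (by positivity), ← ENNReal.ofReal_mul hp0]
        congr 1; ring

theorem st_set {n : ℕ} (hn : 2 ≤ n) {δ t : ℝ} (hδ : 0 < δ) (ht : 0 < t) {E : Set (V n)} (hE : MeasurableSet E)
    (hE0 : volume E ≠ 0) (hEt : volume E ≠ ⊤) {u : V n → ℂ} (hum : Measurable u)
    (hub : ∀ x, ‖u x‖ ≤ E.indicator (fun _ => (1:ℝ)) x) :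
    NN n δ t u ≤ ENNReal.ofReal (400 * δ * t ^ (2 * n / (n + 1) : ℝ) *
      (volume E).toReal ^ ((n + 3) / (n + 1) : ℝ)) := by
  have hpi := Real.pi_pos
  have hpi4 := Real.pi_le_four
  have hn2 : (2:ℝ) ≤ n := by exact_mod_cast hn
  set e := (volume E).toReal with he
  have he0 : 0 < e := ENNReal.toReal_pos hE0 hEt
  have hEi : Integrable (E.indicator (fun _ => (1:ℝ))) := by
    rw [integrable_indicator_iff hE]
    exact integrableOn_const hEt
  have hu : Integrable u := by
    refine hEi.mono' hum.aestronglyMeasurable (Eventually.of_forall hub)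
  have hE1 : ∫ x, E.indicator (fun _ => (1:ℝ)) x = e := by
    rw [integral_indicator hE]; simp [he, Measure.real]
  have hb : ∫⁻ ξ, ‖𝓕 u ξ‖ₑ ^ 2 ≤ volume E := by
    refine (bessel hu).trans ?_
    calc ∫⁻ x, ‖u x‖ₑ ^ 2 ≤ ∫⁻ x, E.indicator (fun _ => (1:ℝ≥0∞)) x := by
          refine lintegral_mono fun x => ?_
          have := hub x
          by_cases hx : x ∈ E
          · rw [Set.indicator_of_mem hx] at this ⊢
            have h1 : ‖u x‖ₑ ≤ 1 := by
              rw [← ofReal_norm, ← ENNReal.ofReal_one]; exact ENNReal.ofReal_le_ofReal this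
            exact pow_le_one' h1 2
          · rw [Set.indicator_of_notMem hx] at this
            have : u x = 0 := norm_le_zero_iff.1 this
            simp [this]
      _ = volume E := by rw [lintegral_indicator hE]; simp
  have hfc := continuous_fourier hu
  have hen : ∀ ξ, ENNReal.ofReal (‖𝓕 u ξ‖ ^ 2) = ‖𝓕 u ξ‖ₑ ^ 2 := by
    intro ξ; rw [ENNReal.ofReal_pow (norm_nonneg _), ofReal_norm]
  have hu2 : Integrable (fun ξ => ‖𝓕 u ξ‖ ^ 2) := by
    refine ⟨(by fun_prop : Continuous fun ξ => ‖𝓕 u ξ‖ ^ 2).aestronglyMeasurable, ?_⟩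
    rw [hasFiniteIntegral_iff_ofReal (Eventually.of_forall fun ξ => sq_nonneg _)]
    simp_rw [hen]
    exact hb.trans_lt hEt.lt_top
  have hu2e : ∫ ξ, ‖𝓕 u ξ‖ ^ 2 ≤ e := by
    rw [integral_eq_lintegral_of_nonneg_ae (Eventually.of_forall fun ξ => sq_nonneg _) hu2.aestronglyMeasurable]
    simp_rw [hen]
    exact ENNReal.toReal_mono hEt hb
  have hu1e : ∫ x, ‖u x‖ ≤ e := by
    rw [← hE1]; exact integral_mono hu.norm hEi hub
  set S : ℝ := (t ^ n * e) ^ (2 / (n + 1) : ℝ) with hS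
  have hS0 : 0 < S := by positivity
  have core := st_core (by omega : 1 ≤ n) hδ ht hS0 hu hum hu2
  set W : V n → ℝ := fun ξ => (1 / (1 + (δ⁻¹ * (1 - ‖ξ‖ ^ 2 / t ^ 2)) ^ 2)) * ‖𝓕 u ξ‖ ^ 2 with hW
  have hW0 : ∀ ξ, 0 ≤ W ξ := fun ξ => by rw [hW]; positivity
  have hWi : Integrable W := by
    refine hu2.mono' ?_ (Eventually.of_forall fun ξ => ?_)
    · have : Continuous W := by
        rw [hW]
        refine Continuous.mul ?_ (by fun_prop)
        apply continuous_const.div (by fun_prop)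
        intro ξ; positivity
      exact this.aestronglyMeasurable
    · rw [Real.norm_of_nonneg (hW0 ξ), hW]
      apply mul_le_of_le_one_left (sq_nonneg _)
      rw [div_le_one (by positivity)]
      have := sq_nonneg (δ⁻¹ * (1 - ‖ξ‖ ^ 2 / t ^ 2))
      linarith
  have hNN : NN n δ t u ≤ ENNReal.ofReal (5 / 4 * ∫ ξ, W ξ) := by
    rw [← integral_const_mul, ofReal_integral_eq_lintegral_ofReal (hWi.const_mul _)
      (Eventually.of_forall fun ξ => by have := hW0 ξ; simp only [Pi.zero_apply]; positivity)]
    unfold NN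
    refine le_trans (setLIntegral_mono' (measurableSet_AA n δ t) fun ξ hξ => ?_) (setLIntegral_le_lintegral _ _)
    rw [← hen]
    apply ENNReal.ofReal_le_ofReal
    rw [hW]; simp only []
    rw [← mul_assoc]
    apply le_mul_of_one_le_left (sq_nonneg _)
    rw [mul_one_div, one_le_div (by positivity)]
    have h1 : |1 - ‖ξ‖ ^ 2 / t ^ 2| ≤ δ / 2 := hξ
    have h2 : |δ⁻¹ * (1 - ‖ξ‖ ^ 2 / t ^ 2)| ≤ 1 / 2 := by
      rw [abs_mul, abs_of_pos (inv_pos.2 hδ)]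
      calc δ⁻¹ * |1 - ‖ξ‖ ^ 2 / t ^ 2| ≤ δ⁻¹ * (δ / 2) := mul_le_mul_of_nonneg_left h1 (inv_pos.2 hδ).le
        _ = 1 / 2 := by field_simp
    have h3 : (δ⁻¹ * (1 - ‖ξ‖ ^ 2 / t ^ 2)) ^ 2 ≤ (1 / 2) ^ 2 := sq_le_sq' (abs_le.1 h2).1 (abs_le.1 h2).2
    linarith
  refine hNN.trans (ENNReal.ofReal_le_ofReal ?_)
  have hte : 0 < t ^ n * e := by positivity
  set Q : ℝ := t ^ (2 * n / (n + 1) : ℝ) * e ^ ((n + 3) / (n + 1) : ℝ) with hQ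
  have hQ0 : 0 < Q := by positivity
  have hn1 : (n:ℝ) + 1 ≠ 0 := by positivity
  have eS : S * e = Q := by
    rw [hS, hQ, Real.mul_rpow (by positivity) he0.le, ← Real.rpow_natCast, ← Real.rpow_mul ht.le, mul_assoc]
    nth_rewrite 2 [← Real.rpow_one e]
    rw [← Real.rpow_add he0]
    congr 2
    · ring
    · field_simp; ring
  have eS2 : t ^ n * S ^ (-((n - 1) / 2 : ℝ)) * e ^ 2 = Q := by
    rw [hS, hQ, ← Real.rpow_mul hte.le, Real.mul_rpow (by positivity) he0.le, ← Real.rpow_natCast t n,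
      ← Real.rpow_natCast e 2, ← Real.rpow_mul ht.le]
    rw [show ∀ a b c d : ℝ, a * (b * c) * d = (a * b) * (c * d) by intros; ring, ← Real.rpow_add ht, ← Real.rpow_add he0]
    congr 2
    · field_simp; ring
    · push_cast; field_simp; ring
  have hP : (t ^ 2 / 2) ^ (n / 2 : ℝ) ≤ t ^ n := by
    calc (t ^ 2 / 2) ^ (n / 2 : ℝ) ≤ (t ^ 2) ^ (n / 2 : ℝ) := by
          apply Real.rpow_le_rpow (by positivity) _ (by positivity)
          have := sq_nonneg t; linarith
      _ = t ^ n := by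
          rw [← Real.rpow_natCast t 2, ← Real.rpow_mul ht.le, ← Real.rpow_natCast]; congr 1; push_cast; ring
  have hi0 : 0 ≤ ∫ x, ‖u x‖ := integral_nonneg fun x => norm_nonneg _
  have c1 : 2 * Real.pi * δ * S * (∫ ξ, ‖𝓕 u ξ‖ ^ 2) ≤ 2 * Real.pi * δ * Q := by
    rw [← eS, ← mul_assoc]
    exact mul_le_mul_of_nonneg_left hu2e (by positivity)
  have c2 : 48 * Real.pi * δ * (t ^ 2 / 2) ^ (n / 2 : ℝ) * S ^ (-((n - 1) / 2 : ℝ)) * (∫ x, ‖u x‖) ^ 2 ≤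
      48 * Real.pi * δ * Q := by
    rw [← eS2]
    calc _ ≤ 48 * Real.pi * δ * t ^ n * S ^ (-((n - 1) / 2 : ℝ)) * e ^ 2 := by
          gcongr
      _ = _ := by ring
  calc 5 / 4 * ∫ ξ, W ξ ≤ 5 / 4 * (2 * Real.pi * δ * Q + 48 * Real.pi * δ * Q) := by linarith
    _ = (250 / 4 * Real.pi) * (δ * Q) := by ring
    _ ≤ 400 * (δ * Q) := by
        apply mul_le_mul_of_nonneg_right _ (by positivity)
        have := Real.pi_lt_d2; linarith
    _ = _ := by rw [hQ]; ring

end SqFn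

namespace SqFn

theorem norm_iF_le {n : ℕ} (h : V n → ℂ) (x : V n) : ‖iF h x‖ ≤ ∫ ξ, ‖h ξ‖ := by
  unfold iF
  refine (norm_integral_le_integral_norm _).trans (le_of_eq ?_)
  simp [norm_ex]

theorem cs2 {X : Type*} [MeasurableSpace X] (μ : Measure X) (a b : X → ℝ≥0∞) (ha : AEMeasurable a μ)
    (hb : AEMeasurable b μ) : (∫⁻ x, a x * b x ∂μ) ^ 2 ≤ (∫⁻ x, a x ^ 2 ∂μ) * ∫⁻ x, b x ^ 2 ∂μ := by
  have h := ENNReal.lintegral_mul_le_Lp_mul_Lq μ Real.HolderConjugate.two_two ha hb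
  simp only [Pi.mul_apply, ENNReal.rpow_two] at h
  calc _ ≤ ((∫⁻ x, a x ^ 2 ∂μ) ^ (1 / 2 : ℝ) * (∫⁻ x, b x ^ 2 ∂μ) ^ (1 / 2 : ℝ)) ^ 2 := by gcongr
    _ = _ := by
      rw [mul_pow, ← ENNReal.rpow_natCast, ← ENNReal.rpow_natCast, ← ENNReal.rpow_mul, ← ENNReal.rpow_mul]
      norm_num

theorem pair_bound {n : ℕ} {φ : ℝ → ℝ} (hφ : Good φ) {δ : ℝ} (hδ : 0 < δ) (hδ1 : δ ≤ 1) {t : ℝ} (ht : 0 < t)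
    {g u : V n → ℂ} (hg : Integrable g) (hu : Integrable u) :
    ‖∫ x, (starRingEnd ℂ) (u x) * FT n φ δ t g x‖ₑ ^ 2 ≤ NN n δ t g * NN n δ t u := by
  have hi := integrable_mul_fourier (integrable_mt (n := n) hφ hδ hδ1 ht) hg
  unfold FT
  rw [pair hi hu]
  have hmg := (continuous_fourier hg).measurable
  have hmu := (continuous_fourier hu).measurable
  calc _ ≤ (∫⁻ ξ, ‖mt n φ δ t ξ * 𝓕 g ξ * (starRingEnd ℂ) (𝓕 u ξ)‖ₑ) ^ 2 := by
        gcongr; exact enorm_integral_le_lintegral_enorm _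
    _ ≤ (∫⁻ ξ in AA n δ t, ‖𝓕 g ξ‖ₑ * ‖𝓕 u ξ‖ₑ) ^ 2 := by
        refine pow_le_pow_left' ?_ 2
        rw [← lintegral_indicator (measurableSet_AA n δ t)]
        refine lintegral_mono fun ξ => ?_
        have h1 := enorm_mt_le (n := n) hφ hδ t ξ
        have h2 : ‖(starRingEnd ℂ) (𝓕 u ξ)‖ₑ = ‖𝓕 u ξ‖ₑ := by
          rw [← ofReal_norm, RCLike.norm_conj, ofReal_norm]
        rw [enorm_mul, enorm_mul, h2]
        by_cases hx : ξ ∈ AA n δ t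
        · rw [Set.indicator_of_mem hx] at h1 ⊢
          exact mul_le_mul' (mul_le_of_le_one_left' h1) le_rfl
        · rw [Set.indicator_of_notMem hx] at h1 ⊢
          have : ‖mt n φ δ t ξ‖ₑ = 0 := le_antisymm h1 zero_le
          rw [this]; simp
    _ ≤ _ := cs2 _ _ _ hmg.enorm.aemeasurable hmu.enorm.aemeasurable

theorem FT_weak {n : ℕ} (hn : 2 ≤ n) {φ : ℝ → ℝ} (hφ : Good φ) {δ : ℝ} (hδ : 0 < δ) (hδ1 : δ ≤ 1) {t : ℝ} (ht : 0 < t)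
    {g : V n → ℂ} (hg : Integrable g) (N : ℝ) (hN : 0 < N) (hNN : NN n δ t g ≤ ENNReal.ofReal N) (l : ℝ) (hl : 0 < l) :
    volume {x | ENNReal.ofReal l < ‖FT n φ δ t g x‖ₑ} ≤ ENNReal.ofReal (N * l ^ (-2:ℝ)) ∧
    volume {x | ENNReal.ofReal l < ‖FT n φ δ t g x‖ₑ} ≤
      ENNReal.ofReal ((N * (400 * δ * t ^ (2 * n / (n + 1) : ℝ))) ^ (((n:ℝ) + 1) / (n - 1)) *
        l ^ (-(2 * (((n:ℝ) + 1) / (n - 1))))) := by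
  have hn2 : (2:ℝ) ≤ n := by exact_mod_cast hn
  set h := FT n φ δ t g with hh
  have hi := integrable_mul_fourier (integrable_mt (n := n) hφ hδ hδ1 ht) hg
  have hhc : Continuous h := continuous_iF hi
  set E := {x | ENNReal.ofReal l < ‖h x‖ₑ} with hE
  have hEm : MeasurableSet E := measurableSet_lt measurable_const hhc.measurable.enorm
  have hl2 : ENNReal.ofReal l ≠ 0 := by simpa using hl
  have first : volume E ≤ ENNReal.ofReal (N * l ^ (-2:ℝ)) := by
    have h1 : ENNReal.ofReal l ^ 2 * volume E ≤ ENNReal.ofReal N := by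
      refine le_trans ?_ ((FT_L2 hφ hδ hδ1 ht hg).trans hNN)
      calc ENNReal.ofReal l ^ 2 * volume E = ∫⁻ x in E, ENNReal.ofReal l ^ 2 := by simp
        _ ≤ ∫⁻ x in E, ‖h x‖ₑ ^ 2 := by
            refine setLIntegral_mono' hEm fun x hx => ?_
            have : ENNReal.ofReal l < ‖h x‖ₑ := hx
            gcongr
        _ ≤ _ := setLIntegral_le_lintegral _ _
    have e1 : N * l ^ (-2:ℝ) = N / l ^ 2 := by
      rw [Real.rpow_neg hl.le, Real.rpow_two]; rfl
    rw [e1, ENNReal.ofReal_div_of_pos (by positivity), ENNReal.ofReal_pow hl.le]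
    rw [ENNReal.le_div_iff_mul_le (Or.inl (by positivity)) (Or.inl (by finiteness)), mul_comm]
    exact h1
  refine ⟨first, ?_⟩
  by_cases hE0 : volume E = 0
  · rw [hE0]; exact zero_le
  have hEt : volume E ≠ ⊤ := ne_top_of_le_ne_top ENNReal.ofReal_ne_top first
  set e := (volume E).toReal with he
  have he0 : 0 < e := ENNReal.toReal_pos hE0 hEt
  set u : V n → ℂ := E.indicator (fun x => h x / ‖h x‖) with hu
  have hum : Measurable u := by
    rw [hu]
    refine Measurable.indicator ?_ hEm
    have := hhc.measurable
    fun_prop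
  have hub : ∀ x, ‖u x‖ ≤ E.indicator (fun _ => (1:ℝ)) x := by
    intro x
    rw [hu]
    by_cases hx : x ∈ E
    · rw [Set.indicator_of_mem hx, Set.indicator_of_mem hx, norm_div, Complex.norm_real, norm_norm]
      exact div_self_le_one _
    · rw [Set.indicator_of_notMem hx, Set.indicator_of_notMem hx]; simp
  have hEi : Integrable (E.indicator (fun _ => (1:ℝ))) := by
    rw [integrable_indicator_iff hEm]
    exact integrableOn_const hEt
  have hui : Integrable u := hEi.mono' hum.aestronglyMeasurable (Eventually.of_forall hub)
  have hst := st_set hn hδ ht hEm hE0 hEt hum hub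
  have hpb := pair_bound hφ hδ hδ1 ht hg hui
  rw [← hh] at hpb
  have hid : ∀ x, (starRingEnd ℂ) (u x) * h x = ((E.indicator (fun x => ‖h x‖) x : ℝ) : ℂ) := by
    intro x
    rw [hu]
    by_cases hx : x ∈ E
    · rw [Set.indicator_of_mem hx, Set.indicator_of_mem hx]
      have hne : (‖h x‖ : ℂ) ≠ 0 := by
        intro h0
        have h0' : h x = 0 := by simpa using h0
        have : ENNReal.ofReal l < ‖h x‖ₑ := hx
        rw [h0'] at this; simp at this
      rw [map_div₀, Complex.conj_ofReal, div_mul_eq_mul_div, mul_comm, Complex.mul_conj, Complex.normSq_eq_norm_sq]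
      push_cast; field_simp
    · rw [Set.indicator_of_notMem hx, Set.indicator_of_notMem hx]; simp
  have hlow : l * e ≤ ∫ x, E.indicator (fun x => ‖h x‖) x := by
    have hsi : IntegrableOn (fun x => ‖h x‖) E := by
      refine Integrable.mono' (g := fun _ => ∫ ξ, ‖mt n φ δ t ξ * 𝓕 g ξ‖) (integrableOn_const hEt)
        hhc.norm.aestronglyMeasurable (Eventually.of_forall fun x => ?_)
      rw [norm_norm]
      exact norm_iF_le _ x
    rw [integral_indicator hEm]
    have : ∫ x in E, l = l * e := by simp [he, Measure.real, mul_comm]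
    rw [← this]
    refine setIntegral_mono_on (integrableOn_const hEt) hsi hEm fun x hx => ?_
    have h1 : ENNReal.ofReal l < ‖h x‖ₑ := hx
    rw [← ofReal_norm] at h1
    exact (ENNReal.lt_ofReal_iff_toReal_lt ENNReal.ofReal_ne_top |>.1 h1).le.trans' (by rw [ENNReal.toReal_ofReal hl.le])
  simp_rw [hid] at hpb
  have hio : ∫ x, ((E.indicator (fun x => ‖h x‖) x : ℝ) : ℂ) = ((∫ x, E.indicator (fun x => ‖h x‖) x : ℝ) : ℂ) :=
    integral_ofReal (𝕜 := ℂ)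
  rw [hio, ← ofReal_norm, Complex.norm_real] at hpb
  set B := 400 * δ * t ^ (2 * n / (n + 1) : ℝ) with hB
  have hB0 : 0 < B := by positivity
  have key : (l * e) ^ 2 ≤ N * (B * e ^ ((n + 3) / (n + 1) : ℝ)) := by
    have h1 : ENNReal.ofReal ((l * e) ^ 2) ≤ ENNReal.ofReal (N * (B * e ^ ((n + 3) / (n + 1) : ℝ))) := by
      rw [ENNReal.ofReal_pow (by positivity), ENNReal.ofReal_mul hN.le]
      calc _ ≤ ENNReal.ofReal ‖∫ x, E.indicator (fun x => ‖h x‖) x‖ ^ 2 := by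
            refine pow_le_pow_left' (ENNReal.ofReal_le_ofReal (hlow.trans (le_abs_self _))) 2
        _ ≤ _ := hpb.trans (mul_le_mul' hNN hst)
    exact (ENNReal.ofReal_le_ofReal_iff (by positivity)).1 h1
  rw [← ENNReal.ofReal_toReal hEt]
  apply ENNReal.ofReal_le_ofReal
  rw [← he]
  set θ := ((n:ℝ) + 1) / (n - 1) with hθ
  have hn1 : (0:ℝ) < n - 1 := by linarith
  have hθ0 : 0 < θ := by positivity
  have e1 : e ^ (1 / θ) ≤ N * B * l ^ (-2:ℝ) := by
    have h2 : e ^ 2 = e ^ (1 / θ) * e ^ ((n + 3) / (n + 1) : ℝ) := by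
      rw [← Real.rpow_add he0, ← Real.rpow_natCast]; congr 1
      rw [hθ]; push_cast; field_simp; ring
    rw [mul_pow, h2] at key
    have hp : 0 < e ^ ((n + 3) / (n + 1) : ℝ) := by positivity
    have h3 : l ^ 2 * e ^ (1 / θ) ≤ N * B := by
      refine le_of_mul_le_mul_right ?_ hp
      linarith
    rw [Real.rpow_neg hl.le, Real.rpow_two, ← div_eq_mul_inv, le_div_iff₀ (by positivity), mul_comm]
    exact h3
  calc e = (e ^ (1 / θ)) ^ θ := by rw [← Real.rpow_mul he0.le, one_div_mul_cancel hθ0.ne', Real.rpow_one]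
    _ ≤ (N * B * l ^ (-2:ℝ)) ^ θ := Real.rpow_le_rpow (by positivity) e1 hθ0.le
    _ = _ := by rw [Real.mul_rpow (by positivity) (by positivity), ← Real.rpow_mul hl.le]; congr 2; ring

/-- Stein–Tomas type estimate for a single frequency -/
theorem FT_Lp {n : ℕ} (hn : 2 ≤ n) (p : ℝ) (hp : 2 < p) (hp2 : p < 2 * (n + 1) / (n - 1)) : ∃ C : ℝ, 0 < C ∧
    ∀ φ : ℝ → ℝ, Good φ → ∀ δ : ℝ, 0 < δ → δ ≤ 1 → ∀ t : ℝ, 0 < t → ∀ g : V n → ℂ, Integrable g →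
    ∫⁻ x, ‖FT n φ δ t g x‖ₑ ^ p ≤
      ENNReal.ofReal (C * δ ^ ((n + 1) * (p - 2) / 4) * t ^ (n * (p - 2) / 2)) * NN n δ t g ^ (p / 2) := by
  have hn2 : (2:ℝ) ≤ n := by exact_mod_cast hn
  set θ := ((n:ℝ) + 1) / (n - 1) with hθ
  have hn1 : (0:ℝ) < n - 1 := by linarith
  have hθ1 : 1 < θ := by rw [hθ, one_lt_div hn1]; linarith
  have hpθ : p < 2 * θ := by rw [hθ, ← mul_div_assoc]; exact hp2
  set A := p * (1 / (p - 2) + 1 / (2 * θ - p)) with hA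
  have hA0 : 0 < A := by
    have : 0 < p - 2 := by linarith
    have : 0 < 2 * θ - p := by linarith
    positivity
  set γ := (n + 1) * (p - 2) / 4 with hγ
  refine ⟨A * 400 ^ γ, by positivity, ?_⟩
  intro φ hφ δ hδ hδ1 t ht g hg
  have hi := integrable_mul_fourier (integrable_mt (n := n) hφ hδ hδ1 ht) hg
  have hhc : Continuous (FT n φ δ t g) := continuous_iF hi
  by_cases hNt : NN n δ t g = ⊤
  · rw [hNt, ENNReal.top_rpow_of_pos (by linarith), ENNReal.mul_top]
    · exact le_top
    · rw [Ne, ENNReal.ofReal_eq_zero, not_le]; positivity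
  set N0 := (NN n δ t g).toReal with hN0
  have hN00 : 0 ≤ N0 := ENNReal.toReal_nonneg
  have main : ∀ N : ℝ, N0 < N → ∫⁻ x, ‖FT n φ δ t g x‖ₑ ^ p ≤
      ENNReal.ofReal (A * 400 ^ γ * δ ^ γ * t ^ (n * (p - 2) / 2) * N ^ (p / 2)) := by
    intro N hN
    have hNpos : 0 < N := hN00.trans_lt hN
    have hNN : NN n δ t g ≤ ENNReal.ofReal N := by
      rw [← ENNReal.ofReal_toReal hNt]; exact ENNReal.ofReal_le_ofReal hN.le
    have hB0 : 0 < 400 * δ * t ^ (2 * n / (n + 1) : ℝ) := by positivity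
    have := weak_interp volume (fun x => ‖FT n φ δ t g x‖ₑ) hhc.measurable.enorm N _ θ p hNpos hB0 hθ1 hp hpθ
      (fun l hl => (FT_weak hn hφ hδ hδ1 ht hg N hNpos hNN l hl).1)
      (fun l hl => (FT_weak hn hφ hδ hδ1 ht hg N hNpos hNN l hl).2)
    refine this.trans (ENNReal.ofReal_le_ofReal (le_of_eq ?_))
    rw [← hA]
    have e1 : θ * (p - 2) / (2 * (θ - 1)) = γ := by
      rw [hθ, hγ]
      have : ((n:ℝ) + 1) / (n - 1) - 1 = 2 / (n - 1) := by field_simp; ring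
      rw [this]; field_simp; ring
    rw [e1, Real.mul_rpow (by positivity) (by positivity), Real.mul_rpow (by positivity) (by positivity),
      ← Real.rpow_mul ht.le]
    have e2 : 2 * n / (n + 1) * γ = n * (p - 2) / 2 := by rw [hγ]; field_simp; ring
    rw [e2]; ring
  have hlim : Tendsto (fun N => ENNReal.ofReal (A * 400 ^ γ * δ ^ γ * t ^ (n * (p - 2) / 2) * N ^ (p / 2))) (𝓝[>] N0)
      (𝓝 (ENNReal.ofReal (A * 400 ^ γ * δ ^ γ * t ^ (n * (p - 2) / 2) * N0 ^ (p / 2)))) := by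
    apply Tendsto.mono_left _ nhdsWithin_le_nhds
    apply ENNReal.tendsto_ofReal
    apply Tendsto.const_mul
    exact (Real.continuous_rpow_const (by linarith)).tendsto N0
  have := ge_of_tendsto hlim (eventually_mem_nhdsWithin.mono fun N hN => main N hN)
  refine this.trans (le_of_eq ?_)
  rw [ENNReal.ofReal_mul (by positivity), ← ENNReal.ofReal_rpow_of_nonneg hN00 (by linarith), hN0,
    ENNReal.ofReal_toReal hNt]

end SqFn

namespace SqFn

/-- the single-scale square function (squared) -/
noncomputable def sT (n : ℕ) (φ : ℝ → ℝ) (δ T : ℝ) (f : V n → ℂ) (x : V n) : ℝ≥0∞ :=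
  ∫⁻ t in Set.Ioc T (2 * T), ‖FT n φ δ t f x‖ₑ ^ 2 * ENNReal.ofReal t⁻¹

theorem lint_inv {T : ℝ} (hT : 0 < T) : ∫⁻ t in Set.Ioc T (2 * T), ENNReal.ofReal t⁻¹ ≤ 1 := by
  calc ∫⁻ t in Set.Ioc T (2 * T), ENNReal.ofReal t⁻¹ ≤ ∫⁻ t in Set.Ioc T (2 * T), ENNReal.ofReal T⁻¹ := by
        refine setLIntegral_mono' measurableSet_Ioc fun t ht => ENNReal.ofReal_le_ofReal ?_
        exact inv_anti₀ hT ht.1.le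
    _ = 1 := by
        rw [setLIntegral_const, Real.volume_Ioc, ← ENNReal.ofReal_mul (by positivity), ← ENNReal.ofReal_one]
        congr 1; field_simp; ring

theorem bdd_FT {n : ℕ} {φ : ℝ → ℝ} (hφ : Good φ) : ∃ C : ℝ, 0 < C ∧ ∀ δ : ℝ, 0 < δ → δ ≤ 1 →
    ∀ t : ℝ, 0 < t → ∀ f : V n → ℂ, Integrable f → ∀ x, ‖FT n φ δ t f x‖ₑ ≤ ENNReal.ofReal (C * t ^ n) * ∫⁻ y, ‖f y‖ₑ := by
  obtain ⟨C, hC, h⟩ := kernel_decay (n := n) hφ 0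
  refine ⟨C, hC, fun δ hδ hδ1 t ht f hf x => ?_⟩
  rw [FT_conv hφ hδ hδ1 ht hf]
  refine (enorm_integral_le_lintegral_enorm _).trans ?_
  rw [← lintegral_const_mul'' _ hf.1.enorm]
  refine lintegral_mono fun y => ?_
  rw [enorm_mul]
  refine mul_le_mul_left ?_ _
  rw [← ofReal_norm]
  have := h δ hδ hδ1 t ht (x - y)
  rw [pow_zero, div_one] at this
  exact ENNReal.ofReal_le_ofReal this

theorem measurable_sT {n : ℕ} {φ : ℝ → ℝ} (hφ : Good φ) (δ T : ℝ) {g : V n → ℂ} (hg : Integrable g) :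
    Measurable (sT n φ δ T g) := measurable_tint hφ δ hg _

theorem bdd_s {n : ℕ} {φ : ℝ → ℝ} (hφ : Good φ) {δ T : ℝ} (hδ : 0 < δ) (hδ1 : δ ≤ 1) (hT : 0 < T)
    {f : V n → ℂ} (hf : Integrable f) : ∃ D : ℝ≥0∞, D ≠ ⊤ ∧ ∀ x, sT n φ δ T f x ≤ D := by
  obtain ⟨C, hC, h⟩ := bdd_FT (n := n) hφ
  refine ⟨(ENNReal.ofReal (C * (2 * T) ^ n) * ∫⁻ y, ‖f y‖ₑ) ^ 2, ?_, fun x => ?_⟩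
  · have := hf.2.ne
    exact ENNReal.pow_ne_top (ENNReal.mul_ne_top ENNReal.ofReal_ne_top this)
  · unfold sT
    calc _ ≤ ∫⁻ t in Set.Ioc T (2 * T), (ENNReal.ofReal (C * (2 * T) ^ n) * ∫⁻ y, ‖f y‖ₑ) ^ 2 * ENNReal.ofReal t⁻¹ := by
          refine setLIntegral_mono' measurableSet_Ioc fun t ht => mul_le_mul_left (pow_le_pow_left' ?_ 2) _
          have ht0 : 0 < t := hT.trans ht.1
          refine (h δ hδ hδ1 t ht0 f hf x).trans (mul_le_mul_left (ENNReal.ofReal_le_ofReal ?_) _)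
          have := ht.2
          gcongr
      _ ≤ _ := by
          rw [lintegral_const_mul _ (by fun_prop)]
          calc _ ≤ _ * 1 := mul_le_mul' le_rfl (lint_inv hT)
            _ = _ := mul_one _

theorem int_s {n : ℕ} {φ : ℝ → ℝ} (hφ : Good φ) {δ T : ℝ} (hδ : 0 < δ) (hδ1 : δ ≤ 1) (hT : 0 < T)
    {f : V n → ℂ} (hf : Integrable f) (hf2 : ∫⁻ x, ‖f x‖ₑ ^ 2 ≠ ⊤) : ∫⁻ x, sT n φ δ T f x ≠ ⊤ := by
  refine ne_top_of_le_ne_top ?_ ((lintegral_mono fun x => ?_).trans (FT_L2_t hφ hδ hδ1 hf))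
  · exact ENNReal.mul_ne_top ENNReal.ofReal_ne_top hf2
  · exact lintegral_mono_set fun t ht => hT.trans ht.1

theorem fin_pow {X : Type*} [MeasurableSpace X] (μ : Measure X) (s : X → ℝ≥0∞) (hs : Measurable s)
    (D : ℝ≥0∞) (hD : D ≠ ⊤) (h : ∀ x, s x ≤ D) (hi : ∫⁻ x, s x ∂μ ≠ ⊤) (q : ℝ) (hq : 1 ≤ q) :
    ∫⁻ x, s x ^ q ∂μ ≠ ⊤ := by
  refine ne_top_of_le_ne_top (b := D ^ (q - 1) * ∫⁻ x, s x ∂μ) ?_ ?_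
  · exact ENNReal.mul_ne_top (ENNReal.rpow_ne_top_of_nonneg (by linarith) hD) hi
  · rw [← lintegral_const_mul _ hs]
    refine lintegral_mono fun x => ?_
    calc s x ^ q = s x ^ ((q - 1) + 1) := by ring_nf
      _ = s x ^ (q - 1) * s x := by rw [ENNReal.rpow_add_of_nonneg _ _ (by linarith) (by norm_num), ENNReal.rpow_one]
      _ ≤ _ := mul_le_mul_left (ENNReal.rpow_le_rpow (h x) (by linarith)) _

theorem loc {n : ℕ} (hn : 2 ≤ n) (p : ℝ) (hp : 2 < p) (hp2 : p < 2 * (n + 1) / (n - 1)) : ∃ C : ℝ, 0 < C ∧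
    ∀ φ : ℝ → ℝ, Good φ → ∀ δ : ℝ, 0 < δ → δ ≤ 1 → ∀ T : ℝ, 0 < T → ∀ g : V n → ℂ, Integrable g →
    ∫⁻ x, ‖g x‖ₑ ^ 2 ≠ ⊤ →
    ∫⁻ x, sT n φ δ T g x ^ (p / 2) ≤
      ENNReal.ofReal (C * δ ^ ((n + 1) * (p - 2) / 4 + p / 2) * T ^ (n * (p - 2) / 2)) * (∫⁻ x, ‖g x‖ₑ ^ 2) ^ (p / 2) := by
  obtain ⟨C, hC, h⟩ := FT_Lp hn p hp hp2
  refine ⟨C * 2 ^ (n * (p - 2) / 2) * 2 ^ (p / 2), by positivity, ?_⟩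
  intro φ hφ δ hδ hδ1 T hT g hg hg2
  have hq : 1 < p / 2 := by linarith
  have hq0 : 0 < p / 2 := by linarith
  obtain ⟨D, hD, hDs⟩ := bdd_s hφ hδ hδ1 hT hg
  have hfin := fin_pow volume _ (measurable_sT hφ δ T hg) D hD hDs (int_s hφ hδ hδ1 hT hg hg2) (p / 2) hq.le
  have hmF := measurable_FT hφ δ hg
  have hH : Measurable (Function.uncurry fun (t : ℝ) (x : V n) => ‖FT n φ δ t g x‖ₑ ^ 2 * ENNReal.ofReal t⁻¹) :=
    (hmF.pow_const 2).mul (measurable_fst.inv.ennreal_ofReal)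
  set B := C * δ ^ ((n + 1) * (p - 2) / 4) * (2 * T) ^ (n * (p - 2) / 2) with hB
  have hB0 : 0 < B := by positivity
  refine (minkowski volume (volume.restrict (Set.Ioc T (2 * T))) _ hH (p / 2) hq hfin).trans ?_
  have key : ∫⁻ t in Set.Ioc T (2 * T), (∫⁻ x, (‖FT n φ δ t g x‖ₑ ^ 2 * ENNReal.ofReal t⁻¹) ^ (p / 2)) ^ (1 / (p / 2)) ≤
      ENNReal.ofReal B ^ (1 / (p / 2)) * (ENNReal.ofReal (2 * δ) * ∫⁻ x, ‖g x‖ₑ ^ 2) := by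
    calc _ ≤ ∫⁻ t in Set.Ioc T (2 * T), ENNReal.ofReal B ^ (1 / (p / 2)) * (NN n δ t g * ENNReal.ofReal t⁻¹) := by
          refine setLIntegral_mono' measurableSet_Ioc fun t ht => ?_
          have ht0 : 0 < t := hT.trans ht.1
          have e1 : ∀ x, (‖FT n φ δ t g x‖ₑ ^ 2 * ENNReal.ofReal t⁻¹) ^ (p / 2) =
              ‖FT n φ δ t g x‖ₑ ^ p * ENNReal.ofReal t⁻¹ ^ (p / 2) := by
            intro x
            rw [ENNReal.mul_rpow_of_nonneg _ _ hq0.le, ← ENNReal.rpow_natCast, ← ENNReal.rpow_mul]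
            congr 2; push_cast; ring
          have hm1 : Measurable fun x => ‖FT n φ δ t g x‖ₑ ^ p :=
            (hmF.comp measurable_prodMk_left).pow_const p
          simp_rw [e1]
          rw [lintegral_mul_const _ hm1, ENNReal.mul_rpow_of_nonneg _ _ (by positivity), ← ENNReal.rpow_mul,
            mul_one_div_cancel hq0.ne', ENNReal.rpow_one, ← mul_assoc]
          refine mul_le_mul_left ?_ _
          have : NN n δ t g = (NN n δ t g ^ (p / 2)) ^ (1 / (p / 2)) := by
            rw [← ENNReal.rpow_mul, mul_one_div_cancel hq0.ne', ENNReal.rpow_one]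
          rw [this, ← ENNReal.mul_rpow_of_nonneg _ _ (by positivity)]
          refine ENNReal.rpow_le_rpow ?_ (by positivity)
          refine (h φ hφ δ hδ hδ1 t ht0 g hg).trans (mul_le_mul_left (ENNReal.ofReal_le_ofReal ?_) _)
          have h2 := ht.2
          have h3 : 0 ≤ n * (p - 2) / 2 := by
            have : 0 < p - 2 := by linarith
            positivity
          rw [hB]; gcongr
      _ = ENNReal.ofReal B ^ (1 / (p / 2)) * ∫⁻ t in Set.Ioc T (2 * T), (NN n δ t g * ENNReal.ofReal t⁻¹) := by
          rw [lintegral_const_mul]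
          exact (measurable_NN δ hg).mul (measurable_id.inv.ennreal_ofReal)
      _ ≤ _ := by
          refine mul_le_mul' le_rfl ((lintegral_mono_set fun t ht => ?_).trans (NN_t hδ hδ1 hg))
          exact hT.trans ht.1
  refine (ENNReal.rpow_le_rpow key hq0.le).trans (le_of_eq ?_)
  rw [ENNReal.mul_rpow_of_nonneg _ _ hq0.le, ← ENNReal.rpow_mul, one_div_mul_cancel hq0.ne', ENNReal.rpow_one,
    ENNReal.mul_rpow_of_nonneg _ _ hq0.le, ENNReal.ofReal_rpow_of_nonneg (by positivity) hq0.le, ← mul_assoc,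
    ← ENNReal.ofReal_mul hB0.le]
  congr 2
  rw [hB, Real.mul_rpow (by norm_num) hT.le, Real.mul_rpow (by norm_num) hδ.le, Real.rpow_add hδ]
  ring

end SqFn

namespace SqFn

theorem holder_ball {X : Type*} [MeasurableSpace X] (μ : Measure X) (u : X → ℝ≥0∞) (hu : AEMeasurable u μ) (q : ℝ) (hq : 1 < q) :
    (∫⁻ x, u x ∂μ) ^ q ≤ μ Set.univ ^ (q - 1) * ∫⁻ x, u x ^ q ∂μ := by
  have h := holder_q μ u (fun _ => 1) hu aemeasurable_const q hq
  simp only [ENNReal.one_rpow, mul_one, lintegral_one] at h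
  refine (ENNReal.rpow_le_rpow h (by linarith)).trans (le_of_eq ?_)
  have hq0 : q ≠ 0 := by linarith
  rw [ENNReal.mul_rpow_of_nonneg _ _ (by linarith), ← ENNReal.rpow_mul, ← ENNReal.rpow_mul, one_div_mul_cancel hq0,
    ENNReal.rpow_one, mul_comm]
  congr 2; field_simp

/-- pointwise splitting at a single scale -/
theorem s_split {n : ℕ} {φ : ℝ → ℝ} (hφ : Good φ) (M : ℕ) (hM : n + 1 ≤ M) : ∃ C : ℝ, 0 < C ∧
    ∀ δ : ℝ, 0 < δ → δ ≤ 1 → ∀ T : ℝ, 0 < T → ∀ R : ℝ, 0 < R → ∀ z x : V n, x ∈ Metric.ball z R⁻¹ →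
    ∀ f : V n → ℂ, Integrable f → Measurable f →
    sT n φ δ T f x ≤ 2 * sT n φ δ T ((Metric.ball z (2 * R⁻¹)).indicator f) x +
      2 * (ENNReal.ofReal (C * (T / R) ^ n / (δ * (T / R)) ^ M) * cv n R (fun y => ‖f y‖ₑ) x) ^ 2 := by
  obtain ⟨C, hC, h⟩ := FT_split (n := n) hφ 0 M (by omega)
  refine ⟨C, hC, fun δ hδ hδ1 T hT R hR z x hx f hf hfm => ?_⟩
  set A := (ENNReal.ofReal (C * (T / R) ^ n / (δ * (T / R)) ^ M) * cv n R (fun y => ‖f y‖ₑ) x) with hA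
  set fz := (Metric.ball z (2 * R⁻¹)).indicator f with hfz
  have hfzi : Integrable fz := hf.indicator measurableSet_ball
  have hmt := measurable_FT_t hφ δ hfzi x
  unfold sT
  calc _ ≤ ∫⁻ t in Set.Ioc T (2 * T), (2 * (‖FT n φ δ t fz x‖ₑ ^ 2 * ENNReal.ofReal t⁻¹) + 2 * A ^ 2 * ENNReal.ofReal t⁻¹) := by
        refine setLIntegral_mono' measurableSet_Ioc fun t ht => ?_
        have ht0 : 0 < t := hT.trans ht.1
        have h1 := h δ hδ hδ1 t ht0 R hR z x hx f hf hfm (fun _ => 1) measurable_const (by simp)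
        simp only [one_mul] at h1
        have h2 : ‖FT n φ δ t f x‖ₑ ≤ ‖FT n φ δ t fz x‖ₑ + A := by
          refine h1.trans (add_le_add le_rfl (mul_le_mul_left (ENNReal.ofReal_le_ofReal ?_) _))
          obtain ⟨k, rfl⟩ : ∃ k, M = n + k := ⟨M - n, by omega⟩
          have e : ∀ u : ℝ, 0 < u → C * u ^ n / (δ * u) ^ (n + k) = C / (δ ^ (n + k) * u ^ k) := by
            intro u hu; rw [mul_pow]; field_simp; ring
          rw [e _ (by positivity), e _ (by positivity)]
          have := ht.1.le
          gcongr
        calc _ ≤ (‖FT n φ δ t fz x‖ₑ + A) ^ 2 * ENNReal.ofReal t⁻¹ := mul_le_mul_left (pow_le_pow_left' h2 2) _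
          _ ≤ (2 * ‖FT n φ δ t fz x‖ₑ ^ 2 + 2 * A ^ 2) * ENNReal.ofReal t⁻¹ := mul_le_mul_left (enn_sq_add _ _) _
          _ = _ := by ring
    _ = 2 * (∫⁻ t in Set.Ioc T (2 * T), ‖FT n φ δ t fz x‖ₑ ^ 2 * ENNReal.ofReal t⁻¹) +
        2 * A ^ 2 * ∫⁻ t in Set.Ioc T (2 * T), ENNReal.ofReal t⁻¹ := by
        have m1 : Measurable fun t : ℝ => ENNReal.ofReal t⁻¹ := measurable_id.inv.ennreal_ofReal
        have m2 : Measurable fun t => ‖FT n φ δ t fz x‖ₑ ^ 2 * ENNReal.ofReal t⁻¹ := (hmt.pow_const 2).fun_mul m1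
        rw [lintegral_add_left (m2.const_mul 2), lintegral_const_mul _ m2, lintegral_const_mul _ m1]
    _ ≤ _ := by
        refine add_le_add le_rfl ?_
        calc _ ≤ 2 * A ^ 2 * 1 := mul_le_mul' le_rfl (lint_inv hT)
          _ = _ := mul_one _

theorem rpow_split (a b : ℝ≥0∞) (q : ℝ) (hq : 1 ≤ q) :
    (2 * a + 2 * b ^ 2) ^ q ≤ 4 ^ q * (a ^ q + b ^ (2 * q)) := by
  calc _ ≤ (2:ℝ≥0∞) ^ (q - 1) * ((2 * a) ^ q + (2 * b ^ 2) ^ q) := ENNReal.rpow_add_le_mul_rpow_add_rpow _ _ hq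
    _ = (2:ℝ≥0∞) ^ (q - 1) * 2 ^ q * (a ^ q + b ^ (2 * q)) := by
        rw [ENNReal.mul_rpow_of_nonneg _ _ (by linarith), ENNReal.mul_rpow_of_nonneg _ _ (by linarith),
          ENNReal.rpow_mul]
        norm_num; ring
    _ ≤ _ := by
        refine mul_le_mul_left ?_ _
        calc (2:ℝ≥0∞) ^ (q - 1) * 2 ^ q ≤ 2 ^ q * 2 ^ q := by
              refine mul_le_mul_left (ENNReal.rpow_le_rpow_of_exponent_le (by norm_num) (by linarith)) _
          _ = 4 ^ q := by
              rw [← ENNReal.mul_rpow_of_nonneg _ _ (by linarith)]; norm_num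

theorem s_local {n : ℕ} (hn : 2 ≤ n) {φ : ℝ → ℝ} (hφ : Good φ) (p : ℝ) (hp : 2 < p) (hp2 : p < 2 * (n + 1) / (n - 1))
    (M : ℕ) (hM : n + 1 ≤ M) : ∃ C : ℝ, 0 < C ∧
    ∀ δ : ℝ, 0 < δ → δ ≤ 1 → ∀ T : ℝ, 0 < T → ∀ R : ℝ, 0 < R →
    ∀ f : V n → ℂ, Integrable f → Measurable f → ∫⁻ x, ‖f x‖ₑ ^ 2 ≠ ⊤ →
    ∫⁻ x, sT n φ δ T f x ^ (p / 2) ≤ ENNReal.ofReal (C * (δ ^ ((n + 1) * (p - 2) / 4 + p / 2) * (T / R) ^ (n * (p - 2) / 2) +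
      ((T / R) ^ n / (δ * (T / R)) ^ M) ^ p)) * ∫⁻ x, ‖f x‖ₑ ^ p := by
  obtain ⟨C1, hC1, h1⟩ := loc hn p hp hp2
  obtain ⟨C2, hC2, h2⟩ := s_split (n := n) hφ M hM
  obtain ⟨C3, hC3, h3⟩ := cv_Lp n p (by linarith)
  set b := (vb n).toReal with hb
  have hb0 : 0 < b := ENNReal.toReal_pos (vb_pos n).ne' (vb_ne_top n)
  have hbv : vb n = ENNReal.ofReal b := (ENNReal.ofReal_toReal (vb_ne_top n)).symm
  set Ca := 4 ^ (p / 2) * (C1 * (2 ^ n) ^ (p / 2) * b ^ (p / 2 - 1)) with hCa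
  set Cb := 4 ^ (p / 2) * (C2 ^ p * C3) with hCb
  have hCa0 : 0 < Ca := by positivity
  have hCb0 : 0 < Cb := by positivity
  refine ⟨Ca + Cb, by positivity, ?_⟩
  intro δ hδ hδ1 T hT R hR f hf hfm hf2
  have hq : 1 < p / 2 := by linarith
  set K := C1 * δ ^ ((n + 1) * (p - 2) / 4 + p / 2) * T ^ (n * (p - 2) / 2) with hK
  have hK0 : 0 < K := by positivity
  set τ := C2 * (T / R) ^ n / (δ * (T / R)) ^ M with hτ
  have hτ0 : 0 < τ := by positivity
  set v := R⁻¹ ^ n * b with hv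
  have hv0 : 0 < v := by positivity
  set S := ∫⁻ x, sT n φ δ T f x ^ (p / 2) with hS
  set F := ∫⁻ x, ‖f x‖ₑ ^ p with hF
  have hcvm : Measurable (cv n R (fun y => ‖f y‖ₑ)) := measurable_cv R _ hfm.enorm
  have hsm := (measurable_sT hφ δ T hf).pow_const (p / 2)
  -- per ball
  have hball : ∀ z : V n, ∫⁻ x in Metric.ball z R⁻¹, sT n φ δ T f x ^ (p / 2) ≤
      4 ^ (p / 2) * (ENNReal.ofReal K * (ENNReal.ofReal (2 ^ n * v) ^ (p / 2 - 1) * ∫⁻ x in Metric.ball z (2 * R⁻¹), ‖f x‖ₑ ^ p) +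
        ENNReal.ofReal (τ ^ p) * ∫⁻ x in Metric.ball z R⁻¹, cv n R (fun y => ‖f y‖ₑ) x ^ p) := by
    intro z
    set fz := (Metric.ball z (2 * R⁻¹)).indicator f with hfz
    have hfzi : Integrable fz := hf.indicator measurableSet_ball
    have hfz2 : ∫⁻ x, ‖fz x‖ₑ ^ 2 = ∫⁻ x in Metric.ball z (2 * R⁻¹), ‖f x‖ₑ ^ 2 := by
      rw [← lintegral_indicator measurableSet_ball]
      refine lintegral_congr fun x => ?_
      by_cases hx : x ∈ Metric.ball z (2 * R⁻¹) <;> simp [hfz, hx]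
    have hfz2t : ∫⁻ x, ‖fz x‖ₑ ^ 2 ≠ ⊤ := by
      rw [hfz2]; exact ne_top_of_le_ne_top hf2 (setLIntegral_le_lintegral _ _)
    have hszm := (measurable_sT hφ δ T hfzi).pow_const (p / 2)
    calc _ ≤ ∫⁻ x in Metric.ball z R⁻¹, 4 ^ (p / 2) * (sT n φ δ T fz x ^ (p / 2) +
              ENNReal.ofReal (τ ^ p) * cv n R (fun y => ‖f y‖ₑ) x ^ p) := by
          refine setLIntegral_mono' measurableSet_ball fun x hx => ?_
          refine (ENNReal.rpow_le_rpow (h2 δ hδ hδ1 T hT R hR z x hx f hf hfm) (by linarith)).trans ?_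
          refine (rpow_split _ _ _ hq.le).trans (le_of_eq ?_)
          rw [show 2 * (p / 2) = p by ring, ENNReal.mul_rpow_of_nonneg _ _ (by linarith),
            ENNReal.ofReal_rpow_of_nonneg hτ0.le (by linarith)]
      _ = 4 ^ (p / 2) * ((∫⁻ x in Metric.ball z R⁻¹, sT n φ δ T fz x ^ (p / 2)) +
            ENNReal.ofReal (τ ^ p) * ∫⁻ x in Metric.ball z R⁻¹, cv n R (fun y => ‖f y‖ₑ) x ^ p) := by
          have m1 := hcvm.pow_const p
          rw [lintegral_const_mul _ (hszm.fun_add (m1.const_mul _)), lintegral_add_left hszm, lintegral_const_mul _ m1]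
      _ ≤ _ := by
          refine mul_le_mul' le_rfl (add_le_add ?_ le_rfl)
          refine (setLIntegral_le_lintegral _ _).trans ?_
          refine (h1 φ hφ δ hδ hδ1 T hT fz hfzi hfz2t).trans ?_
          refine mul_le_mul' le_rfl ?_
          rw [hfz2]
          refine (holder_ball _ _ (hfm.enorm.pow_const 2).aemeasurable _ hq).trans (le_of_eq ?_)
          rw [Measure.restrict_apply_univ, vol_ball z (by positivity : 0 < 2 * R⁻¹), hbv,
            ← ENNReal.ofReal_mul (by positivity)]
          congr 2
          · rw [hv, mul_pow]; ring_nf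
          · ext x
            rw [← ENNReal.rpow_natCast, ← ENNReal.rpow_mul]; congr 1; push_cast; ring
  have hfpm : Measurable fun x => ‖f x‖ₑ ^ p := hfm.enorm.pow_const p
  have key : ENNReal.ofReal v * S ≤ ENNReal.ofReal v * (ENNReal.ofReal (Ca * (δ ^ ((n + 1) * (p - 2) / 4 + p / 2) * (T / R) ^ (n * (p - 2) / 2)) +
      Cb * ((T / R) ^ n / (δ * (T / R)) ^ M) ^ p) * F) := by
    calc ENNReal.ofReal v * S = ∫⁻ z, ∫⁻ x in Metric.ball z R⁻¹, sT n φ δ T f x ^ (p / 2) := by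
          rw [avg _ hsm (by positivity), hbv, ← ENNReal.ofReal_mul (by positivity)]
      _ ≤ ∫⁻ z : V n, 4 ^ (p / 2) * (ENNReal.ofReal K * (ENNReal.ofReal (2 ^ n * v) ^ (p / 2 - 1) * ∫⁻ x in Metric.ball z (2 * R⁻¹), ‖f x‖ₑ ^ p) +
        ENNReal.ofReal (τ ^ p) * ∫⁻ x in Metric.ball z R⁻¹, cv n R (fun y => ‖f y‖ₑ) x ^ p) := lintegral_mono hball
      _ = 4 ^ (p / 2) * (ENNReal.ofReal K * (ENNReal.ofReal (2 ^ n * v) ^ (p / 2 - 1) * (ENNReal.ofReal (2 ^ n * v) * F)) +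
        ENNReal.ofReal (τ ^ p) * (ENNReal.ofReal v * ∫⁻ x, cv n R (fun y => ‖f y‖ₑ) x ^ p)) := by
          have m1 := measurable_ball_int _ hfpm (2 * R⁻¹)
          have m2 := measurable_ball_int _ (hcvm.pow_const p) R⁻¹
          rw [lintegral_const_mul _ (((m1.const_mul _).const_mul _).fun_add (m2.const_mul _)),
            lintegral_add_left ((m1.const_mul _).const_mul _), lintegral_const_mul _ (m1.const_mul _), lintegral_const_mul _ m1,
            lintegral_const_mul _ m2, avg _ hfpm (by positivity), avg _ (hcvm.pow_const p) (by positivity), hbv,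
            ← ENNReal.ofReal_mul (by positivity), ← ENNReal.ofReal_mul (by positivity), mul_pow, mul_assoc]
      _ ≤ 4 ^ (p / 2) * (ENNReal.ofReal K * (ENNReal.ofReal (2 ^ n * v) ^ (p / 2 - 1) * (ENNReal.ofReal (2 ^ n * v) * F)) +
        ENNReal.ofReal (τ ^ p) * (ENNReal.ofReal v * (ENNReal.ofReal C3 * F))) := by
          refine mul_le_mul' le_rfl (add_le_add le_rfl (mul_le_mul' le_rfl (mul_le_mul' le_rfl ?_)))
          exact h3 R hR _ hfm.enorm
      _ = ENNReal.ofReal (4 ^ (p / 2) * (K * ((2 ^ n * v) ^ (p / 2 - 1) * (2 ^ n * v)) + τ ^ p * (v * C3))) * F := by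
          have e4 : (4:ℝ≥0∞) ^ (p / 2) = ENNReal.ofReal (4 ^ (p / 2)) := by
            rw [← ENNReal.ofReal_rpow_of_nonneg (by norm_num) (by linarith)]; norm_num
          rw [e4, ENNReal.ofReal_mul (p := 4 ^ (p / 2)) (by positivity), ENNReal.ofReal_add (by positivity) (by positivity),
            ENNReal.ofReal_mul (p := K) (by positivity), ENNReal.ofReal_mul (p := (2 ^ n * v) ^ (p / 2 - 1)) (by positivity),
            ENNReal.ofReal_mul (p := τ ^ p) (by positivity), ENNReal.ofReal_mul (p := v) (by positivity),
            ENNReal.ofReal_rpow_of_nonneg (p := p / 2 - 1) (by positivity) (by linarith)]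
          ring
      _ = _ := by
          rw [← mul_assoc (ENNReal.ofReal v), ← ENNReal.ofReal_mul hv0.le]
          congr 2
          have e1 : (2 ^ n * v) ^ (p / 2 - 1) * (2 ^ n * v) = (2 ^ n) ^ (p / 2) * (v ^ (p / 2 - 1) * v) := by
            rw [Real.mul_rpow (by positivity) hv0.le]
            have : ((2:ℝ) ^ n) ^ (p / 2) = (2 ^ n) ^ (p / 2 - 1) * 2 ^ n := by
              rw [← Real.rpow_add_one (by positivity)]; ring_nf
            rw [this]; ring
          have e2 : v ^ (p / 2 - 1) = R⁻¹ ^ (n * (p - 2) / 2) * b ^ (p / 2 - 1) := by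
            rw [hv, Real.mul_rpow (by positivity) hb0.le, ← Real.rpow_natCast, ← Real.rpow_mul (by positivity)]
            congr 2; ring
          have e3 : (T / R) ^ (n * (p - 2) / 2) = T ^ (n * (p - 2) / 2) * R⁻¹ ^ (n * (p - 2) / 2) := by
            rw [div_eq_mul_inv, Real.mul_rpow hT.le (by positivity)]
          have e4 : τ ^ p = C2 ^ p * ((T / R) ^ n / (δ * (T / R)) ^ M) ^ p := by
            rw [hτ, mul_div_assoc, Real.mul_rpow hC2.le (by positivity)]
          rw [e1, e2, e3, e4, hK, hCa, hCb]; ring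
  rw [ENNReal.mul_le_mul_iff_right (ENNReal.ofReal_pos.2 hv0).ne' ENNReal.ofReal_ne_top] at key
  refine key.trans (mul_le_mul_left (ENNReal.ofReal_le_ofReal ?_) _)
  have a1 : 0 ≤ δ ^ ((n + 1) * (p - 2) / 4 + p / 2) * (T / R) ^ (n * (p - 2) / 2) := by positivity
  have a2 : 0 ≤ ((T / R) ^ n / (δ * (T / R)) ^ M) ^ p := by positivity
  nlinarith [mul_nonneg hCa0.le a2, mul_nonneg hCb0.le a1]

theorem single {n : ℕ} (hn : 2 ≤ n) {φ : ℝ → ℝ} (hφ : Good φ) (p : ℝ) (hp : 2 < p) (hp2 : p < 2 * (n + 1) / (n - 1)) :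
    ∃ e : ℝ, p / (n + 1) < e ∧ ∃ C : ℝ, 0 < C ∧
    ∀ δ : ℝ, 0 < δ → δ ≤ 1 → ∀ T : ℝ, 0 < T →
    ∀ f : V n → ℂ, Integrable f → Measurable f → ∫⁻ x, ‖f x‖ₑ ^ 2 ≠ ⊤ →
    ∫⁻ x, sT n φ δ T f x ^ (p / 2) ≤ ENNReal.ofReal (C * δ ^ e) * ∫⁻ x, ‖f x‖ₑ ^ p := by
  have hn2 : (2:ℝ) ≤ n := by exact_mod_cast hn
  have hn1 : (0:ℝ) < n - 1 := by linarith
  rw [lt_div_iff₀ hn1] at hp2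
  set γ := p / 2 - (p - 2) * (n - 1) / 4 - p / (n + 1) with hγ
  have hγ0 : 0 < γ := by
    have : γ = (n - 1) * (2 * (n + 1) - p * (n - 1)) / (4 * (n + 1)) := by
      rw [hγ]; field_simp; ring
    rw [this]
    have : 0 < 2 * ((n:ℝ) + 1) - p * (n - 1) := by linarith
    positivity
  have hp20 : 0 < p - 2 := by linarith
  set ε := γ / (n * (p - 2)) with hε
  have hε0 : 0 < ε := by positivity
  obtain ⟨M, hM⟩ := exists_nat_ge (((1 + ε) * n + 1) / ε + n + 1)
  have hM1 : n + 1 ≤ M := by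
    have : (0:ℝ) ≤ ((1 + ε) * n + 1) / ε := by positivity
    have : ((n + 1 : ℕ) : ℝ) ≤ M := by push_cast; linarith
    exact_mod_cast this
  have hM2 : (1 + ε) * n + 1 ≤ ε * M := by
    have : ((1 + ε) * n + 1) / ε ≤ M := by linarith
    rw [div_le_iff₀ hε0] at this; linarith
  obtain ⟨C, hC, h⟩ := s_local hn hφ p hp (by rwa [lt_div_iff₀ hn1]) M hM1
  set e := p / (n + 1) + γ / 2 with he
  refine ⟨e, by linarith, C * 2, by positivity, ?_⟩
  intro δ hδ hδ1 T hT f hf hfm hf2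
  set R := T * δ ^ (1 + ε) with hR
  have hR0 : 0 < R := by positivity
  have hTR : T / R = δ ^ (-(1 + ε)) := by
    rw [hR, Real.rpow_neg hδ.le]; field_simp
  refine (h δ hδ hδ1 T hT R hR0 f hf hfm hf2).trans (mul_le_mul_left (ENNReal.ofReal_le_ofReal ?_) _)
  rw [mul_assoc]
  refine mul_le_mul_of_nonneg_left ?_ hC.le
  have t1 : δ ^ ((n + 1) * (p - 2) / 4 + p / 2) * (T / R) ^ (n * (p - 2) / 2) = δ ^ e := by
    rw [hTR, ← Real.rpow_mul hδ.le, ← Real.rpow_add hδ]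
    congr 1
    have : ε * (n * (p - 2)) = γ := by rw [hε]; field_simp
    have h2 : p / (n + 1) = p / 2 - (p - 2) * (n - 1) / 4 - γ := by rw [hγ]; ring
    rw [he, h2]; linear_combination (-1/2) * this
  have t2 : ((T / R) ^ n / (δ * (T / R)) ^ M) ^ p ≤ δ ^ e := by
    have : (T / R) ^ n / (δ * (T / R)) ^ M = δ ^ (ε * M - (1 + ε) * n) := by
      rw [hTR, ← Real.rpow_one_add' hδ.le (by linarith), ← Real.rpow_natCast, ← Real.rpow_natCast, ← Real.rpow_mul hδ.le,
        ← Real.rpow_mul hδ.le, ← Real.rpow_sub hδ]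
      congr 1; ring
    rw [this, ← Real.rpow_mul hδ.le]
    refine Real.rpow_le_rpow_of_exponent_ge hδ hδ1 ?_
    have h3 : e ≤ p := by
      have : 0 ≤ (p - 2) * (n - 1) / 4 := by positivity
      have : 0 ≤ p / (n + 1) := by positivity
      rw [he]; linarith
    nlinarith
  linarith

end SqFn

namespace SqFn

theorem kap_mass (n : ℕ) : ∃ C : ℝ, 0 < C ∧ ∀ R : ℝ, 0 < R → ∀ x : V n, ∫⁻ y, kap n R (x - y) ≤ ENNReal.ofReal C := by
  set b := (vb n).toReal with hb
  have hb0 : 0 < b := ENNReal.toReal_pos (vb_pos n).ne' (vb_ne_top n)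
  have hbv : vb n = ENNReal.ofReal b := (ENNReal.ofReal_toReal (vb_ne_top n)).symm
  refine ⟨2 ^ (2 * n + 2) * b, by positivity, fun R hR x => ?_⟩
  have h := cv_le_Mx R hR (fun _ : V n => 1) measurable_const x
  have h2 := Mx_add_le (fun _ : V n => 0) measurable_const 1 x
  have h3 : Mx n (fun _ : V n => 0) x = 0 := by simp [Mx]
  rw [h3] at h2
  simp only [zero_add, one_mul] at h2
  simp only [cv, mul_one] at h
  refine h.trans ?_
  rw [ENNReal.ofReal_mul (by positivity), ← hbv]
  exact mul_le_mul' le_rfl h2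

theorem kap_neg (n : ℕ) (R : ℝ) (x : V n) : kap n R (-x) = kap n R x := by simp [kap]

theorem exists_bump (n : ℕ) : ∃ ψ : SchwartzMap (V n) ℂ, (∀ ξ, ‖ψ ξ‖ ≤ 1) ∧
    (∀ ξ, 1 / 2 ≤ ‖ξ‖ ^ 2 → ‖ξ‖ ^ 2 ≤ 6 → ψ ξ = 1) ∧ (∀ ξ, ψ ξ ≠ 0 → 1 / 4 ≤ ‖ξ‖ ^ 2 ∧ ‖ξ‖ ^ 2 ≤ 25 / 4) := by
  let θ : ContDiffBump (13 / 4 : ℝ) := ⟨11 / 4, 3, by norm_num, by norm_num⟩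
  have hsupp : ∀ s : ℝ, θ s ≠ 0 → 1 / 4 < s ∧ s < 25 / 4 := by
    intro s hs
    have : s ∈ Function.support θ := hs
    rw [θ.support_eq, Real.ball_eq_Ioo] at this
    simp only [θ, Set.mem_Ioo] at this
    constructor <;> linarith [this.1, this.2]
  set m : V n → ℂ := fun ξ => (θ (‖ξ‖ ^ 2) : ℂ) with hm
  have hsm : ContDiff ℝ (⊤ : ℕ∞) m := by
    have h1 : ContDiff ℝ (⊤ : ℕ∞) (fun ξ : V n => ‖ξ‖ ^ 2) := contDiff_norm_sq ℝ
    exact (Complex.ofRealCLM.contDiff).comp (θ.contDiff.comp h1)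
  have hcs : HasCompactSupport m := by
    refine HasCompactSupport.intro (isCompact_closedBall (0 : V n) 3) fun ξ hξ => ?_
    by_contra hne
    have h2 := (hsupp (‖ξ‖ ^ 2) (by intro h0; exact hne (by simp [hm, h0]))).2
    rw [mem_closedBall_zero_iff, not_le] at hξ
    nlinarith
  refine ⟨hcs.toSchwartzMap hsm, fun ξ => ?_, fun ξ h1 h2 => ?_, fun ξ h => ?_⟩
  · change ‖m ξ‖ ≤ 1
    rw [hm, Complex.norm_real, Real.norm_of_nonneg θ.nonneg]; exact θ.le_one
  · change m ξ = 1
    have : θ (‖ξ‖ ^ 2) = 1 := by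
      apply θ.one_of_mem_closedBall
      rw [Real.closedBall_eq_Icc]
      simp only [θ, Set.mem_Icc]; constructor <;> linarith
    simp [hm, this]
  · change m ξ ≠ 0 at h
    have := hsupp (‖ξ‖ ^ 2) (by intro h0; exact h (by simp [hm, h0]))
    exact ⟨this.1.le, this.2.le⟩

/-- the annular bump -/
noncomputable def bump (n : ℕ) : SchwartzMap (V n) ℂ := (exists_bump n).choose

theorem bump_le {n : ℕ} (ξ : V n) : ‖bump n ξ‖ ≤ 1 := (exists_bump n).choose_spec.1 ξ
theorem bump_one {n : ℕ} (ξ : V n) (h : 1 / 2 ≤ ‖ξ‖ ^ 2) (h' : ‖ξ‖ ^ 2 ≤ 6) : bump n ξ = 1 :=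
  (exists_bump n).choose_spec.2.1 ξ h h'
theorem bump_supp {n : ℕ} (ξ : V n) (h : bump n ξ ≠ 0) : 1 / 4 ≤ ‖ξ‖ ^ 2 ∧ ‖ξ‖ ^ 2 ≤ 25 / 4 :=
  (exists_bump n).choose_spec.2.2 ξ h

theorem exists_scale {n : ℕ} {T : ℝ} (hT : 0 < T) : ∃ ψ : SchwartzMap (V n) ℂ, ∀ ξ, ψ ξ = bump n (T⁻¹ • ξ) := by
  refine ⟨SchwartzMap.compCLMOfContinuousLinearEquiv ℂ
    (ContinuousLinearEquiv.smulLeft (Units.mk0 T⁻¹ (inv_pos.2 hT).ne') : V n ≃L[ℝ] V n) (bump n), fun ξ => ?_⟩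
  rfl

theorem mt_bump {n : ℕ} {φ : ℝ → ℝ} (hφ : Good φ) {δ : ℝ} (hδ : 0 < δ) (hδ1 : δ ≤ 1) {T t : ℝ} (hT : 0 < T)
    (ht : t ∈ Set.Ioc T (2 * T)) (ξ : V n) : mt n φ δ t ξ * bump n (T⁻¹ • ξ) = mt n φ δ t ξ := by
  by_cases h : ξ ∈ AA n δ t
  · have ht0 : 0 < t := hT.trans ht.1
    have h1 := AA_norm hδ1 ht0 h
    have e : ‖T⁻¹ • ξ‖ ^ 2 = ‖ξ‖ ^ 2 / T ^ 2 := by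
      rw [norm_smul, Real.norm_of_nonneg (inv_pos.2 hT).le]; field_simp
    rw [bump_one, mul_one]
    · rw [e, le_div_iff₀ (by positivity)]
      have := ht.1
      nlinarith
    · rw [e, div_le_iff₀ (by positivity)]
      have := ht.2
      nlinarith
  · rw [mt_zero hφ hδ t h, zero_mul]

theorem bump_decay (n : ℕ) : ∃ C : ℝ, 0 < C ∧ ∀ T : ℝ, 0 < T → ∀ x : V n,
    ‖iF (fun ξ => bump n (T⁻¹ • ξ)) x‖ₑ ≤ ENNReal.ofReal C * kap n T x := by
  have hS : ∀ x, iF (bump n) x = (𝓕⁻ (bump n) : SchwartzMap (V n) ℂ) x := by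
    intro x; rw [iF_eq, SchwartzMap.fourierInv_coe]
  set g : SchwartzMap (V n) ℂ := 𝓕⁻ (bump n) with hg
  obtain ⟨C0, hC0⟩ := g.decay' 0 0
  obtain ⟨C1, hC1⟩ := g.decay' (n + 1) 0
  have h0 : ∀ x, ‖g x‖ ≤ C0 := fun x => by
    have := hC0 x; rw [norm_iteratedFDeriv_zero, pow_zero, one_mul] at this; exact this
  have h1 : ∀ x, ‖x‖ ^ (n + 1) * ‖g x‖ ≤ C1 := fun x => by
    have := hC1 x; rw [norm_iteratedFDeriv_zero] at this; exact this
  have hC0' : 0 ≤ C0 := (norm_nonneg _).trans (h0 0)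
  have hC1' : 0 ≤ C1 := (by positivity : 0 ≤ ‖(0 : V n)‖ ^ (n + 1) * ‖g 0‖).trans (h1 0)
  refine ⟨2 ^ n * (C0 + C1 + 1), by positivity, fun T hT x => ?_⟩
  rw [iF_scale _ hT, hS, kap, ← ENNReal.ofReal_mul (by positivity), ← ofReal_norm]
  refine ENNReal.ofReal_le_ofReal ?_
  rw [norm_mul, Complex.norm_real, Real.norm_of_nonneg (by positivity)]
  have e : T * ‖x‖ = ‖T • x‖ := by rw [norm_smul, Real.norm_of_nonneg hT.le]
  rw [e]
  set y := T • x
  have key : ‖g y‖ * (1 + ‖y‖) ^ (n + 1) ≤ 2 ^ n * (C0 + C1 + 1) := by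
    have a := add_pow_le zero_le_one (norm_nonneg y) (n + 1)
    simp only [one_pow, Nat.add_sub_cancel] at a
    calc _ ≤ ‖g y‖ * (2 ^ n * (1 + ‖y‖ ^ (n + 1))) := by gcongr
      _ = 2 ^ n * (‖g y‖ + ‖y‖ ^ (n + 1) * ‖g y‖) := by ring
      _ ≤ _ := by
        have := h0 y; have := h1 y
        exact mul_le_mul_of_nonneg_left (by linarith) (by positivity)
  rw [← le_div_iff₀ (by positivity)] at key
  calc T ^ n * ‖g y‖ ≤ T ^ n * (2 ^ n * (C0 + C1 + 1) / (1 + ‖y‖) ^ (n + 1)) := by gcongr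
    _ = _ := by ring

/-- frequency localization -/
noncomputable def PK (n : ℕ) (T : ℝ) (f : V n → ℂ) (x : V n) : ℂ :=
  iF (fun ξ => bump n (T⁻¹ • ξ) * 𝓕 f ξ) x

theorem integrable_bump {n : ℕ} {T : ℝ} (hT : 0 < T) : Integrable (fun ξ : V n => bump n (T⁻¹ • ξ)) := by
  obtain ⟨ψ, hψ⟩ := exists_scale (n := n) hT
  refine ψ.integrable.congr (ae_of_all _ hψ)

theorem PK_conv {n : ℕ} {T : ℝ} (hT : 0 < T) {f : V n → ℂ} (hf : Integrable f) (x : V n) :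
    PK n T f x = ∫ y, iF (fun ξ => bump n (T⁻¹ • ξ)) (x - y) * f y :=
  iF_conv (integrable_bump hT) hf x

theorem PK_schwartz {n : ℕ} {T : ℝ} (hT : 0 < T) (f : SchwartzMap (V n) ℂ) :
    ∃ g : SchwartzMap (V n) ℂ, (⇑g = PK n T f) ∧ ∀ ξ, 𝓕 (g : V n → ℂ) ξ = bump n (T⁻¹ • ξ) * 𝓕 (f : V n → ℂ) ξ := by
  obtain ⟨ψ, hψ⟩ := exists_scale (n := n) hT
  set h : SchwartzMap (V n) ℂ := SchwartzMap.smulLeftCLM ℂ (⇑ψ) (𝓕 f) with hh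
  have hv : ∀ ξ, h ξ = bump n (T⁻¹ • ξ) * 𝓕 (f : V n → ℂ) ξ := by
    intro ξ
    rw [hh, SchwartzMap.smulLeftCLM_apply_apply ψ.hasTemperateGrowth, hψ, smul_eq_mul, SchwartzMap.fourier_coe]
  refine ⟨𝓕⁻ h, ?_, fun ξ => ?_⟩
  · ext x
    rw [SchwartzMap.fourierInv_coe, ← iF_eq]
    unfold PK
    congr 1; ext ξ; exact hv ξ
  · rw [← SchwartzMap.fourier_coe, FourierTransform.fourier_fourierInv_eq, hv]

theorem sT_PK {n : ℕ} {φ : ℝ → ℝ} (hφ : Good φ) {δ : ℝ} (hδ : 0 < δ) (hδ1 : δ ≤ 1) {T : ℝ} (hT : 0 < T)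
    (f : SchwartzMap (V n) ℂ) : sT n φ δ T (PK n T f) = sT n φ δ T f := by
  obtain ⟨g, hg, hF⟩ := PK_schwartz hT f
  rw [← hg]
  ext x
  unfold sT
  refine setLIntegral_congr_fun measurableSet_Ioc fun t ht => ?_
  have : FT n φ δ t g x = FT n φ δ t f x := by
    unfold FT
    congr 1; ext ξ
    rw [hF, ← mul_assoc, mt_bump hφ hδ hδ1 hT ht]
  simp only [this]

theorem reproduce (n : ℕ) : ∃ A : ℝ, 0 < A ∧ ∀ φ : ℝ → ℝ, Good φ → ∀ δ : ℝ, 0 < δ → δ ≤ 1 → ∀ T : ℝ, 0 < T →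
    ∀ f : V n → ℂ, Integrable f → ∀ x, sT n φ δ T f x ≤ ENNReal.ofReal A * cv n T (sT n φ δ T f) x := by
  obtain ⟨C1, hC1, h1⟩ := kap_mass n
  obtain ⟨C2, hC2, h2⟩ := bump_decay n
  refine ⟨C2 * C1 * C2, by positivity, ?_⟩
  intro φ hφ δ hδ hδ1 T hT f hf x
  have hmk := measurable_kap n T
  have hmF := measurable_FT hφ δ hf
  obtain ⟨ψ, hψ⟩ := exists_scale (n := n) hT
  set Φ : SchwartzMap (V n) ℂ := 𝓕⁻ ψ with hΦ
  have hΦv : ∀ y, ‖Φ y‖ₑ ≤ ENNReal.ofReal C2 * kap n T y := by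
    intro y
    rw [hΦ, SchwartzMap.fourierInv_coe, ← iF_eq, show (⇑ψ) = fun ξ => bump n (T⁻¹ • ξ) from funext hψ]
    exact h2 T hT y
  have hFΦ : ∀ ξ, 𝓕 (Φ : V n → ℂ) ξ = bump n (T⁻¹ • ξ) := by
    intro ξ
    rw [← SchwartzMap.fourier_coe, hΦ, FourierTransform.fourier_fourierInv_eq, hψ]
  have hpt : ∀ t ∈ Set.Ioc T (2 * T), ‖FT n φ δ t f x‖ₑ ^ 2 ≤
      ENNReal.ofReal (C2 * C1 * C2) * ∫⁻ y, kap n T (x - y) * ‖FT n φ δ t f y‖ₑ ^ 2 := by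
    intro t ht
    have ht0 : 0 < t := hT.trans ht.1
    have hm1 : Measurable fun y => ‖FT n φ δ t f y‖ₑ := Measurable.comp (g := fun z : ℝ × V n => ‖FT n φ δ z.1 f z.2‖ₑ) (f := fun y : V n => (t, y))
      hmF measurable_prodMk_left
    have hi := integrable_mul_fourier (integrable_mt (n := n) hφ hδ hδ1 ht0) hf
    have e : FT n φ δ t f x = ∫ y, FT n φ δ t f (x - y) * Φ y := by
      have := iF_conv hi Φ.integrable x
      rw [show (fun y => FT n φ δ t f (x - y) * Φ y) = fun y => iF (fun ξ => mt n φ δ t ξ * 𝓕 f ξ) (x - y) * Φ y from rfl, ← this]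
      unfold FT
      congr 1; ext ξ
      rw [hFΦ, mul_right_comm, mt_bump hφ hδ hδ1 hT ht]
    have hk2 : ∀ y, (kap n T y ^ (1 / 2 : ℝ)) ^ 2 = kap n T y := by
      intro y; rw [← ENNReal.rpow_natCast, ← ENNReal.rpow_mul]; norm_num
    have hms : Measurable fun y : V n => kap n T y ^ (1 / 2 : ℝ) := hmk.pow_const _
    have hmx : Measurable fun y : V n => ‖FT n φ δ t f (x - y)‖ₑ := Measurable.comp (g := fun y => ‖FT n φ δ t f y‖ₑ)
      (f := fun y : V n => x - y) hm1 (measurable_const.sub measurable_id)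
    calc ‖FT n φ δ t f x‖ₑ ^ 2 ≤ (ENNReal.ofReal C2 * ∫⁻ y, kap n T y ^ (1 / 2 : ℝ) * (kap n T y ^ (1 / 2 : ℝ) * ‖FT n φ δ t f (x - y)‖ₑ)) ^ 2 := by
          refine pow_le_pow_left' ?_ 2
          rw [e]
          refine (enorm_integral_le_lintegral_enorm _).trans ?_
          rw [← lintegral_const_mul _ (hms.fun_mul (hms.fun_mul hmx))]
          refine lintegral_mono fun y => ?_
          rw [enorm_mul]
          calc _ ≤ ‖FT n φ δ t f (x - y)‖ₑ * (ENNReal.ofReal C2 * kap n T y) := mul_le_mul' le_rfl (hΦv y)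
            _ = ‖FT n φ δ t f (x - y)‖ₑ * (ENNReal.ofReal C2 * (kap n T y ^ (1 / 2 : ℝ)) ^ 2) := by rw [hk2]
            _ = _ := by ring
      _ ≤ ENNReal.ofReal C2 ^ 2 * ((∫⁻ y, (kap n T y ^ (1 / 2 : ℝ)) ^ 2) * ∫⁻ y, (kap n T y ^ (1 / 2 : ℝ) * ‖FT n φ δ t f (x - y)‖ₑ) ^ 2) := by
          rw [mul_pow]
          exact mul_le_mul' le_rfl (cs2 _ _ _ hms.aemeasurable (hms.fun_mul hmx).aemeasurable)
      _ ≤ ENNReal.ofReal C2 ^ 2 * (ENNReal.ofReal C1 * ∫⁻ y, kap n T (x - y) * ‖FT n φ δ t f y‖ₑ ^ 2) := by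
          refine mul_le_mul' le_rfl (mul_le_mul' ?_ (le_of_eq ?_))
          · simp_rw [hk2]
            have := h1 T hT 0
            simp_rw [zero_sub, kap_neg] at this
            exact this
          · rw [← lintegral_sub_left_eq_self (fun y => kap n T (x - y) * ‖FT n φ δ t f y‖ₑ ^ 2) x]
            refine lintegral_congr fun y => ?_
            rw [mul_pow, hk2, sub_sub_cancel]
      _ = _ := by
          rw [ENNReal.ofReal_mul (by positivity), ENNReal.ofReal_mul (by positivity)]; ring
  have hmj : Measurable (Function.uncurry fun (t : ℝ) (y : V n) => kap n T (x - y) * ‖FT n φ δ t f y‖ₑ ^ 2 * ENNReal.ofReal t⁻¹) := by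
    have a : Measurable fun z : ℝ × V n => kap n T (x - z.2) := hmk.comp (measurable_const.sub measurable_snd)
    exact (a.mul (hmF.pow_const 2)).mul measurable_fst.inv.ennreal_ofReal
  have m1 : Measurable fun t : ℝ => ENNReal.ofReal t⁻¹ := measurable_id.inv.ennreal_ofReal
  calc sT n φ δ T f x ≤ ∫⁻ t in Set.Ioc T (2 * T), ENNReal.ofReal (C2 * C1 * C2) *
        ∫⁻ y, kap n T (x - y) * ‖FT n φ δ t f y‖ₑ ^ 2 * ENNReal.ofReal t⁻¹ := by
        refine setLIntegral_mono' measurableSet_Ioc fun t ht => ?_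
        rw [lintegral_mul_const' _ _ ENNReal.ofReal_ne_top, ← mul_assoc]
        exact mul_le_mul_left (hpt t ht) _
    _ = ENNReal.ofReal (C2 * C1 * C2) * ∫⁻ y, ∫⁻ t in Set.Ioc T (2 * T), kap n T (x - y) * ‖FT n φ δ t f y‖ₑ ^ 2 * ENNReal.ofReal t⁻¹ := by
        rw [lintegral_const_mul' _ _ ENNReal.ofReal_ne_top, lintegral_lintegral_swap hmj.aemeasurable]
    _ = _ := by
        unfold cv sT
        congr 1
        refine lintegral_congr fun y => ?_
        simp_rw [mul_assoc]
        rw [lintegral_const_mul' _ _ (by simp [kap])]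

end SqFn

namespace SqFn

theorem overlap {n : ℕ} {T0 : ℝ} (hT0 : 0 < T0) (K : ℕ) (ξ : V n) :
    ∑ i ∈ Finset.range K, ‖bump n ((T0 * 2 ^ i)⁻¹ • ξ)‖ₑ ^ 2 ≤ 3 := by
  classical
  set S := (Finset.range K).filter (fun i => bump n ((T0 * 2 ^ i)⁻¹ • ξ) ≠ 0) with hS
  have h1 : ∑ i ∈ Finset.range K, ‖bump n ((T0 * 2 ^ i)⁻¹ • ξ)‖ₑ ^ 2 ≤ ∑ i ∈ S, (1:ℝ≥0∞) := by
    rw [hS, Finset.sum_filter]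
    refine Finset.sum_le_sum fun i _ => ?_
    by_cases h : bump n ((T0 * 2 ^ i)⁻¹ • ξ) = 0
    · rw [if_neg (not_not.2 h), h, enorm_zero]; norm_num
    · simp only [ne_eq, h, not_false_eq_true, if_true]
      refine pow_le_one' ?_ 2
      rw [← ofReal_norm, ← ENNReal.ofReal_one]
      exact ENNReal.ofReal_le_ofReal (bump_le _)
  refine h1.trans ?_
  have hb : ∀ i ∈ S, (T0 * 2 ^ i) ^ 2 / 4 ≤ ‖ξ‖ ^ 2 ∧ ‖ξ‖ ^ 2 ≤ 25 / 4 * (T0 * 2 ^ i) ^ 2 := by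
    intro i hi
    have h := bump_supp _ (Finset.mem_filter.1 hi).2
    have hp : 0 < T0 * 2 ^ i := by positivity
    have e : ‖(T0 * 2 ^ i)⁻¹ • ξ‖ ^ 2 = ‖ξ‖ ^ 2 / (T0 * 2 ^ i) ^ 2 := by
      rw [norm_smul, Real.norm_of_nonneg (inv_pos.2 hp).le]; field_simp
    rw [e, le_div_iff₀ (by positivity), div_le_iff₀ (by positivity)] at h
    exact ⟨by linarith [h.1], h.2⟩
  have hcard : S.card ≤ 3 := by
    rcases S.eq_empty_or_nonempty with h0 | h0
    · rw [h0]; simp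
    · set a := S.min' h0 with ha
      have : S ⊆ Finset.Icc a (a + 2) := by
        intro j hj
        have haj : a ≤ j := S.min'_le j hj
        rw [Finset.mem_Icc]
        refine ⟨haj, ?_⟩
        by_contra hlt
        push Not at hlt
        obtain ⟨d, rfl⟩ : ∃ d, j = a + 3 + d := ⟨j - (a + 3), by omega⟩
        have h1 := (hb _ hj).1
        have h2 := (hb _ (S.min'_mem h0)).2
        rw [← ha] at h2
        have h3 : (T0 * 2 ^ (a + 3 + d)) ^ 2 = 64 * (2 ^ d) ^ 2 * (T0 * 2 ^ a) ^ 2 := by ring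
        have h4 : (1:ℝ) ≤ 2 ^ d := one_le_pow₀ (by norm_num)
        have h5 : 0 < (T0 * 2 ^ a) ^ 2 := by positivity
        rw [h3] at h1
        nlinarith [mul_le_mul_of_nonneg_right (one_le_pow₀ h4 : (1:ℝ) ≤ (2 ^ d) ^ 2) h5.le]
      calc S.card ≤ (Finset.Icc a (a + 2)).card := Finset.card_le_card this
        _ = 3 := by rw [Nat.card_Icc]; omega
  simp only [Finset.sum_const, nsmul_eq_mul, mul_one]
  exact_mod_cast hcard

theorem integrable_PKh {n : ℕ} {T : ℝ} (hT : 0 < T) {f : V n → ℂ} (hf : Integrable f) :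
    Integrable (fun ξ => bump n (T⁻¹ • ξ) * 𝓕 f ξ) := integrable_mul_fourier (integrable_bump hT) hf

theorem continuous_PK {n : ℕ} {T : ℝ} (hT : 0 < T) {f : V n → ℂ} (hf : Integrable f) :
    Continuous (PK n T f) := continuous_iF (integrable_PKh hT hf)

theorem PK_L2 {n : ℕ} {T0 : ℝ} (hT0 : 0 < T0) (K : ℕ) {f : V n → ℂ} (hf : Integrable f) :
    ∑ i ∈ Finset.range K, ∫⁻ x, ‖PK n (T0 * 2 ^ i) f x‖ₑ ^ 2 ≤ 3 * ∫⁻ x, ‖f x‖ₑ ^ 2 := by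
  have hm := (continuous_fourier hf).measurable.enorm
  calc _ ≤ ∑ i ∈ Finset.range K, ∫⁻ ξ, ‖bump n ((T0 * 2 ^ i)⁻¹ • ξ)‖ₑ ^ 2 * ‖𝓕 f ξ‖ₑ ^ 2 := by
        refine Finset.sum_le_sum fun i _ => ?_
        refine (bessel_inv (integrable_PKh (by positivity) hf)).trans (le_of_eq ?_)
        refine lintegral_congr fun ξ => ?_
        rw [enorm_mul, mul_pow]
    _ = ∫⁻ ξ, ∑ i ∈ Finset.range K, ‖bump n ((T0 * 2 ^ i)⁻¹ • ξ)‖ₑ ^ 2 * ‖𝓕 f ξ‖ₑ ^ 2 := by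
        rw [lintegral_finsetSum]
        intro i _
        have : Measurable fun ξ : V n => ‖bump n ((T0 * 2 ^ i)⁻¹ • ξ)‖ₑ :=
          ((bump n).continuous.comp (continuous_const_smul _)).measurable.enorm
        exact (this.pow_const 2).mul (hm.pow_const 2)
    _ ≤ ∫⁻ ξ, 3 * ‖𝓕 f ξ‖ₑ ^ 2 := by
        refine lintegral_mono fun ξ => ?_
        simp only []
        rw [← Finset.sum_mul]
        exact mul_le_mul_left (overlap hT0 K ξ) _
    _ ≤ _ := by
        rw [lintegral_const_mul _ (hm.pow_const 2)]
        exact mul_le_mul' le_rfl (bessel hf)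

theorem PK_add {n : ℕ} {T : ℝ} (hT : 0 < T) {f g : V n → ℂ} (hf : Integrable f) (hg : Integrable g) (x : V n) :
    PK n T (f + g) x = PK n T f x + PK n T g x := by
  have hi : ∀ h : V n → ℂ, Integrable h → Integrable fun y => iF (fun ξ => bump n (T⁻¹ • ξ)) (x - y) * h y := by
    intro h hh
    have hc : Continuous fun y : V n => iF (fun ξ => bump n (T⁻¹ • ξ)) (x - y) :=
      (continuous_iF (integrable_bump hT)).comp (continuous_const.sub continuous_id)
    exact hh.bdd_mul hc.aestronglyMeasurable (ae_of_all _ fun y => norm_iF_le _ _)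
  rw [PK_conv hT hf, PK_conv hT hg, PK_conv hT (hf.add hg), ← integral_add (hi f hf) (hi g hg)]
  congr 1; ext y; simp [mul_add]

theorem LP (n : ℕ) (p : ℝ) (hp : 2 < p) : ∃ C : ℝ, 0 < C ∧ ∀ T0 : ℝ, 0 < T0 → ∀ K : ℕ, ∀ f : V n → ℂ, Integrable f →
    Measurable f → ∑ i ∈ Finset.range K, ∫⁻ x, ‖PK n (T0 * 2 ^ i) f x‖ₑ ^ p ≤ ENNReal.ofReal C * ∫⁻ x, ‖f x‖ₑ ^ p := by
  obtain ⟨C1, hC1, h1⟩ := kap_mass n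
  obtain ⟨C2, hC2, h2⟩ := bump_decay n
  set c := 1 / (2 * C1 * C2) with hc
  have hc0 : 0 < c := by positivity
  have hp2 : 0 < p - 2 := by linarith
  refine ⟨p * 12 * (c ^ (2 - p) / (p - 2)), by positivity, ?_⟩
  intro T0 hT0 K f hf hfm
  have hgm : ∀ i : ℕ, Measurable fun x => ‖PK n (T0 * 2 ^ i) f x‖ₑ := fun i =>
    (continuous_PK (by positivity) hf).measurable.enorm
  refine (marcin volume volume (Finset.range K) (fun i x => ‖PK n (T0 * 2 ^ i) f x‖ₑ) (fun x => ‖f x‖ₑ) hgm hfm.enorm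
    2 p c (ENNReal.ofReal 12) (by norm_num) hp hc0 ?_).trans (le_of_eq ?_)
  · intro l hl
    set E := {y | ENNReal.ofReal (c * l) < ‖f y‖ₑ} with hE
    have hEm : MeasurableSet E := measurableSet_lt measurable_const hfm.enorm
    have hfh : Integrable (E.indicator f) := hf.indicator hEm
    have hfl : Integrable (Eᶜ.indicator f) := hf.indicator hEm.compl
    have hlo : ∀ i : ℕ, ∀ x, ‖PK n (T0 * 2 ^ i) (Eᶜ.indicator f) x‖ₑ ≤ ENNReal.ofReal (l / 2) := by
      intro i x
      have hT : 0 < T0 * 2 ^ i := by positivity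
      rw [PK_conv hT hfl]
      refine (enorm_integral_le_lintegral_enorm _).trans ?_
      have hmk : Measurable fun y : V n => kap n (T0 * 2 ^ i) (x - y) :=
        (measurable_kap n _).comp (measurable_const.sub measurable_id)
      calc _ ≤ ∫⁻ y, ENNReal.ofReal (C2 * (c * l)) * kap n (T0 * 2 ^ i) (x - y) := by
            refine lintegral_mono fun y => ?_
            rw [enorm_mul, ENNReal.ofReal_mul hC2.le, mul_right_comm]
            refine mul_le_mul' (h2 _ hT _) ?_
            by_cases hy : y ∈ E
            · simp [hy]
            · rw [Set.indicator_of_mem (by exact hy)]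
              simpa [hE] using hy
        _ ≤ ENNReal.ofReal (C2 * (c * l)) * ENNReal.ofReal C1 := by
            rw [lintegral_const_mul _ hmk]
            exact mul_le_mul' le_rfl (h1 _ hT x)
        _ = _ := by
            rw [← ENNReal.ofReal_mul (by positivity)]
            congr 1; rw [hc]; field_simp
    have hsum : f = Eᶜ.indicator f + E.indicator f := by
      rw [add_comm]; exact (Set.indicator_self_add_compl E f).symm
    have hset : ∀ i : ℕ, {x | ENNReal.ofReal l < ‖PK n (T0 * 2 ^ i) f x‖ₑ} ⊆
        {x | ENNReal.ofReal (l / 2) ^ 2 ≤ ‖PK n (T0 * 2 ^ i) (E.indicator f) x‖ₑ ^ 2} := by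
      intro i x hx
      simp only [Set.mem_setOf_eq] at hx ⊢
      refine pow_le_pow_left' ?_ 2
      by_contra hlt
      push Not at hlt
      have hT : 0 < T0 * 2 ^ i := by positivity
      have : ‖PK n (T0 * 2 ^ i) f x‖ₑ ≤ ENNReal.ofReal (l / 2) + ENNReal.ofReal (l / 2) := by
        conv_lhs => rw [hsum]
        rw [PK_add hT hfl hfh]
        exact (enorm_add_le _ _).trans (add_le_add (hlo i x) hlt.le)
      rw [← ENNReal.ofReal_add (by positivity) (by positivity), add_halves] at this
      exact absurd hx (not_lt.2 this)
    have hl2 : ENNReal.ofReal (l / 2) ^ 2 ≠ 0 := pow_ne_zero 2 (ENNReal.ofReal_pos.2 (by positivity)).ne'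
    have hl2t : ENNReal.ofReal (l / 2) ^ 2 ≠ ⊤ := ENNReal.pow_ne_top ENNReal.ofReal_ne_top
    have hmh : ∀ i : ℕ, Measurable fun x => ‖PK n (T0 * 2 ^ i) (E.indicator f) x‖ₑ := fun i =>
      (continuous_PK (by positivity) hfh).measurable.enorm
    calc _ ≤ ∑ i ∈ Finset.range K, (∫⁻ x, ‖PK n (T0 * 2 ^ i) (E.indicator f) x‖ₑ ^ 2) / ENNReal.ofReal (l / 2) ^ 2 := by
          refine Finset.sum_le_sum fun i _ => ?_
          exact (measure_mono (hset i)).trans (meas_ge_le_lintegral_div ((hmh i).pow_const 2).aemeasurable hl2 hl2t)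
      _ = (∑ i ∈ Finset.range K, ∫⁻ x, ‖PK n (T0 * 2 ^ i) (E.indicator f) x‖ₑ ^ 2) / ENNReal.ofReal (l / 2) ^ 2 := by
          simp_rw [div_eq_mul_inv]; rw [Finset.sum_mul]
      _ ≤ (3 * ∫⁻ x, ‖E.indicator f x‖ₑ ^ 2) / ENNReal.ofReal (l / 2) ^ 2 := by
          exact ENNReal.div_le_div_right (PK_L2 hT0 K hfh) _
      _ = _ := by
          have e1 : ∫⁻ x, ‖E.indicator f x‖ₑ ^ 2 = ∫⁻ y in E, ‖f y‖ₑ ^ (2:ℝ) := by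
            rw [← lintegral_indicator hEm]
            refine lintegral_congr fun x => ?_
            by_cases hx : x ∈ E <;> simp [hx]
          rw [e1, div_eq_mul_inv, mul_right_comm]
          congr 1
          rw [← ENNReal.ofReal_pow (by positivity), ← ENNReal.ofReal_inv_of_pos (by positivity),
            show (3:ℝ≥0∞) = ENNReal.ofReal 3 by norm_num, ← ENNReal.ofReal_mul (by norm_num), ← ENNReal.ofReal_mul (by norm_num)]
          congr 1
          rw [Real.rpow_neg hl.le, Real.rpow_two]; field_simp; norm_num
  · rw [ENNReal.ofReal_mul (p := p * 12) (by positivity), ENNReal.ofReal_mul (p := p) (by positivity)]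

end SqFn

namespace SqFn

theorem sum_scales (h : ℝ → ℝ≥0∞) {T0 : ℝ} (hT0 : 0 < T0) (a d : ℕ) :
    ∑ i ∈ Finset.Ico a (a + d), ∫⁻ t in Set.Ioc (T0 * 2 ^ i) (2 * (T0 * 2 ^ i)), h t =
      ∫⁻ t in Set.Ioc (T0 * 2 ^ a) (T0 * 2 ^ (a + d)), h t := by
  induction d with
  | zero => simp
  | succ d ih =>
    rw [← add_assoc, Finset.sum_Ico_succ_top (by omega), ih,
      show 2 * (T0 * 2 ^ (a + d)) = T0 * 2 ^ (a + d + 1) by ring,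
      ← lintegral_union measurableSet_Ioc (Set.Ioc_disjoint_Ioc_of_le le_rfl), Set.Ioc_union_Ioc_eq_Ioc]
    · have : (2:ℝ) ^ a ≤ 2 ^ (a + d) := pow_le_pow_right₀ (by norm_num) (by omega)
      gcongr
    · have : (2:ℝ) ^ (a + d) ≤ 2 ^ (a + d + 1) := pow_le_pow_right₀ (by norm_num) (by omega)
      gcongr

theorem choose_L (M : ℕ) (κ : ℝ) (hκ : 0 < κ) : ∃ C : ℝ, 0 < C ∧ ∀ δ : ℝ, 0 < δ → δ ≤ 1 →
    ∃ L : ℕ, 1 ≤ δ ^ (M + 1) * 2 ^ L ∧ (L : ℝ) ≤ C * δ ^ (-κ) := by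
  have hlog2 : 0 < Real.log 2 := Real.log_pos (by norm_num)
  refine ⟨(M + 1) / (κ * Real.log 2) + 1, by positivity, fun δ hδ hδ1 => ?_⟩
  set X := (M + 1) * Real.log δ⁻¹ / Real.log 2 with hX
  have hδi : 1 ≤ δ⁻¹ := (one_le_inv₀ hδ).2 hδ1
  have hl0 : 0 ≤ Real.log δ⁻¹ := Real.log_nonneg hδi
  have hX0 : 0 ≤ X := by positivity
  refine ⟨⌈X⌉₊, ?_, ?_⟩
  · have h1 : (M + 1) * Real.log δ⁻¹ ≤ ⌈X⌉₊ * Real.log 2 := by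
      have := Nat.le_ceil X
      rw [hX, div_le_iff₀ hlog2] at this
      exact this
    have h2 : Real.log (δ⁻¹ ^ (M + 1)) ≤ Real.log (2 ^ ⌈X⌉₊) := by
      rw [Real.log_pow, Real.log_pow]; push_cast; exact h1
    have h3 := (Real.log_le_log_iff (by positivity) (by positivity)).1 h2
    rw [inv_pow] at h3
    have h4 : 0 < δ ^ (M + 1) := by positivity
    calc (1:ℝ) = δ ^ (M + 1) * (δ ^ (M + 1))⁻¹ := by field_simp
      _ ≤ _ := by gcongr
  · have h1 := (Nat.ceil_lt_add_one hX0).le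
    have h2 : Real.log δ⁻¹ ≤ δ ^ (-κ) / κ := by
      have := Real.log_le_rpow_div (inv_pos.2 hδ).le hκ
      rwa [Real.inv_rpow hδ.le, ← Real.rpow_neg hδ.le] at this
    have h3 : 1 ≤ δ ^ (-κ) := Real.one_le_rpow_of_pos_of_le_one_of_nonpos hδ hδ1 (by linarith)
    calc (⌈X⌉₊ : ℝ) ≤ X + 1 := h1
      _ ≤ (M + 1) * (δ ^ (-κ) / κ) / Real.log 2 + δ ^ (-κ) := by rw [hX]; gcongr
      _ = _ := by field_simp

theorem trunc {n : ℕ} (hn : 2 ≤ n) {φ : ℝ → ℝ} (hφ : Good φ) (p : ℝ) (hp : 2 < p) (hp2 : p < 2 * (n + 1) / (n - 1)) :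
    ∃ C : ℝ, 0 < C ∧ ∀ δ : ℝ, 0 < δ → δ ≤ 1 → ∀ f : SchwartzMap (V n) ℂ, ∀ T0 : ℝ, 0 < T0 → ∀ K : ℕ,
    ∫⁻ x, (∑ i ∈ Finset.range K, sT n φ δ (T0 * 2 ^ i) f x) ^ (p / 2) ≤
      ENNReal.ofReal (C * δ ^ (p / (n + 1))) * ∫⁻ x, ‖f x‖ₑ ^ p := by
  have hn2 : (2:ℝ) ≤ n := by exact_mod_cast hn
  have hq : 1 < p / 2 := by linarith
  have hq0 : 0 < p / 2 := by linarith
  obtain ⟨ν, hν⟩ := exists_nat_ge (((n:ℝ) + 1) * (1 + |p / 2 - 2|))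
  obtain ⟨A, hA, hrep⟩ := reproduce n
  obtain ⟨Cp, hCp, hpara⟩ := paraproduct n (p / 2) hq A hA ν hν
  set M := n + 1 + ν with hM
  obtain ⟨Ch, hCh, hhigh⟩ := high (n := n) hφ ν M le_rfl
  obtain ⟨e, he, Cs, hCs, hsingle⟩ := single hn hφ p hp hp2
  obtain ⟨Cl, hCl, hLP⟩ := LP n p hp
  obtain ⟨Ck, hCk, hkm⟩ := kap_mass n
  set κ := (e - p / (n + 1)) / (p / 2) with hκ
  have hκ0 : 0 < κ := div_pos (by linarith) hq0
  obtain ⟨CL, hCL, hchL⟩ := choose_L M κ hκ0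
  refine ⟨Cp * (2 ^ (p / 2 - 1) * (Ch ^ (p / 2) + CL ^ (p / 2) * (Cs * Cl))), by positivity, ?_⟩
  intro δ hδ hδ1 f T0 hT0 K
  obtain ⟨L, hL1, hL2⟩ := hchL δ hδ hδ1
  have hf : Integrable (f : V n → ℂ) := f.integrable
  have hfm : Measurable (f : V n → ℂ) := f.continuous.measurable
  have hL2f : ∀ g : SchwartzMap (V n) ℂ, ∫⁻ x, ‖g x‖ₑ ^ 2 ≠ ⊤ := by
    intro g
    have := (g.memLp 2 volume).2.ne
    rw [eLpNorm_eq_lintegral_rpow_enorm_toReal (by norm_num) (by norm_num)] at this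
    intro h
    apply this
    simp [h]
  have hf2 := hL2f f
  have hTi : ∀ i : ℕ, 0 < T0 * 2 ^ i := fun i => by positivity
  set s : ℕ → V n → ℝ≥0∞ := fun i => sT n φ δ (T0 * 2 ^ i) f with hs
  have hsm : ∀ i, Measurable (s i) := fun i => measurable_sT hφ δ _ hf
  have hbd : ∀ i, ∃ D : ℝ≥0∞, D ≠ ⊤ ∧ ∀ x, s i x ≤ D := fun i => bdd_s hφ hδ hδ1 (hTi i) hf
  choose D hD hDs using hbd
  set σ : V n → ℝ≥0∞ := fun x => (∑ i ∈ Finset.range K, s i x ^ (p / 2)) ^ (1 / (p / 2)) with hσ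
  have hσs : Measurable fun x => ∑ i ∈ Finset.range K, s i x ^ (p / 2) :=
    Finset.measurable_sum _ fun i _ => (hsm i).pow_const _
  have hσm : Measurable σ := hσs.pow_const _
  have hσq : ∀ x, σ x ^ (p / 2) = ∑ i ∈ Finset.range K, s i x ^ (p / 2) := by
    intro x
    rw [hσ]; simp only []
    rw [← ENNReal.rpow_mul, one_div_mul_cancel hq0.ne', ENNReal.rpow_one]
  have hF2m : Measurable fun x => ‖f x‖ₑ ^ 2 := hfm.enorm.pow_const 2
  have hSfin : ∫⁻ x, (∑ i ∈ Finset.range K, s i x) ^ (p / 2) ≠ ⊤ := by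
    refine fin_pow volume _ (Finset.measurable_sum _ fun i _ => hsm i) (∑ i ∈ Finset.range K, D i) ?_ ?_ ?_ _ hq.le
    · exact ENNReal.sum_ne_top.2 fun i _ => hD i
    · exact fun x => Finset.sum_le_sum fun i _ => hDs i x
    · rw [lintegral_finsetSum _ fun i _ => hsm i]
      exact ENNReal.sum_ne_top.2 fun i _ => int_s hφ hδ hδ1 (hTi i) hf hf2
  have main := hpara K L (fun i => T0 * 2 ^ i) hTi
    (fun i j hij => mul_le_mul_of_nonneg_left (pow_le_pow_right₀ (by norm_num) hij) hT0.le) s hsm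
    (fun i x => hrep φ hφ δ hδ hδ1 _ (hTi i) f hf x)
    (fun i x => by
      have hmk : Measurable fun y : V n => kap n (T0 * 2 ^ i) (x - y) :=
        (measurable_kap n _).comp (measurable_const.sub measurable_id)
      refine ne_top_of_le_ne_top (ENNReal.mul_ne_top (hD i) (ENNReal.ofReal_ne_top (r := Ck))) ?_
      calc _ ≤ ∫⁻ y, D i * kap n (T0 * 2 ^ i) (x - y) := by
            refine lintegral_mono fun y => ?_
            rw [mul_comm]; exact mul_le_mul_left (hDs i y) _
        _ ≤ _ := by
            rw [lintegral_const_mul _ hmk]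
            exact mul_le_mul' le_rfl (hkm _ (hTi i) x))
    hSfin (fun x => ‖f x‖ₑ ^ 2) σ hF2m hσm
    (fun i hi x => by
      calc s i x = (s i x ^ (p / 2)) ^ (1 / (p / 2)) := by
            rw [← ENNReal.rpow_mul, mul_one_div_cancel hq0.ne', ENNReal.rpow_one]
        _ ≤ σ x := ENNReal.rpow_le_rpow
            (Finset.single_le_sum (f := fun i => s i x ^ (p / 2)) (fun _ _ => zero_le) (Finset.mem_range.2 hi)) (by positivity))
    (ENNReal.ofReal (Ch * δ))
    (fun l hl ω hω hωs => by
      refine le_trans (lintegral_mono fun x => mul_le_mul_left ?_ _)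
        (hhigh δ hδ hδ1 (T0 * 2 ^ (l + L)) (hTi _) (T0 * 2 ^ l) (hTi _) ?_ f hf hfm ω hω hωs)
      · rcases le_or_gt (l + L) K with hk | hk
        · obtain ⟨d, rfl⟩ : ∃ d, K = l + L + d := ⟨K - (l + L), by omega⟩
          simp only [hs, sT]
          rw [sum_scales _ hT0]
          exact lintegral_mono_set fun t ht => ht.1
        · rw [Finset.Ico_eq_empty (by omega)]; simp
      · have : T0 * 2 ^ (l + L) / (T0 * 2 ^ l) = (2:ℝ) ^ L := by rw [pow_add]; field_simp
        rw [this]; exact hL1)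
  refine main.trans ?_
  have hsum : ∫⁻ x, σ x ^ (p / 2) ≤ ENNReal.ofReal (Cs * δ ^ e) * (ENNReal.ofReal Cl * ∫⁻ x, ‖f x‖ₑ ^ p) := by
    simp_rw [hσq]
    rw [lintegral_finsetSum _ fun i _ => (hsm i).pow_const _]
    calc _ ≤ ∑ i ∈ Finset.range K, ENNReal.ofReal (Cs * δ ^ e) * ∫⁻ x, ‖PK n (T0 * 2 ^ i) f x‖ₑ ^ p := by
          refine Finset.sum_le_sum fun i _ => ?_
          obtain ⟨g, hg, -⟩ := PK_schwartz (hTi i) f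
          simp only [hs]
          rw [← sT_PK hφ hδ hδ1 (hTi i) f, ← hg]
          exact hsingle δ hδ hδ1 _ (hTi i) g g.integrable g.continuous.measurable (hL2f g)
      _ ≤ _ := by
          rw [← Finset.mul_sum]
          exact mul_le_mul' le_rfl (hLP T0 hT0 K f hf hfm)
  have hFp : ∀ x, (‖f x‖ₑ ^ 2) ^ (p / 2) = ‖f x‖ₑ ^ p := by
    intro x
    rw [← ENNReal.rpow_natCast, ← ENNReal.rpow_mul]; congr 1; push_cast; ring
  have hLe : (L : ℝ≥0∞) = ENNReal.ofReal (L : ℝ) := by simp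
  have hpm : Measurable fun x => ‖f x‖ₑ ^ p := hfm.enorm.pow_const p
  calc _ ≤ ENNReal.ofReal Cp * ∫⁻ x, (2:ℝ≥0∞) ^ (p / 2 - 1) * (ENNReal.ofReal ((Ch * δ) ^ (p / 2)) * ‖f x‖ₑ ^ p +
          ENNReal.ofReal ((L:ℝ) ^ (p / 2)) * σ x ^ (p / 2)) := by
        refine mul_le_mul' le_rfl (lintegral_mono fun x => ?_)
        refine (ENNReal.rpow_add_le_mul_rpow_add_rpow _ _ hq.le).trans (le_of_eq ?_)
        rw [ENNReal.mul_rpow_of_nonneg _ _ hq0.le, ENNReal.mul_rpow_of_nonneg _ _ hq0.le, hFp, hLe,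
          ENNReal.ofReal_rpow_of_nonneg (by positivity) hq0.le, ENNReal.ofReal_rpow_of_nonneg (by positivity) hq0.le]
    _ = ENNReal.ofReal Cp * ((2:ℝ≥0∞) ^ (p / 2 - 1) * (ENNReal.ofReal ((Ch * δ) ^ (p / 2)) * (∫⁻ x, ‖f x‖ₑ ^ p) +
          ENNReal.ofReal ((L:ℝ) ^ (p / 2)) * ∫⁻ x, σ x ^ (p / 2))) := by
        have m2 := hσm.pow_const (p / 2)
        rw [lintegral_const_mul _ ((hpm.const_mul _).fun_add (m2.const_mul _)), lintegral_add_left (hpm.const_mul _),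
          lintegral_const_mul _ hpm, lintegral_const_mul _ m2]
    _ ≤ ENNReal.ofReal Cp * ((2:ℝ≥0∞) ^ (p / 2 - 1) * (ENNReal.ofReal ((Ch * δ) ^ (p / 2)) * (∫⁻ x, ‖f x‖ₑ ^ p) +
          ENNReal.ofReal ((L:ℝ) ^ (p / 2)) * (ENNReal.ofReal (Cs * δ ^ e) * (ENNReal.ofReal Cl * ∫⁻ x, ‖f x‖ₑ ^ p)))) :=
        mul_le_mul' le_rfl (mul_le_mul' le_rfl (add_le_add le_rfl (mul_le_mul' le_rfl hsum)))
    _ = ENNReal.ofReal (Cp * (2 ^ (p / 2 - 1) * ((Ch * δ) ^ (p / 2) + (L:ℝ) ^ (p / 2) * ((Cs * δ ^ e) * Cl)))) * ∫⁻ x, ‖f x‖ₑ ^ p := by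
        have e4 : (2:ℝ≥0∞) ^ (p / 2 - 1) = ENNReal.ofReal (2 ^ (p / 2 - 1)) := by
          rw [← ENNReal.ofReal_rpow_of_nonneg (by norm_num) (by linarith)]; norm_num
        rw [e4, ENNReal.ofReal_mul (p := Cp) (by positivity), ENNReal.ofReal_mul (p := 2 ^ (p / 2 - 1)) (by positivity),
          ENNReal.ofReal_add (by positivity) (by positivity), ENNReal.ofReal_mul (p := (L:ℝ) ^ (p / 2)) (by positivity),
          ENNReal.ofReal_mul (p := Cs * δ ^ e) (by positivity)]
        ring
    _ ≤ _ := by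
        refine mul_le_mul_left (ENNReal.ofReal_le_ofReal ?_) _
        have b1 : (Ch * δ) ^ (p / 2) ≤ Ch ^ (p / 2) * δ ^ (p / (n + 1)) := by
          rw [Real.mul_rpow hCh.le hδ.le]
          refine mul_le_mul_of_nonneg_left (Real.rpow_le_rpow_of_exponent_ge hδ hδ1 ?_) (by positivity)
          gcongr; linarith
        have b2 : (L:ℝ) ^ (p / 2) * ((Cs * δ ^ e) * Cl) ≤ CL ^ (p / 2) * (Cs * Cl) * δ ^ (p / (n + 1)) := by
          have : (L:ℝ) ^ (p / 2) ≤ CL ^ (p / 2) * δ ^ (p / (n + 1) - e) := by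
            refine (Real.rpow_le_rpow (by positivity) hL2 hq0.le).trans (le_of_eq ?_)
            rw [Real.mul_rpow hCL.le (by positivity), ← Real.rpow_mul hδ.le]
            congr 2
            rw [hκ]; field_simp; ring
          calc _ ≤ CL ^ (p / 2) * δ ^ (p / (n + 1) - e) * ((Cs * δ ^ e) * Cl) := by gcongr
            _ = CL ^ (p / 2) * (Cs * Cl) * (δ ^ (p / (n + 1) - e) * δ ^ e) := by ring
            _ = _ := by rw [← Real.rpow_add hδ, sub_add_cancel]
        calc _ ≤ Cp * (2 ^ (p / 2 - 1) * (Ch ^ (p / 2) * δ ^ (p / (n + 1)) + CL ^ (p / 2) * (Cs * Cl) * δ ^ (p / (n + 1)))) :=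
              mul_le_mul_of_nonneg_left (mul_le_mul_of_nonneg_left (add_le_add b1 b2) (by positivity)) hCp.le
          _ = _ := by ring

theorem full {n : ℕ} (hn : 2 ≤ n) {φ : ℝ → ℝ} (hφ : Good φ) (p : ℝ) (hp : 2 ≤ p) (hp2 : p < 2 * (n + 1) / (n - 1)) :
    ∃ C : ℝ, 0 < C ∧ ∀ δ : ℝ, 0 < δ → δ ≤ 1 → ∀ f : SchwartzMap (V n) ℂ,
    ∫⁻ x, (∫⁻ t in Set.Ioi (0:ℝ), ‖FT n φ δ t f x‖ₑ ^ 2 * ENNReal.ofReal t⁻¹) ^ (p / 2) ≤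
      ENNReal.ofReal (C * δ ^ (p / (n + 1))) * ∫⁻ x, ‖f x‖ₑ ^ p := by
  have hn2 : (2:ℝ) ≤ n := by exact_mod_cast hn
  rcases hp.eq_or_lt with rfl | hp
  · refine ⟨2, by norm_num, fun δ hδ hδ1 f => ?_⟩
    have h := FT_L2_t hφ hδ hδ1 (f.integrable (μ := volume))
    simp only [div_self (two_ne_zero' ℝ), ENNReal.rpow_one, ENNReal.rpow_two]
    refine h.trans (mul_le_mul_left (ENNReal.ofReal_le_ofReal ?_) _)
    refine mul_le_mul_of_nonneg_left ?_ (by norm_num)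
    calc δ = δ ^ (1:ℝ) := (Real.rpow_one δ).symm
      _ ≤ _ := Real.rpow_le_rpow_of_exponent_ge hδ hδ1 (by rw [div_le_one (by positivity)]; linarith)
  · obtain ⟨C, hC, h⟩ := trunc hn hφ p hp hp2
    refine ⟨C, hC, fun δ hδ hδ1 f => ?_⟩
    have hf : Integrable (f : V n → ℂ) := f.integrable
    set I : ℕ → Set ℝ := fun N => Set.Ioc (((2:ℝ) ^ N)⁻¹) (2 ^ N) with hI
    have hmono : Monotone I := by
      intro a b hab
      have : (2:ℝ) ^ a ≤ 2 ^ b := pow_le_pow_right₀ (by norm_num) hab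
      exact Set.Ioc_subset_Ioc (inv_anti₀ (by positivity) this) this
    have hU : ⋃ N, I N = Set.Ioi 0 := by
      ext t
      simp only [hI, Set.mem_iUnion, Set.mem_Ioc, Set.mem_Ioi]
      constructor
      · rintro ⟨N, h1, -⟩; exact lt_trans (by positivity) h1
      · intro ht
        obtain ⟨N1, h1⟩ := pow_unbounded_of_one_lt t (by norm_num : (1:ℝ) < 2)
        obtain ⟨N2, h2⟩ := pow_unbounded_of_one_lt t⁻¹ (by norm_num : (1:ℝ) < 2)
        have h3 : (2:ℝ) ^ N1 ≤ 2 ^ (max N1 N2) := pow_le_pow_right₀ (by norm_num) (le_max_left _ _)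
        have h4 : (2:ℝ) ^ N2 ≤ 2 ^ (max N1 N2) := pow_le_pow_right₀ (by norm_num) (le_max_right _ _)
        exact ⟨max N1 N2, inv_lt_of_inv_lt₀ ht (h2.trans_le h4), h1.le.trans h3⟩
    set a : ℕ → V n → ℝ≥0∞ := fun N x => ∫⁻ t in I N, ‖FT n φ δ t f x‖ₑ ^ 2 * ENNReal.ofReal t⁻¹ with ha
    have hlim : ∀ x, Tendsto (fun N => a N x ^ (p / 2)) atTop
        (𝓝 ((∫⁻ t in Set.Ioi (0:ℝ), ‖FT n φ δ t f x‖ₑ ^ 2 * ENNReal.ofReal t⁻¹) ^ (p / 2))) := by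
      intro x
      refine ((ENNReal.continuous_rpow_const).tendsto _).comp ?_
      rw [← hU, setLIntegral_iUnion_of_directed _ hmono.directed_le]
      exact tendsto_atTop_iSup fun i j hij => lintegral_mono_set (hmono hij)
    refine le_of_tendsto' (lintegral_tendsto_of_tendsto_of_monotone
      (fun N => ((measurable_tint hφ δ hf (I N)).pow_const (p / 2)).aemeasurable)
      (ae_of_all _ fun x i j hij => ENNReal.rpow_le_rpow (lintegral_mono_set (hmono hij)) (by linarith))
      (ae_of_all _ hlim)) fun N => ?_
    refine le_trans (le_of_eq ?_) (h δ hδ hδ1 f (((2:ℝ) ^ N)⁻¹) (by positivity) (2 * N))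
    refine lintegral_congr fun x => ?_
    congr 1
    simp only [sT]
    have := sum_scales (fun t => ‖FT n φ δ t f x‖ₑ ^ 2 * ENNReal.ofReal t⁻¹) (T0 := ((2:ℝ) ^ N)⁻¹) (by positivity) 0 (2 * N)
    rw [zero_add, ← Finset.range_eq_Ico, pow_zero, mul_one] at this
    rw [this, hI]
    have e : ((2:ℝ) ^ N)⁻¹ * 2 ^ (2 * N) = 2 ^ N := by rw [two_mul, pow_add]; field_simp
    rw [e]

end SqFn

theorem squareFn_Lp_bound (n : ℕ) (hn : 2 ≤ n) (φ : ℝ → ℝ)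
    (hφsmooth : ContDiff ℝ (⊤ : ℕ∞) φ) (hφbdd : ∀ s : ℝ, |φ s| ≤ 1)
    (hφsupp : ∀ s : ℝ, 1 / 2 < |s| → φ s = 0)
    (p : ℝ) (hp1 : 2 ≤ p) (hp2 : p < 2 * ((n : ℝ) + 1) / ((n : ℝ) - 1)) :
    ∃ C : ℝ, 0 < C ∧ ∀ δ : ℝ, 0 < δ → δ ≤ 1 →
      ∀ f : SchwartzMap (EuclideanSpace ℝ (Fin n)) ℂ,
        (∫⁻ x, squareFn n φ δ (⇑f) x ^ p ∂volume) ^ (1 / p)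
          ≤ ENNReal.ofReal (C * δ ^ (1 / ((n : ℝ) + 1))) *
              eLpNorm f (ENNReal.ofReal p) volume := by
  obtain ⟨C, hC, h⟩ := SqFn.full hn (φ := φ) ⟨hφsmooth, hφbdd, hφsupp⟩ p hp1 hp2
  have hp0 : 0 < p := by linarith
  refine ⟨C ^ (1 / p), Real.rpow_pos_of_pos hC _, fun δ hδ hδ1 f => ?_⟩
  have key : ∀ x, squareFn n φ δ (⇑f) x ^ p
      = (∫⁻ t in Set.Ioi (0 : ℝ), ‖SqFn.FT n φ δ t f x‖ₑ ^ 2 * ENNReal.ofReal t⁻¹) ^ (p / 2) := by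
    intro x
    unfold squareFn
    rw [← ENNReal.rpow_mul, show (1 / 2 : ℝ) * p = p / 2 by ring]
    rfl
  simp only [key]
  have hnorm : eLpNorm f (ENNReal.ofReal p) volume = (∫⁻ x, ‖f x‖ₑ ^ p) ^ (1 / p) := by
    rw [eLpNorm_eq_lintegral_rpow_enorm_toReal (by simpa using hp0) ENNReal.ofReal_ne_top,
      ENNReal.toReal_ofReal hp0.le]
  rw [hnorm]
  have hc : ENNReal.ofReal (C ^ (1 / p) * δ ^ (1 / ((n : ℝ) + 1)))
      = ENNReal.ofReal (C * δ ^ (p / ((n : ℝ) + 1))) ^ (1 / p) := by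
    rw [ENNReal.ofReal_rpow_of_nonneg (by positivity) (by positivity),
      Real.mul_rpow hC.le (by positivity), ← Real.rpow_mul hδ.le]
    congr 3
    field_simp
  rw [hc, ← ENNReal.mul_rpow_of_nonneg _ _ (by positivity)]
  exact ENNReal.rpow_le_rpow (h δ hδ hδ1 f) (by positivity)
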